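/- Let 1 < q < ∞ and α > −1. For every f ∈ A^1_α there exist a sequence {a_i} of (1,q)_α-atoms and a sequence {λ_i} of complex numbers such that f = Σ_i λ_i P_α a_i with convergence in A^1_α and Σ_i |λ_i| ≤ C_q ‖f‖_{1,α}, where C_q depends only on n, q, α. Moreover, there is a constant C > 0 depending only on n, q, α such that C^{-1} inf{Σ_i |λ_i|} ≤ ‖f‖_{1,α} ≤ C inf{Σ_i |λ_i|}, where the infimum is taken over all such decompositions of f. -/

import Mathlib

open MeasureTheory Filter Topology
open scoped Classical ENNReal

noncomputable section

/-- `ℂⁿ` with the Euclidean norm. -/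
abbrev En (n : ℕ) := EuclideanSpace ℂ (Fin n)

instance (n : ℕ) : MeasurableSpace (En n) := borel _
instance (n : ℕ) : BorelSpace (En n) := ⟨rfl⟩

/-- The Lebesgue volume measure on `ℂⁿ`. -/
def vol (n : ℕ) : Measure (En n) := Measure.addHaar

/-- The open unit ball `𝔹ₙ` of `ℂⁿ`. -/
def uball (n : ℕ) : Set (En n) := Metric.ball 0 1

/-- The Hermitian pairing `⟨z,w⟩ = ∑ⱼ zⱼ * conj wⱼ`. -/
def herm {n : ℕ} (z w : En n) : ℂ := ∑ j, z j * (starRingEnd ℂ) (w j)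

/-- The orthogonal projection `P_z w` onto the line spanned by `z`. -/
def prj {n : ℕ} (z w : En n) : En n :=
  if z = 0 then 0 else (herm w z / herm z z) • z

/-- The Möbius automorphism `φ_z` of the unit ball. -/
def mobius {n : ℕ} (z w : En n) : En n :=
  ((1 : ℂ) / (1 - herm w z)) •
    (z - prj z w - ((Real.sqrt (1 - ‖z‖ ^ 2) : ℝ) : ℂ) • (w - prj z w))

/-- The Bergman metric `β(z,w)`. -/
def bmet {n : ℕ} (z w : En n) : ℝ :=
  (1 / 2) * Real.log ((1 + ‖mobius z w‖) / (1 - ‖mobius z w‖))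

/-- The Bergman metric ball `D(z,γ)`. -/
def Dball {n : ℕ} (z : En n) (γ : ℝ) : Set (En n) :=
  {w | w ∈ uball n ∧ bmet z w < γ}

/-- The normalizing constant `c_α`. -/
def cnorm (n : ℕ) (α : ℝ) : ℝ :=
  if -1 < α then Real.Gamma (n + α + 1) / (n.factorial * Real.Gamma (α + 1)) else 1

/-- The weighted measure `dv_α = c_α (1-|z|²)^α dv` on the unit ball. -/
def measA (n : ℕ) (α : ℝ) : Measure (En n) :=
  ((vol n).restrict (uball n)).withDensity
    (fun z => ENNReal.ofReal (cnorm n α * (1 - ‖z‖ ^ 2) ^ α))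

/-- The invariant measure `dτ = (1-|z|²)^{-(n+1)} dv` on the unit ball. -/
def measTau (n : ℕ) : Measure (En n) :=
  ((vol n).restrict (uball n)).withDensity
    (fun z => ENNReal.ofReal ((1 - ‖z‖ ^ 2) ^ (-((n : ℝ) + 1))))

/-- The Bergman space (quasi-)norm `‖f‖_{p,α}`, valued in `ℝ≥0∞`. -/
def apnorm (n : ℕ) (p α : ℝ) (f : En n → ℂ) : ℝ≥0∞ :=
  (∫⁻ z, ENNReal.ofReal (‖f z‖ ^ p) ∂measA n α) ^ (1 / p)

/-- The radial derivative `Rf(z) = ∑ z_k ∂f/∂z_k = Df(z)[z]`. -/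
def radD {n : ℕ} (f : En n → ℂ) (z : En n) : ℂ := fderiv ℂ f z z

/-- Iterated radial derivative `R^k f`. -/
def radIter {n : ℕ} : ℕ → (En n → ℂ) → En n → ℂ
  | 0, f => f
  | (k + 1), f => radD (radIter k f)

/-- The pseudo-metric `ϱ` on the unit ball. -/
def rho {n : ℕ} (z w : En n) : ℝ :=
  if z ≠ 0 ∧ w ≠ 0 then
    |‖z‖ - ‖w‖| + ‖1 - herm z w / ((‖z‖ : ℂ) * (‖w‖ : ℂ))‖
  else ‖z‖ + ‖w‖

/-- The Carleson tube `Q_r(ζ) = {z ∈ 𝔹ₙ : |1-⟨z,ζ⟩|^{1/2} < r}`. -/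
def ctube (n : ℕ) (ζ : En n) (r : ℝ) : Set (En n) :=
  {z | z ∈ uball n ∧ ‖1 - herm z ζ‖ ^ ((1 : ℝ) / 2) < r}

/-- A `(1,q)_α`-atom with respect to Carleson tubes. -/
def IsAtomCT (n : ℕ) (q α : ℝ) (a : En n → ℂ) : Prop :=
  (a = fun _ => 1) ∨
  ∃ (ζ : En n) (r : ℝ), ‖ζ‖ = 1 ∧ 0 < r ∧
    (∀ z, z ∉ ctube n ζ r → a z = 0) ∧
    (∫⁻ z, ENNReal.ofReal (‖a z‖ ^ q) ∂measA n α) ^ (1 / q) ≤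
      (measA n α (ctube n ζ r)) ^ (1 / q - 1) ∧
    ∫ z, a z ∂measA n α = 0

/-- The Bergman projection `P_α g(z) = ∫ (1-⟨z,w⟩)^{-(n+1+α)} g(w) dv_α(w)`. -/
def bergProj (n : ℕ) (α : ℝ) (g : En n → ℂ) (z : En n) : ℂ :=
  ∫ w, g w / (1 - herm z w) ^ ((((n : ℝ) + 1 + α : ℝ)) : ℂ) ∂measA n α

/-- The set of quantities `∑ᵢ |λᵢ|` over all atomic decompositions
`f = ∑ᵢ λᵢ P_α aᵢ` (convergence in the norm of `A¹_α`). -/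
def atomDecompSums (n : ℕ) (q α : ℝ) (f : En n → ℂ) : Set ℝ≥0∞ :=
  {t | ∃ (a : ℕ → En n → ℂ) (lam : ℕ → ℂ), (∀ i, IsAtomCT n q α (a i)) ∧
    Tendsto (fun N => ∫⁻ z,
        ENNReal.ofReal ‖f z - ∑ i ∈ Finset.range N, lam i * bergProj n α (a i) z‖ ∂measA n α)
      atTop (𝓝 0) ∧
    t = ∑' i, ENNReal.ofReal ‖lam i‖}




theorem herm_eq {n : ℕ} (z w : En n) : herm z w = inner ℂ w z := by
  simp [herm, PiLp.inner_apply]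

theorem norm_herm_le {n : ℕ} (z w : En n) : ‖herm z w‖ ≤ ‖z‖ * ‖w‖ := by
  rw [herm_eq, mul_comm]; exact norm_inner_le_norm _ _

theorem herm_conj {n : ℕ} (z w : En n) : (starRingEnd ℂ) (herm z w) = herm w z := by
  rw [herm_eq, herm_eq, inner_conj_symm]

theorem herm_add_left {n : ℕ} (z z' w : En n) : herm (z + z') w = herm z w + herm z' w := by
  simp [herm_eq]
theorem herm_add_right {n : ℕ} (z w w' : En n) : herm z (w + w') = herm z w + herm z w' := by
  simp [herm_eq]
theorem herm_sub_left {n : ℕ} (z z' w : En n) : herm (z - z') w = herm z w - herm z' w := by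
  simp [herm_eq]
theorem herm_sub_right {n : ℕ} (z w w' : En n) : herm z (w - w') = herm z w - herm z w' := by
  simp [herm_eq]
theorem herm_smul_left {n : ℕ} (c : ℂ) (z w : En n) : herm (c • z) w = c * herm z w := by
  simp [herm_eq]
theorem herm_smul_right {n : ℕ} (c : ℂ) (z w : En n) :
    herm z (c • w) = (starRingEnd ℂ) c * herm z w := by
  simp [herm_eq, mul_comm]
theorem herm_self {n : ℕ} (z : En n) : herm z z = ((‖z‖ ^ 2 : ℝ) : ℂ) := by
  rw [herm_eq, inner_self_eq_norm_sq_to_K]; simp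

theorem continuous_herm {n : ℕ} : Continuous (fun p : En n × En n => herm p.1 p.2) := by
  simp only [herm_eq]; fun_prop

theorem continuous_herm_left {n : ℕ} (w : En n) : Continuous (fun z : En n => herm z w) := by
  simp only [herm_eq]; fun_prop
theorem continuous_herm_right {n : ℕ} (w : En n) : Continuous (fun z : En n => herm w z) := by
  simp only [herm_eq]; fun_prop

theorem norm_sq_eq {n : ℕ} (z ζ : En n) (hζ : ‖ζ‖ = 1) :
    ‖z‖ ^ 2 = ‖herm z ζ‖ ^ 2 + ‖z - herm z ζ • ζ‖ ^ 2 := by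
  have h0 : inner ℂ (herm z ζ • ζ) (z - herm z ζ • ζ) = 0 := by
    rw [← herm_eq, herm_sub_left, herm_smul_left, herm_smul_right, herm_smul_right, herm_self, hζ]
    simp [mul_comm]
  have := norm_add_sq_eq_norm_sq_add_norm_sq_of_inner_eq_zero (𝕜 := ℂ) _ _ h0
  rw [add_sub_cancel, norm_smul, hζ, mul_one] at this
  nlinarith [this]

theorem herm_decomp {n : ℕ} (z w ζ : En n) (hζ : ‖ζ‖ = 1) :
    herm z w = herm z ζ * (starRingEnd ℂ) (herm w ζ)
      + herm (z - herm z ζ • ζ) (w - herm w ζ • ζ) := by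
  simp only [herm_sub_left, herm_sub_right, herm_smul_left, herm_smul_right, herm_self, hζ,
    herm_conj]
  simp

theorem perp_sq_le {n : ℕ} (z ζ : En n) (hζ : ‖ζ‖ = 1) (hz : ‖z‖ ≤ 1) :
    ‖z - herm z ζ • ζ‖ ^ 2 ≤ 2 * ‖1 - herm z ζ‖ := by
  have h1 := norm_sq_eq z ζ hζ
  have h2 : ‖herm z ζ‖ ≤ 1 := (norm_herm_le z ζ).trans (by rw [hζ]; linarith)
  have h3 : 1 - ‖herm z ζ‖ ≤ ‖1 - herm z ζ‖ := by
    have := norm_sub_norm_le (1 : ℂ) (herm z ζ); simpa using this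
  nlinarith [norm_nonneg z, norm_nonneg (herm z ζ)]

theorem quasi_tri {n : ℕ} (z w ζ : En n) (hζ : ‖ζ‖ = 1) (hz : ‖z‖ ≤ 1) (hw : ‖w‖ ≤ 1) :
    ‖herm z w - herm z ζ‖ ≤ ‖1 - herm w ζ‖
      + 2 * (√‖1 - herm z ζ‖ * √‖1 - herm w ζ‖) := by
  have h1 := herm_decomp z w ζ hζ
  have h2 : ‖herm z ζ‖ ≤ 1 := (norm_herm_le z ζ).trans (by rw [hζ]; linarith)
  have e : herm z w - herm z ζ = herm z ζ * (starRingEnd ℂ) (herm w ζ - 1)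
      + herm (z - herm z ζ • ζ) (w - herm w ζ • ζ) := by
    rw [h1]; simp; ring
  rw [e]
  refine (norm_add_le _ _).trans (add_le_add ?_ ?_)
  · rw [norm_mul, RCLike.norm_conj, norm_sub_rev]
    exact mul_le_of_le_one_left (norm_nonneg _) h2
  · refine (norm_herm_le _ _).trans ?_
    have a1 : ‖z - herm z ζ • ζ‖ ≤ √(2 * ‖1 - herm z ζ‖) := Real.le_sqrt_of_sq_le (perp_sq_le z ζ hζ hz)
    have a2 : ‖w - herm w ζ • ζ‖ ≤ √(2 * ‖1 - herm w ζ‖) := Real.le_sqrt_of_sq_le (perp_sq_le w ζ hζ hw)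
    refine (mul_le_mul a1 a2 (norm_nonneg _) (Real.sqrt_nonneg _)).trans (le_of_eq ?_)
    rw [Real.sqrt_mul (by norm_num), Real.sqrt_mul (by norm_num)]
    have : √(2:ℝ) * √2 = 2 := Real.mul_self_sqrt (by norm_num)
    linear_combination (√‖1 - herm z ζ‖ * √‖1 - herm w ζ‖) * this

theorem re_pos {n : ℕ} (z w : En n) (h : ‖z‖ * ‖w‖ < 1) : 0 < (1 - herm z w).re := by
  have := (Complex.re_le_norm (herm z w)).trans (norm_herm_le z w)
  simp; linarith

theorem one_sub_herm_ne {n : ℕ} (z w : En n) (h : ‖z‖ * ‖w‖ < 1) : 1 - herm z w ≠ 0 := by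
  intro h0; have := re_pos z w h; rw [h0] at this; simp at this

theorem le_one_sub_herm {n : ℕ} (z w : En n) : 1 - ‖z‖ * ‖w‖ ≤ ‖1 - herm z w‖ := by
  have := norm_sub_norm_le (1 : ℂ) (herm z w)
  have h := norm_herm_le z w
  simp at this; linarith

theorem le_one_sub_herm' {n : ℕ} (z w : En n) (hz : ‖z‖ ≤ 1) : 1 - ‖w‖ ≤ ‖1 - herm z w‖ := by
  have := le_one_sub_herm z w
  nlinarith [norm_nonneg w]

/-- anisotropic dilation -/
def LD {n : ℕ} (ζ : En n) (p q : ℝ) : En n →ₗ[ℂ] En n where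
  toFun v := (q : ℂ) • v + (((p - q : ℝ) : ℂ) * herm v ζ) • ζ
  map_add' x y := by simp only [herm_add_left, mul_add, add_smul, smul_add]; abel
  map_smul' c x := by
    simp only [herm_smul_left, smul_add, smul_smul, RingHom.id_apply]; congr 2 <;> ring

theorem LD_apply {n : ℕ} (ζ : En n) (p q : ℝ) (v : En n) :
    LD ζ p q v = (q : ℂ) • v + (((p - q : ℝ) : ℂ) * herm v ζ) • ζ := rfl

theorem LD_herm {n : ℕ} (ζ : En n) (hζ : ‖ζ‖ = 1) (p q : ℝ) (v : En n) :
    herm (LD ζ p q v) ζ = p * herm v ζ := by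
  rw [LD_apply, herm_add_left, herm_smul_left, herm_smul_left, herm_self, hζ]; simp; ring

theorem LD_perp {n : ℕ} (ζ : En n) (hζ : ‖ζ‖ = 1) (p q : ℝ) (v : En n) :
    LD ζ p q v - herm (LD ζ p q v) ζ • ζ = (q : ℂ) • (v - herm v ζ • ζ) := by
  rw [LD_herm ζ hζ, LD_apply, smul_sub, smul_smul]
  simp only [Complex.ofReal_sub, sub_mul, sub_smul]; abel

theorem LD_norm {n : ℕ} (ζ : En n) (hζ : ‖ζ‖ = 1) (p q : ℝ) (v : En n) :
    ‖LD ζ p q v‖ ^ 2 = p ^ 2 * ‖herm v ζ‖ ^ 2 + q ^ 2 * (‖v‖ ^ 2 - ‖herm v ζ‖ ^ 2) := by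
  rw [norm_sq_eq _ ζ hζ, LD_perp ζ hζ, LD_herm ζ hζ, norm_mul, norm_smul]
  have := norm_sq_eq v ζ hζ
  simp only [mul_pow, Complex.norm_real, Real.norm_eq_abs, sq_abs]
  rw [this]; ring

theorem LD_adj {n : ℕ} (ζ : En n) (p q : ℝ) (z v : En n) :
    herm z (LD ζ p q v) = herm (LD ζ p q z) v := by
  simp only [LD_apply, herm_add_left, herm_add_right, herm_smul_left, herm_smul_right, map_mul,
    herm_conj, Complex.conj_ofReal]
  ring

theorem LD_comp {n : ℕ} (ζ : En n) (hζ : ‖ζ‖ = 1) (p q p' q' : ℝ) (v : En n) :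
    LD ζ p q (LD ζ p' q' v) = LD ζ (p * p') (q * q') v := by
  rw [LD_apply, LD_herm ζ hζ, LD_apply, LD_apply]
  simp only [smul_add, smul_smul, add_assoc, ← add_smul]
  congr 2
  · push_cast; ring
  · push_cast; ring

theorem LD_one {n : ℕ} (ζ : En n) (v : En n) : LD ζ 1 1 v = v := by
  simp [LD_apply]

theorem LD_det {n : ℕ} (hn : 1 ≤ n) (ζ : En n) (hζ : ‖ζ‖ = 1) (p q : ℝ) (hq : q ≠ 0) :
    LinearMap.det (LD ζ p q) = (p : ℂ) * q ^ (n - 1) := by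
  have hq' : (q : ℂ) ≠ 0 := by exact_mod_cast hq
  let f : Module.Dual ℂ (En n) :=
    { toFun := fun v => herm v ζ
      map_add' := fun x y => herm_add_left x y ζ
      map_smul' := fun c x => herm_smul_left c x ζ }
  have e : LD ζ p q = (q : ℂ) • LinearMap.transvection f ((((p - q : ℝ) : ℂ) / q) • ζ) := by
    ext1 v
    rw [LD_apply, LinearMap.smul_apply, LinearMap.transvection.apply, smul_add, smul_smul, smul_smul]
    congr 2
    change _ = (q : ℂ) * herm v ζ * _
    field_simp
  rw [e, LinearMap.det_smul, LinearMap.transvection.det]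
  have : f ((((p - q : ℝ) : ℂ) / q) • ζ) = ((p - q : ℝ) : ℂ) / q := by
    change herm _ ζ = _
    rw [herm_smul_left, herm_self, hζ]; simp
  rw [this]
  have hf : Module.finrank ℂ (En n) = n := by simp
  rw [hf]
  obtain ⟨k, rfl⟩ : ∃ k, n = k + 1 := ⟨n - 1, by omega⟩
  simp only [Nat.add_sub_cancel, pow_succ]
  push_cast
  field_simp; ring

instance (n : ℕ) : Measure.IsAddHaarMeasure (vol n) := by unfold vol; infer_instance

theorem vol_map {n : ℕ} (A : En n →ₗ[ℂ] En n) (hA : LinearMap.det A ≠ 0) :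
    Measure.map A (vol n) = ENNReal.ofReal ((‖LinearMap.det A‖ ^ 2)⁻¹) • vol n := by
  have h1 : LinearMap.det (A.restrictScalars ℝ) = ‖LinearMap.det A‖ ^ 2 := by
    rw [LinearMap.det_restrictScalars, Algebra.norm_complex_apply, Complex.normSq_eq_norm_sq]
  have := Measure.map_linearMap_addHaar_eq_smul_addHaar (vol n) (f := A.restrictScalars ℝ)
    (by rw [h1]; positivity)
  rw [h1, abs_of_nonneg (by positivity)] at this
  exact this

theorem measurable_lin {n : ℕ} (A : En n →ₗ[ℂ] En n) : Measurable A :=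
  (LinearMap.continuous_of_finiteDimensional A).measurable

theorem vol_scale {n : ℕ} (A : En n →ₗ[ℂ] En n) (hA : LinearMap.det A ≠ 0) (b : En n) :
    vol n = ENNReal.ofReal (‖LinearMap.det A‖ ^ 2) • Measure.map (fun v => b + A v) (vol n) := by
  have : Measure.map (fun v => b + A v) (vol n)
      = Measure.map (fun x => b + x) (Measure.map A (vol n)) := by
    rw [Measure.map_map (measurable_const_add b) (measurable_lin A)]; rfl
  rw [this, vol_map A hA, Measure.map_smul, map_add_left_eq_self, smul_smul,
    ← ENNReal.ofReal_mul (by positivity), mul_inv_cancel₀ (by positivity)]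
  simp



def TT {n : ℕ} (w : En n) (R : ℝ) : Set (En n) := {z | ‖z‖ < 1 ∧ ‖1 - herm z w‖ < R}

theorem measurableSet_TT {n : ℕ} (w : En n) (R : ℝ) : MeasurableSet (TT w R) := by
  apply IsOpen.measurableSet
  exact (isOpen_lt continuous_norm continuous_const).inter
    (isOpen_lt (continuous_const.sub (continuous_herm_left w)).norm continuous_const)

theorem det_sq {n : ℕ} (hn : 1 ≤ n) (ζ : En n) (hζ : ‖ζ‖ = 1) (δ c : ℝ) (hδ : 0 < δ) (hc : 0 < c) :
    LinearMap.det (LD ζ (δ * c) (√δ * c)) ≠ 0 ∧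
    ‖LinearMap.det (LD ζ (δ * c) (√δ * c))‖ ^ 2 = δ ^ (n + 1) * c ^ (2 * n) := by
  have hs : 0 < √δ := Real.sqrt_pos.2 hδ
  have h2 : (√δ) ^ 2 = δ := Real.sq_sqrt hδ.le
  rw [LD_det hn ζ hζ _ _ (by positivity)]
  constructor
  · have h1 : ((δ * c : ℝ) : ℂ) ≠ 0 := by exact_mod_cast (by positivity : δ * c ≠ 0)
    have h3 : ((√δ * c : ℝ) : ℂ) ≠ 0 := by exact_mod_cast (by positivity : √δ * c ≠ 0)
    exact mul_ne_zero h1 (pow_ne_zero _ h3)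
  · rw [norm_mul, norm_pow, Complex.norm_real, Complex.norm_real, Real.norm_eq_abs, Real.norm_eq_abs,
      abs_of_pos (by positivity), abs_of_pos (by positivity)]
    obtain ⟨k, rfl⟩ : ∃ k, n = k + 1 := ⟨n - 1, by omega⟩
    simp only [Nat.add_sub_cancel]
    calc (δ * c * (√δ * c) ^ k) ^ 2 = δ ^ 2 * c ^ 2 * ((√δ) ^ 2) ^ k * (c ^ 2) ^ k := by ring
      _ = _ := by rw [h2]; ring

theorem vol_TT_le {n : ℕ} (hn : 1 ≤ n) : ∃ C : ℝ, 0 < C ∧ ∀ (ζ : En n) (R : ℝ), ‖ζ‖ = 1 → 0 < R →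
    vol n (TT ζ R) ≤ ENNReal.ofReal (C * R ^ (n + 1)) := by
  have hfin : vol n (Metric.ball 0 2) ≠ ⊤ := measure_ball_lt_top.ne
  refine ⟨(vol n (Metric.ball 0 2)).toReal,
    ENNReal.toReal_pos (Metric.measure_ball_pos _ _ (by norm_num)).ne' hfin, fun ζ R hζ hR => ?_⟩
  obtain ⟨h1, h2⟩ := det_sq hn ζ hζ R 1 hR one_pos
  have hs : 0 < √R := Real.sqrt_pos.2 hR
  have hs2 : (√R) ^ 2 = R := Real.sq_sqrt hR.le
  have hm : Measurable (fun v => ζ + LD ζ (R * 1) (√R * 1) v) := (measurable_lin _).const_add _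
  conv_lhs => rw [vol_scale _ h1 ζ, Measure.smul_apply, Measure.map_apply hm (measurableSet_TT _ _),
    h2, smul_eq_mul, mul_comm]
  rw [ENNReal.ofReal_mul ENNReal.toReal_nonneg, ENNReal.ofReal_toReal hfin]
  simp only [one_pow, mul_one]
  gcongr
  intro v hv
  obtain ⟨hv1, hv2⟩ := hv
  have e1 : herm (ζ + LD ζ (R) (√R) v) ζ = 1 + R * herm v ζ := by
    rw [herm_add_left, LD_herm ζ hζ, herm_self, hζ]; simp
  have e2 := perp_sq_le _ ζ hζ hv1.le
  have e3 : ζ + LD ζ (R) (√R) v - herm (ζ + LD ζ (R) (√R) v) ζ • ζ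
      = (√R : ℂ) • (v - herm v ζ • ζ) := by
    rw [← LD_perp ζ hζ R, e1, LD_herm ζ hζ, add_smul, one_smul]; abel
  rw [e3, norm_smul, mul_pow, Complex.norm_real, Real.norm_eq_abs, sq_abs, hs2] at e2
  rw [e1] at hv2 e2
  have e4 : ‖(1 : ℂ) - (1 + R * herm v ζ)‖ = R * ‖herm v ζ‖ := by
    rw [show (1 : ℂ) - (1 + R * herm v ζ) = -(R * herm v ζ) by ring, norm_neg, norm_mul,
      Complex.norm_real, Real.norm_eq_abs, abs_of_pos hR]
  rw [e4] at hv2 e2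
  have e5 : ‖herm v ζ‖ < 1 := by
    by_contra h; push Not at h; nlinarith
  have e6 : ‖v - herm v ζ • ζ‖ ^ 2 ≤ 2 * ‖herm v ζ‖ := by
    by_contra h; push Not at h; nlinarith
  have e7 := norm_sq_eq v ζ hζ
  simp only [Metric.mem_ball, dist_zero_right]
  nlinarith [norm_nonneg v, norm_nonneg (herm v ζ)]

/-- the box parametrization -/
def bx {n : ℕ} (ζ : En n) (δ : ℝ) (v : En n) : En n :=
  ((1 - δ : ℝ) : ℂ) • ζ + LD ζ (δ * (1/4)) (√δ * (1/4)) v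

theorem bx_herm {n : ℕ} (ζ : En n) (hζ : ‖ζ‖ = 1) (δ : ℝ) (v : En n) :
    herm (bx ζ δ v) ζ = ((1 - δ : ℝ) : ℂ) + ((δ * (1/4) : ℝ) : ℂ) * herm v ζ := by
  rw [bx, herm_add_left, LD_herm ζ hζ, herm_smul_left, herm_self, hζ]; simp

theorem bx_bounds {n : ℕ} (ζ : En n) (hζ : ‖ζ‖ = 1) (δ : ℝ) (hδ : 0 < δ) (hδ1 : δ ≤ 1) (v : En n)
    (hv : ‖v‖ ≤ 2) : δ / 2 ≤ 1 - ‖bx ζ δ v‖ ^ 2 ∧ 1 - ‖bx ζ δ v‖ ^ 2 ≤ 3 * δ ∧ ‖bx ζ δ v‖ < 1 ∧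
      ‖1 - herm (bx ζ δ v) ζ‖ < 2 * δ := by
  have hs2 : (√δ) ^ 2 = δ := Real.sq_sqrt hδ.le
  have hc : ‖herm v ζ‖ ≤ 2 := (norm_herm_le v ζ).trans (by rw [hζ]; linarith)
  have e1 := bx_herm ζ hζ δ v
  have e3 : bx ζ δ v - herm (bx ζ δ v) ζ • ζ
      = ((√δ * (1/4) : ℝ) : ℂ) • (v - herm v ζ • ζ) := by
    rw [← LD_perp ζ hζ (δ * (1/4)), e1, LD_herm ζ hζ, bx, add_smul]; abel
  have e4 := norm_sq_eq (bx ζ δ v) ζ hζ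
  have e5 : ‖bx ζ δ v - herm (bx ζ δ v) ζ • ζ‖ ^ 2 ≤ δ / 4 := by
    rw [e3, norm_smul, mul_pow, Complex.norm_real, Real.norm_eq_abs, sq_abs, mul_pow, hs2]
    have := norm_sq_eq v ζ hζ
    have h4 : ‖v - herm v ζ • ζ‖ ^ 2 ≤ 4 := by
      nlinarith [norm_nonneg v, sq_nonneg ‖herm v ζ‖]
    nlinarith
  have e6 : ‖1 - herm (bx ζ δ v) ζ‖ ≤ 3 / 2 * δ := by
    rw [e1, show (1 : ℂ) - (((1 - δ : ℝ) : ℂ) + ((δ * (1/4) : ℝ) : ℂ) * herm v ζ)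
      = (δ : ℂ) - ((δ * (1/4) : ℝ) : ℂ) * herm v ζ by push_cast; ring]
    refine (norm_sub_le _ _).trans ?_
    rw [norm_mul, Complex.norm_real, Complex.norm_real, Real.norm_eq_abs, Real.norm_eq_abs,
      abs_of_pos hδ, abs_of_pos (by positivity)]
    nlinarith
  have e7 : ‖herm (bx ζ δ v) ζ‖ ≤ 1 - δ / 2 := by
    rw [e1]
    refine (norm_add_le _ _).trans ?_
    rw [norm_mul, Complex.norm_real, Complex.norm_real, Real.norm_eq_abs, Real.norm_eq_abs,
      abs_of_nonneg (by linarith), abs_of_pos (by positivity)]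
    nlinarith
  have e8 : 1 - ‖herm (bx ζ δ v) ζ‖ ≤ ‖1 - herm (bx ζ δ v) ζ‖ := by
    have := norm_sub_norm_le (1 : ℂ) (herm (bx ζ δ v) ζ); simpa using this
  have f1 : δ / 2 ≤ 1 - ‖bx ζ δ v‖ ^ 2 := by
    nlinarith [norm_nonneg (herm (bx ζ δ v) ζ)]
  refine ⟨f1, ?_, ?_, by linarith⟩
  · nlinarith [norm_nonneg (herm (bx ζ δ v) ζ), sq_nonneg ‖bx ζ δ v - herm (bx ζ δ v) ζ • ζ‖]
  · by_contra h; push Not at h; nlinarith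

theorem rpow_bd (x a : ℝ) (h1 : 1/3 ≤ x) (h2 : x ≤ 3) : (3:ℝ) ^ (-|a|) ≤ x ^ a ∧ x ^ a ≤ (3:ℝ) ^ |a| := by
  have hx : 0 < x := by linarith
  have l1 : Real.log x ≤ Real.log 3 := Real.log_le_log hx h2
  have l2 : -Real.log 3 ≤ Real.log x := by
    rw [← Real.log_inv]; exact Real.log_le_log (by norm_num) (by norm_num at h1 ⊢; linarith)
  have l3 : |Real.log x * a| ≤ Real.log 3 * |a| := by
    rw [abs_mul]; exact mul_le_mul_of_nonneg_right (abs_le.2 ⟨l2, l1⟩) (abs_nonneg _)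
  have := abs_le.1 l3
  rw [Real.rpow_def_of_pos (by norm_num : (0:ℝ) < 3), Real.rpow_def_of_pos (by norm_num : (0:ℝ) < 3),
    Real.rpow_def_of_pos hx]
  constructor <;> apply Real.exp_le_exp.2 <;> linarith

theorem bx_rpow {n : ℕ} (ζ : En n) (hζ : ‖ζ‖ = 1) (δ : ℝ) (hδ : 0 < δ) (hδ1 : δ ≤ 1) (v : En n)
    (hv : ‖v‖ ≤ 2) (a : ℝ) : (3:ℝ) ^ (-|a|) * δ ^ a ≤ (1 - ‖bx ζ δ v‖ ^ 2) ^ a ∧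
      (1 - ‖bx ζ δ v‖ ^ 2) ^ a ≤ (3:ℝ) ^ |a| * δ ^ a := by
  obtain ⟨h1, h2, -, -⟩ := bx_bounds ζ hζ δ hδ hδ1 v hv
  have e : 1 - ‖bx ζ δ v‖ ^ 2 = ((1 - ‖bx ζ δ v‖ ^ 2) / δ) * δ := by field_simp
  have hx := rpow_bd ((1 - ‖bx ζ δ v‖ ^ 2) / δ) a (by rw [le_div_iff₀ hδ]; linarith)
    (by rw [div_le_iff₀ hδ]; linarith)
  rw [e, Real.mul_rpow (div_nonneg (by linarith) hδ.le) hδ.le]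
  have := Real.rpow_nonneg hδ.le a
  exact ⟨mul_le_mul_of_nonneg_right hx.1 this, mul_le_mul_of_nonneg_right hx.2 this⟩

theorem cnorm_pos (n : ℕ) (α : ℝ) (hα : -1 < α) : 0 < cnorm n α := by
  rw [cnorm, if_pos hα]
  have h1 : 0 < Real.Gamma (n + α + 1) := Real.Gamma_pos_of_pos (by
    have : (0:ℝ) ≤ n := Nat.cast_nonneg n
    linarith)
  have h2 : 0 < Real.Gamma (α + 1) := Real.Gamma_pos_of_pos (by linarith)
  positivity

theorem measurable_dens (n : ℕ) (α : ℝ) :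
    Measurable (fun z : En n => cnorm n α * (1 - ‖z‖ ^ 2) ^ α) := by
  fun_prop

theorem measurableSet_uball (n : ℕ) : MeasurableSet (uball n) := Metric.isOpen_ball.measurableSet

theorem mem_uball {n : ℕ} {z : En n} : z ∈ uball n ↔ ‖z‖ < 1 := by simp [uball]

theorem lintegral_measA (n : ℕ) (α : ℝ) (F : En n → ℝ≥0∞) : ∫⁻ z, F z ∂measA n α =
    ∫⁻ z in uball n, ENNReal.ofReal (cnorm n α * (1 - ‖z‖ ^ 2) ^ α) * F z ∂vol n := by
  rw [measA, lintegral_withDensity_eq_lintegral_mul_non_measurable]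
  · rfl
  · exact (measurable_dens n α).ennreal_ofReal
  · exact Eventually.of_forall fun z => ENNReal.ofReal_lt_top

theorem measA_apply (n : ℕ) (α : ℝ) (S : Set (En n)) (hS : MeasurableSet S) : measA n α S =
    ∫⁻ z in uball n ∩ S, ENNReal.ofReal (cnorm n α * (1 - ‖z‖ ^ 2) ^ α) ∂vol n := by
  rw [measA, withDensity_apply _ hS, Measure.restrict_restrict hS, Set.inter_comm]

theorem measA_ae (n : ℕ) (α : ℝ) : ∀ᵐ z ∂measA n α, ‖z‖ < 1 := by
  refine (withDensity_absolutelyContinuous _ _).ae_le ?_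
  filter_upwards [ae_restrict_mem (measurableSet_uball n)] with z hz using mem_uball.1 hz

theorem lower_TT {n : ℕ} (hn : 1 ≤ n) (α : ℝ) (hα : -1 < α) : ∃ c : ℝ, 0 < c ∧
    ∀ (ζ : En n) (R : ℝ), ‖ζ‖ = 1 → 0 < R → R ≤ 4 →
      ENNReal.ofReal (c * R ^ (n + 1 + α)) ≤ measA n α (TT ζ R) := by
  have hfin : vol n (Metric.ball 0 1) ≠ ⊤ := measure_ball_lt_top.ne
  have hp : 0 < (vol n (Metric.ball 0 1)).toReal :=
    ENNReal.toReal_pos (Metric.measure_ball_pos _ _ (by norm_num)).ne' hfin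
  have hcn := cnorm_pos n α hα
  refine ⟨cnorm n α * 3 ^ (-|α|) * (1/4) ^ (2 * n) * (1/4) ^ (n + 1 + α) *
    (vol n (Metric.ball 0 1)).toReal, by positivity, fun ζ R hζ hR hR4 => ?_⟩
  set δ := R / 4 with hδdef
  have hδ : 0 < δ := by positivity
  have hδ1 : δ ≤ 1 := by rw [hδdef]; linarith
  obtain ⟨h1, h2⟩ := det_sq hn ζ hζ δ (1/4) hδ (by norm_num)
  have hm : Measurable (bx ζ δ) := (measurable_lin _).const_add _
  rw [measA_apply _ _ _ (measurableSet_TT _ _)]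
  conv_rhs => rw [vol_scale _ h1 (((1 - δ : ℝ) : ℂ) • ζ), h2]
  have hmb : MeasurableSet (uball n ∩ TT ζ R) := (measurableSet_uball n).inter (measurableSet_TT _ _)
  change _ ≤ ∫⁻ z in _, _ ∂(_ • Measure.map (bx ζ δ) (vol n))
  rw [Measure.restrict_smul, lintegral_smul_measure, Measure.restrict_map hm hmb,
    lintegral_map (measurable_dens n α).ennreal_ofReal hm]
  have hsub : Metric.ball 0 1 ⊆ bx ζ δ ⁻¹' (uball n ∩ TT ζ R) := by
    intro v hv
    have hv' : ‖v‖ < 1 := by simpa using hv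
    obtain ⟨-, -, g3, g4⟩ := bx_bounds ζ hζ δ hδ hδ1 v (by linarith)
    exact ⟨mem_uball.2 g3, g3, by rw [hδdef] at g4; linarith⟩
  have key : ENNReal.ofReal (cnorm n α * (3 ^ (-|α|) * δ ^ α)) * vol n (Metric.ball 0 1) ≤
      ∫⁻ v in bx ζ δ ⁻¹' (uball n ∩ TT ζ R),
        ENNReal.ofReal (cnorm n α * (1 - ‖bx ζ δ v‖ ^ 2) ^ α) ∂vol n := by
    refine le_trans ?_ (lintegral_mono_set hsub)
    rw [← setLIntegral_const]
    refine setLIntegral_mono' Metric.isOpen_ball.measurableSet fun v hv => ?_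
    have hv' : ‖v‖ < 1 := by simpa using hv
    apply ENNReal.ofReal_le_ofReal
    exact mul_le_mul_of_nonneg_left (bx_rpow ζ hζ δ hδ hδ1 v (by linarith) α).1 hcn.le
  rw [smul_eq_mul]
  refine le_trans (le_of_eq ?_) (mul_le_mul_right key _)
  conv_rhs => rw [← ENNReal.ofReal_toReal hfin, ← ENNReal.ofReal_mul (by positivity),
    ← ENNReal.ofReal_mul (by positivity)]
  congr 1
  have : (1/4 : ℝ) ^ (n + 1 + α) * R ^ (n + 1 + α) = δ ^ (n + 1) * δ ^ α := by
    rw [← Real.mul_rpow (by norm_num) hR.le, show (1/4 : ℝ) * R = δ by rw [hδdef]; ring,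
      Real.rpow_add hδ]
    norm_cast
  linear_combination (cnorm n α * 3 ^ (-|α|) * (1/4) ^ (2 * n) *
    (vol n (Metric.ball 0 1)).toReal) * this



theorem lint_rpow (s R β : ℝ) (hs : 0 < s) (hR : 0 < R) (hβ : -1 < β) :
    ∫⁻ t : ℝ, (Set.Ioo 0 R).indicator (fun x => ENNReal.ofReal (x ^ β)) (1 - t * s) =
      ENNReal.ofReal (s⁻¹ * (R ^ (β + 1) / (β + 1))) := by
  have hg : Measurable ((Set.Ioo 0 R).indicator (fun x : ℝ => ENNReal.ofReal (x ^ β))) := by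
    refine Measurable.indicator ?_ measurableSet_Ioo
    fun_prop
  have h1 : ∫⁻ t : ℝ, (Set.Ioo 0 R).indicator (fun x => ENNReal.ofReal (x ^ β)) (1 - t * s) =
      ∫⁻ u : ℝ, (Set.Ioo 0 R).indicator (fun x => ENNReal.ofReal (x ^ β)) (1 - u)
        ∂(Measure.map (· * s) volume) := by
    have hm : Measurable (fun u : ℝ =>
        (Set.Ioo 0 R).indicator (fun x : ℝ => ENNReal.ofReal (x ^ β)) (1 - u)) :=
      hg.comp (by fun_prop)
    rw [lintegral_map hm (measurable_mul_const s)]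
  rw [h1, Real.map_volume_mul_right hs.ne', lintegral_smul_measure,
    lintegral_sub_left_eq_self, lintegral_indicator measurableSet_Ioo, smul_eq_mul,
    ENNReal.ofReal_mul (by positivity), abs_of_pos (by positivity)]
  congr 1
  rw [Measure.restrict_congr_set Ioo_ae_eq_Ioc, ← ofReal_integral_eq_lintegral_ofReal,
    ← intervalIntegral.integral_of_le hR.le, integral_rpow (Or.inl hβ), Real.zero_rpow (by linarith),
    sub_zero]
  · exact (intervalIntegral.intervalIntegrable_rpow' hβ).1
  · filter_upwards [ae_restrict_mem measurableSet_Ioc] with x hx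
    exact Real.rpow_nonneg hx.1.le _

theorem lint_dil {n : ℕ} (G : En n → ℝ≥0∞) (hG : Measurable G) (t : ℝ) (ht : 0 < t) :
    ∫⁻ z, G z ∂vol n = ENNReal.ofReal (t ^ (2 * n)) * ∫⁻ z, G ((t : ℂ) • z) ∂vol n := by
  have hd : LinearMap.det ((t : ℂ) • (LinearMap.id : En n →ₗ[ℂ] En n)) = (t : ℂ) ^ n := by
    rw [LinearMap.det_smul]; simp
  have htc : (t : ℂ) ≠ 0 := by exact_mod_cast ht.ne'
  conv_lhs => rw [vol_scale ((t : ℂ) • (LinearMap.id : En n →ₗ[ℂ] En n))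
    (by rw [hd]; exact pow_ne_zero _ htc) 0]
  rw [lintegral_smul_measure, lintegral_map hG ((measurable_lin _).const_add _), hd, smul_eq_mul]
  have : ‖(t : ℂ) ^ n‖ ^ 2 = t ^ (2 * n) := by
    rw [norm_pow, Complex.norm_real, Real.norm_eq_abs, abs_of_pos ht, ← pow_mul, mul_comm]
  rw [this]; simp

theorem upper_neg {n : ℕ} (hn : 1 ≤ n) (β : ℝ) (hβ : -1 < β) : ∃ C : ℝ, 0 < C ∧
    ∀ (ζ : En n) (R : ℝ), ‖ζ‖ = 1 → 0 < R → R ≤ 4 →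
    ∫⁻ z, (TT ζ R ∩ {z | 1/2 < ‖z‖}).indicator (fun z => ENNReal.ofReal ((1 - ‖z‖) ^ β)) z ∂vol n
      ≤ ENNReal.ofReal (C * R ^ (n + 1 + β)) := by
  obtain ⟨C0, hC0, hV⟩ := vol_TT_le hn
  have hβ1 : 0 < β + 1 := by linarith
  refine ⟨5 ^ (2 * n) * (C0 * 2 ^ (n + 1)) * (10 / (β + 1)), by positivity, fun ζ R hζ hR hR4 => ?_⟩
  set G : En n → ℝ≥0∞ :=
    (TT ζ R ∩ {z | 1/2 < ‖z‖}).indicator (fun z => ENNReal.ofReal ((1 - ‖z‖) ^ β)) with hGdef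
  have hSm : MeasurableSet (TT ζ R ∩ {z : En n | 1/2 < ‖z‖}) :=
    (measurableSet_TT _ _).inter (isOpen_lt continuous_const continuous_norm).measurableSet
  have hG : Measurable G := by
    refine Measurable.indicator ?_ hSm
    fun_prop
  have inner : ∀ z : En n, ∫⁻ t in Set.Icc 1 (1 + R), G ((t : ℂ) • z) ≤
      (TT ζ (2 * R)).indicator (fun _ => ENNReal.ofReal (10 / (β + 1) * R ^ (β + 1))) z := by
    intro z
    by_cases hz : z ∈ TT ζ (2 * R) ∧ 1/10 ≤ ‖z‖
    · rw [Set.indicator_of_mem hz.1]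
      have hs : 0 < ‖z‖ := by linarith [hz.2]
      calc ∫⁻ t in Set.Icc 1 (1 + R), G ((t : ℂ) • z)
          ≤ ∫⁻ t in Set.Icc 1 (1 + R),
            (Set.Ioo 0 R).indicator (fun x => ENNReal.ofReal (x ^ β)) (1 - t * ‖z‖) := by
            refine setLIntegral_mono' measurableSet_Icc fun t ht => ?_
            have hn' : ‖(t : ℂ) • z‖ = t * ‖z‖ := by
              rw [norm_smul, Complex.norm_real, Real.norm_eq_abs, abs_of_pos (by linarith [ht.1])]
            by_cases h : (t : ℂ) • z ∈ TT ζ R ∩ {z : En n | 1/2 < ‖z‖}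
            · have h3 := le_one_sub_herm ((t : ℂ) • z) ζ
              rw [hζ, mul_one, hn'] at h3
              have h4 := h.1.1
              rw [hn'] at h4
              rw [hGdef, Set.indicator_of_mem h, Set.indicator_of_mem, hn']
              exact ⟨by linarith, lt_of_le_of_lt h3 h.1.2⟩
            · rw [hGdef, Set.indicator_of_notMem h]; exact zero_le
        _ ≤ ∫⁻ t : ℝ, (Set.Ioo 0 R).indicator (fun x => ENNReal.ofReal (x ^ β)) (1 - t * ‖z‖) :=
            setLIntegral_le_lintegral _ _
        _ = _ := lint_rpow _ _ _ hs hR hβ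
        _ ≤ _ := by
            apply ENNReal.ofReal_le_ofReal
            have : ‖z‖⁻¹ ≤ 10 := by
              rw [inv_le_comm₀ hs (by norm_num)]; linarith [hz.2]
            calc ‖z‖⁻¹ * (R ^ (β + 1) / (β + 1)) ≤ 10 * (R ^ (β + 1) / (β + 1)) := by gcongr
              _ = _ := by ring
    · have h0 : ∫⁻ t in Set.Icc 1 (1 + R), G ((t : ℂ) • z) = ∫⁻ t in Set.Icc 1 (1 + R), 0 := by
        refine setLIntegral_congr_fun measurableSet_Icc fun t ht => ?_
        have ht0 : 0 < t := by linarith [ht.1]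
        have hn' : ‖(t : ℂ) • z‖ = t * ‖z‖ := by
          rw [norm_smul, Complex.norm_real, Real.norm_eq_abs, abs_of_pos ht0]
        rw [hGdef]
        refine Set.indicator_of_notMem (fun h => hz ?_) _
        obtain ⟨⟨h1, h2⟩, h3⟩ := h
        simp only [Set.mem_setOf_eq] at h3
        rw [hn'] at h1 h3
        rw [herm_smul_left] at h2
        have hz1 : ‖z‖ < 1 := by nlinarith [norm_nonneg z, ht.1]
        have hh : ‖herm z ζ‖ ≤ 1 := (norm_herm_le z ζ).trans (by rw [hζ]; linarith)
        refine ⟨⟨hz1, ?_⟩, by nlinarith [ht.2, norm_nonneg z]⟩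
        have e : 1 - herm z ζ = (1 - t * herm z ζ) + ((t - 1 : ℝ) : ℂ) * herm z ζ := by
          push_cast; ring
        rw [e]
        refine lt_of_le_of_lt (norm_add_le _ _) ?_
        rw [norm_mul, Complex.norm_real, Real.norm_eq_abs, abs_of_nonneg (by linarith [ht.1])]
        nlinarith [ht.1, ht.2, norm_nonneg (herm z ζ)]
      rw [h0]; simp
  have hmeas2 : Measurable (fun p : ℝ × En n => G ((p.1 : ℂ) • p.2)) :=
    hG.comp (by fun_prop)
  have key : ENNReal.ofReal R * ∫⁻ z, G z ∂vol n ≤ ENNReal.ofReal (R *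
      (5 ^ (2 * n) * (C0 * 2 ^ (n + 1)) * (10 / (β + 1)) * R ^ (n + 1 + β))) := by
    calc ENNReal.ofReal R * ∫⁻ z, G z ∂vol n = ∫⁻ t in Set.Icc 1 (1 + R), (∫⁻ z, G z ∂vol n) := by
          rw [setLIntegral_const, Real.volume_Icc, mul_comm]; simp
      _ ≤ ∫⁻ t in Set.Icc 1 (1 + R), ENNReal.ofReal (5 ^ (2 * n)) * ∫⁻ z, G ((t : ℂ) • z) ∂vol n := by
          refine setLIntegral_mono' measurableSet_Icc fun t ht => ?_
          rw [lint_dil G hG t (by linarith [ht.1])]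
          gcongr
          · linarith [ht.1]
          · linarith [ht.2]
      _ = ENNReal.ofReal (5 ^ (2 * n)) * ∫⁻ t in Set.Icc 1 (1 + R), ∫⁻ z, G ((t : ℂ) • z) ∂vol n := by
          rw [lintegral_const_mul]
          exact hmeas2.lintegral_prod_right'
      _ = ENNReal.ofReal (5 ^ (2 * n)) * ∫⁻ z, (∫⁻ t in Set.Icc 1 (1 + R), G ((t : ℂ) • z)) ∂vol n := by
          rw [lintegral_lintegral_swap hmeas2.aemeasurable]
      _ ≤ ENNReal.ofReal (5 ^ (2 * n)) * ∫⁻ z, (TT ζ (2 * R)).indicator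
            (fun _ => ENNReal.ofReal (10 / (β + 1) * R ^ (β + 1))) z ∂vol n := by
          gcongr with z; exact inner z
      _ = ENNReal.ofReal (5 ^ (2 * n)) * (ENNReal.ofReal (10 / (β + 1) * R ^ (β + 1)) *
            vol n (TT ζ (2 * R))) := by
          rw [lintegral_indicator (measurableSet_TT _ _), setLIntegral_const]
      _ ≤ ENNReal.ofReal (5 ^ (2 * n)) * (ENNReal.ofReal (10 / (β + 1) * R ^ (β + 1)) *
            ENNReal.ofReal (C0 * (2 * R) ^ (n + 1))) := by
          gcongr; exact hV ζ (2 * R) hζ (by positivity)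
      _ = _ := by
          rw [← ENNReal.ofReal_mul (by positivity), ← ENNReal.ofReal_mul (by positivity)]
          congr 1
          have e1 : R ^ (n + 1 + β) = R ^ n * R ^ (β + 1) := by
            rw [← Real.rpow_natCast, ← Real.rpow_add hR]; congr 1; ring
          rw [e1]; ring
  rw [ENNReal.ofReal_mul hR.le] at key
  exact (ENNReal.mul_le_mul_iff_right (by simpa using hR) ENNReal.ofReal_ne_top).1 key

theorem upper_TT {n : ℕ} (hn : 1 ≤ n) (β : ℝ) (hβ : -1 < β) : ∃ C : ℝ, 0 < C ∧
    ∀ (ζ : En n) (R : ℝ), ‖ζ‖ = 1 → 0 < R →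
      measA n β (TT ζ R) ≤ ENNReal.ofReal (C * R ^ (n + 1 + β)) := by
  obtain ⟨C0, hC0, hV⟩ := vol_TT_le hn
  obtain ⟨C1, hC1, hV1⟩ := upper_neg hn β hβ
  have hc := cnorm_pos n β hβ
  have hexp : (0:ℝ) ≤ n + 1 + β := by have : (0:ℝ) ≤ n := Nat.cast_nonneg n; linarith
  have sub1 : ∀ (ζ : En n) (R : ℝ), uball n ∩ TT ζ R = TT ζ R := fun ζ R =>
    Set.inter_eq_right.2 fun z hz => mem_uball.2 hz.1
  have e1 : ∀ R : ℝ, 0 < R → R ^ (n + 1 + β) = R ^ (n + 1) * R ^ β := fun R hR => by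
    rw [Real.rpow_add hR]; norm_cast
  rcases le_or_gt 0 β with hb | hb
  · refine ⟨cnorm n β * 2 ^ β * C0, by positivity, fun ζ R hζ hR => ?_⟩
    rw [measA_apply _ _ _ (measurableSet_TT _ _), sub1]
    calc _ ≤ ∫⁻ z in TT ζ R, ENNReal.ofReal (cnorm n β * (2 * R) ^ β) ∂vol n := by
          refine setLIntegral_mono' (measurableSet_TT _ _) fun z hz => ?_
          have h1 := le_one_sub_herm z ζ
          rw [hζ, mul_one] at h1
          have := hz.1; have := hz.2
          have := norm_nonneg z
          gcongr
          · nlinarith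
          · nlinarith
      _ = ENNReal.ofReal (cnorm n β * (2 * R) ^ β) * vol n (TT ζ R) := setLIntegral_const _ _
      _ ≤ ENNReal.ofReal (cnorm n β * (2 * R) ^ β) * ENNReal.ofReal (C0 * R ^ (n + 1)) := by
          gcongr; exact hV ζ R hζ hR
      _ = _ := by
          rw [← ENNReal.ofReal_mul (by positivity), e1 R hR, Real.mul_rpow (by norm_num) hR.le]
          congr 1; ring
  · have main : ∀ (ζ : En n) (R : ℝ), ‖ζ‖ = 1 → 0 < R → R ≤ 4 → measA n β (TT ζ R) ≤
        ENNReal.ofReal ((cnorm n β * C1 + cnorm n β * (3/4) ^ β * C0 * 4 ^ (-β)) * R ^ (n + 1 + β)) := by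
      intro ζ R hζ hR hR4
      rw [measA_apply _ _ _ (measurableSet_TT _ _), sub1]
      have hSm : MeasurableSet (TT ζ R ∩ {z : En n | 1/2 < ‖z‖}) :=
        (measurableSet_TT _ _).inter (isOpen_lt continuous_const continuous_norm).measurableSet
      calc _ ≤ ∫⁻ z in TT ζ R, (ENNReal.ofReal (cnorm n β) *
              (TT ζ R ∩ {z | 1/2 < ‖z‖}).indicator (fun z => ENNReal.ofReal ((1 - ‖z‖) ^ β)) z
              + ENNReal.ofReal (cnorm n β * (3/4) ^ β)) ∂vol n := by
            refine setLIntegral_mono' (measurableSet_TT _ _) fun z hz => ?_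
            have hz1 := hz.1
            have hz0 := norm_nonneg z
            by_cases h : 1/2 < ‖z‖
            · have hmem : z ∈ TT ζ R ∩ {z : En n | 1/2 < ‖z‖} := ⟨hz, h⟩
              rw [Set.indicator_of_mem hmem,
                ← ENNReal.ofReal_mul hc.le]
              refine le_add_right (ENNReal.ofReal_le_ofReal ?_)
              gcongr 1
              exact Real.rpow_le_rpow_of_nonpos (by linarith) (by nlinarith) hb.le
            · refine le_add_left (ENNReal.ofReal_le_ofReal ?_)
              gcongr 1
              push Not at h
              exact Real.rpow_le_rpow_of_nonpos (by norm_num) (by nlinarith) hb.le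
        _ = ENNReal.ofReal (cnorm n β) * (∫⁻ z in TT ζ R, (TT ζ R ∩ {z | 1/2 < ‖z‖}).indicator
              (fun z => ENNReal.ofReal ((1 - ‖z‖) ^ β)) z ∂vol n)
              + ENNReal.ofReal (cnorm n β * (3/4) ^ β) * vol n (TT ζ R) := by
            have hGm : Measurable ((TT ζ R ∩ {z : En n | 1/2 < ‖z‖}).indicator
              (fun z => ENNReal.ofReal ((1 - ‖z‖) ^ β))) := by
              refine Measurable.indicator ?_ hSm
              fun_prop
            rw [lintegral_add_right _ measurable_const, lintegral_const_mul _ hGm, setLIntegral_const]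
        _ ≤ ENNReal.ofReal (cnorm n β) * ENNReal.ofReal (C1 * R ^ (n + 1 + β))
              + ENNReal.ofReal (cnorm n β * (3/4) ^ β) * ENNReal.ofReal (C0 * R ^ (n + 1)) := by
            gcongr
            · exact (setLIntegral_le_lintegral _ _).trans (hV1 ζ R hζ hR hR4)
            · exact hV ζ R hζ hR
        _ ≤ _ := by
            rw [← ENNReal.ofReal_mul (by positivity), ← ENNReal.ofReal_mul (by positivity),
              ← ENNReal.ofReal_add (by positivity) (by positivity)]
            apply ENNReal.ofReal_le_ofReal
            have e2 : (1:ℝ) ≤ 4 ^ (-β) * R ^ β := by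
              have := Real.rpow_le_rpow_of_nonpos hR hR4 hb.le
              rw [Real.rpow_neg (by norm_num)]
              have h4 : (0:ℝ) < 4 ^ β := by positivity
              rw [inv_mul_eq_div, le_div_iff₀ h4]; linarith
            have e3 : cnorm n β * (3/4) ^ β * (C0 * R ^ (n + 1)) * 1 ≤
              cnorm n β * (3/4) ^ β * (C0 * R ^ (n + 1)) * (4 ^ (-β) * R ^ β) := by gcongr
            rw [e1 R hR]
            nlinarith [e3]
    refine ⟨cnorm n β * C1 + cnorm n β * (3/4) ^ β * C0 * 4 ^ (-β), by positivity,
      fun ζ R hζ hR => ?_⟩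
    rcases le_or_gt R 4 with h | h
    · exact main ζ R hζ hR h
    · have : TT ζ R ⊆ TT ζ 4 := fun z hz => ⟨hz.1, by
        have h1 := norm_sub_le (1:ℂ) (herm z ζ)
        have h2 := norm_herm_le z ζ
        have h3 := hz.1
        rw [hζ] at h2; simp at h1; linarith⟩
      refine (measure_mono this).trans ((main ζ 4 hζ (by norm_num) le_rfl).trans ?_)
      gcongr

theorem exists_unit {n : ℕ} (hn : 1 ≤ n) : ∃ ζ : En n, ‖ζ‖ = 1 :=
  ⟨EuclideanSpace.single ⟨0, hn⟩ 1, by simp⟩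

theorem exists_dir {n : ℕ} (hn : 1 ≤ n) (w : En n) : ∃ ζ : En n, ‖ζ‖ = 1 ∧ w = (‖w‖ : ℂ) • ζ := by
  by_cases h : w = 0
  · obtain ⟨ζ, hζ⟩ := exists_unit hn
    exact ⟨ζ, hζ, by simp [h]⟩
  · have h' : ‖w‖ ≠ 0 := by simpa using h
    refine ⟨((‖w‖ : ℂ)⁻¹) • w, ?_, ?_⟩
    · rw [norm_smul, norm_inv, Complex.norm_real, norm_norm, inv_mul_cancel₀ h']
    · rw [smul_smul, mul_inv_cancel₀ (by exact_mod_cast h'), one_smul]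

theorem upper_TT' {n : ℕ} (hn : 1 ≤ n) (β : ℝ) (hβ : -1 < β) : ∃ C : ℝ, 0 < C ∧
    ∀ (w : En n) (R : ℝ), ‖w‖ ≤ 1 → 0 < R →
      measA n β (TT w R) ≤ ENNReal.ofReal (C * R ^ (n + 1 + β)) := by
  obtain ⟨C, hC, h⟩ := upper_TT hn β hβ
  refine ⟨C * 2 ^ (n + 1 + β), by positivity, fun w R hw hR => ?_⟩
  obtain ⟨ζ, hζ, hwζ⟩ := exists_dir hn w
  have sub : TT w R ⊆ TT ζ (2 * R) := by
    rintro z ⟨h1, h2⟩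
    refine ⟨h1, ?_⟩
    have h3 := le_one_sub_herm' z w h1.le
    have e : 1 - herm z ζ = (1 - herm z w) - ((1 - ‖w‖ : ℝ) : ℂ) * herm z ζ := by
      conv_rhs => rw [hwζ, herm_smul_right]
      simp [norm_smul, hζ]; ring
    have hh : ‖herm z ζ‖ ≤ 1 := (norm_herm_le z ζ).trans (by rw [hζ]; linarith)
    rw [e]
    refine lt_of_le_of_lt (norm_sub_le _ _) ?_
    rw [norm_mul, Complex.norm_real, Real.norm_eq_abs, abs_of_nonneg (by linarith)]
    nlinarith [norm_nonneg (herm z ζ)]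
  refine (measure_mono sub).trans ((h ζ (2 * R) hζ (by positivity)).trans (le_of_eq ?_))
  rw [Real.mul_rpow (by norm_num) hR.le, mul_assoc]

theorem isFinite_measA {n : ℕ} (hn : 1 ≤ n) (β : ℝ) (hβ : -1 < β) : IsFiniteMeasure (measA n β) := by
  obtain ⟨C, hC, h⟩ := upper_TT' hn β hβ
  constructor
  have h1 : measA n β (TT 0 2) = measA n β Set.univ := by
    apply measure_congr
    filter_upwards [measA_ae n β] with z hz
    apply propext
    constructor
    · intro _; trivial
    · intro _; exact ⟨hz, by simp [herm]⟩
  rw [← h1]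
  exact (h 0 2 (by simp) (by norm_num)).trans_lt ENNReal.ofReal_lt_top




theorem dy_sum {X : Type*} [MeasurableSpace X] (μ : Measure X) (F : X → ℝ≥0∞) (S : ℕ → Set X)
    (hS : ∀ k, MeasurableSet (S k)) (M : ℕ → ℝ≥0∞) (A x : ℝ) (hA : 0 ≤ A) (hx : 0 ≤ x) (hx1 : x < 1)
    (hF : ∀ z, F z ≠ 0 → ∃ k, z ∈ S k ∧ F z ≤ M k)
    (hμ : ∀ k, M k * μ (S k) ≤ ENNReal.ofReal (A * x ^ k)) :
    ∫⁻ z, F z ∂μ ≤ ENNReal.ofReal (A / (1 - x)) := by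
  calc ∫⁻ z, F z ∂μ ≤ ∫⁻ z, ∑' k, (S k).indicator (fun _ => M k) z ∂μ := by
        refine lintegral_mono fun z => ?_
        by_cases h : F z = 0
        · rw [h]; exact zero_le
        · obtain ⟨k, hk, hk2⟩ := hF z h
          refine le_trans ?_ (ENNReal.le_tsum k)
          rw [Set.indicator_of_mem hk]; exact hk2
    _ = ∑' k, M k * μ (S k) := by
        rw [lintegral_tsum fun k => (measurable_const.indicator (hS k)).aemeasurable]
        congr 1; ext k
        rw [lintegral_indicator (hS k), setLIntegral_const]
    _ ≤ ∑' k, ENNReal.ofReal (A * x ^ k) := ENNReal.tsum_le_tsum hμ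
    _ = ENNReal.ofReal (A / (1 - x)) := by
        rw [← ENNReal.ofReal_tsum_of_nonneg (fun k => by positivity)
          ((summable_geometric_of_lt_one hx hx1).mul_left A), tsum_mul_left,
          tsum_geometric_of_lt_one hx hx1, div_eq_mul_inv]

theorem dy_far {X : Type*} [MeasurableSpace X] (μ : Measure X) (D : X → ℝ) (hD : Measurable D)
    (C N s : ℝ) (hC : 0 ≤ C) (hN : 0 ≤ N) (hs : 0 < s)
    (h : ∀ R : ℝ, 0 < R → μ {z | D z < R} ≤ ENNReal.ofReal (C * R ^ N)) (ρ : ℝ) (hρ : 0 < ρ) :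
    ∫⁻ z, {z | ρ ≤ D z}.indicator (fun z => ENNReal.ofReal (D z ^ (-N - s))) z ∂μ ≤
      ENNReal.ofReal (C * 2 ^ N / (1 - 2 ^ (-s)) * ρ ^ (-s)) := by
  have hx1 : (2:ℝ) ^ (-s) < 1 := Real.rpow_lt_one_of_one_lt_of_neg (by norm_num) (by linarith)
  have := dy_sum μ ({z | ρ ≤ D z}.indicator (fun z => ENNReal.ofReal (D z ^ (-N - s))))
    (fun k => {z | D z < 2 ^ (k + 1) * ρ}) (fun k => measurableSet_lt hD measurable_const)
    (fun k => ENNReal.ofReal ((2 ^ k * ρ) ^ (-N - s))) (C * 2 ^ N * ρ ^ (-s)) (2 ^ (-s))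
    (by positivity) (by positivity) hx1 ?_ ?_
  · refine this.trans (le_of_eq ?_); congr 1; ring
  · intro z hz
    have hz' : z ∈ {z | ρ ≤ D z} := Set.mem_of_indicator_ne_zero hz
    have hz2 : ρ ≤ D z := hz'
    obtain ⟨k, h1, h2⟩ := exists_nat_pow_near (x := D z / ρ) (y := 2)
      ((one_le_div hρ).2 hz2) (by norm_num)
    rw [le_div_iff₀ hρ] at h1
    rw [div_lt_iff₀ hρ] at h2
    refine ⟨k, h2, ?_⟩
    rw [Set.indicator_of_mem hz']
    exact ENNReal.ofReal_le_ofReal (Real.rpow_le_rpow_of_nonpos (by positivity) h1 (by linarith))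
  · intro k
    refine (mul_le_mul_right (h _ (by positivity)) _).trans (le_of_eq ?_)
    rw [← ENNReal.ofReal_mul (by positivity)]
    congr 1
    have e : ((2:ℝ) ^ (-s)) ^ k = (2 ^ k) ^ (-s) := by
      rw [← Real.rpow_natCast, ← Real.rpow_natCast, ← Real.rpow_mul (by norm_num),
        ← Real.rpow_mul (by norm_num), mul_comm]
    set y := (2 : ℝ) ^ k with hy
    have hy0 : 0 < y := by positivity
    have e2 : (y * ρ) ^ (-N - s) = ((y * ρ) ^ N)⁻¹ * (y ^ (-s) * ρ ^ (-s)) := by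
      rw [sub_eq_add_neg, Real.rpow_add (by positivity), Real.rpow_neg (by positivity) N,
        Real.mul_rpow hy0.le hρ.le (z := -s)]
    rw [e, e2, pow_succ, ← hy, show y * 2 * ρ = 2 * (y * ρ) by ring,
      Real.mul_rpow (by norm_num : (0:ℝ) ≤ 2) (by positivity)]
    have h0 : (y * ρ) ^ N ≠ 0 := by positivity
    field_simp

theorem dy_near {X : Type*} [MeasurableSpace X] (μ : Measure X) (D : X → ℝ) (hD : Measurable D)
    (C N s : ℝ) (hC : 0 ≤ C) (hN : 0 ≤ N) (hs : 0 < s) (hsN : s ≤ N)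
    (h : ∀ R : ℝ, 0 < R → μ {z | D z < R} ≤ ENNReal.ofReal (C * R ^ N)) (ρ : ℝ) (hρ : 0 < ρ) :
    ∫⁻ z, {z | 0 < D z ∧ D z ≤ ρ}.indicator (fun z => ENNReal.ofReal (D z ^ (-N + s))) z ∂μ ≤
      ENNReal.ofReal (C * 2 ^ (N + N) / (1 - 2 ^ (-s)) * ρ ^ s) := by
  have hx1 : (2:ℝ) ^ (-s) < 1 := Real.rpow_lt_one_of_one_lt_of_neg (by norm_num) (by linarith)
  have := dy_sum μ ({z | 0 < D z ∧ D z ≤ ρ}.indicator (fun z => ENNReal.ofReal (D z ^ (-N + s))))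
    (fun k => {z | D z < 2 * ((1/2) ^ k * ρ)}) (fun k => measurableSet_lt hD measurable_const)
    (fun k => ENNReal.ofReal (((1/2) * ((1/2) ^ k * ρ)) ^ (-N + s))) (C * 2 ^ (N + N) * ρ ^ s) (2 ^ (-s))
    (by positivity) (by positivity) hx1 ?_ ?_
  · refine this.trans (le_of_eq ?_); congr 1; ring
  · intro z hz
    have hz' : z ∈ {z | 0 < D z ∧ D z ≤ ρ} := Set.mem_of_indicator_ne_zero hz
    have hz1 := hz'.1
    have hz2 := hz'.2
    obtain ⟨k, h1, h2⟩ := exists_nat_pow_near_of_lt_one (x := D z / ρ) (y := (1/2 : ℝ))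
      (by positivity) ((div_le_one hρ).2 hz2) (by norm_num) (by norm_num)
    rw [lt_div_iff₀ hρ] at h1
    rw [div_le_iff₀ hρ] at h2
    have hp : 0 < (1/2 : ℝ) ^ k * ρ := by positivity
    refine ⟨k, by change D z < _; linarith, ?_⟩
    rw [Set.indicator_of_mem hz']
    refine ENNReal.ofReal_le_ofReal (Real.rpow_le_rpow_of_nonpos (by positivity) ?_ (by linarith))
    rw [pow_succ] at h1; linarith
  · intro k
    refine (mul_le_mul_right (h _ (by positivity)) _).trans ?_
    rw [← ENNReal.ofReal_mul (by positivity)]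
    apply ENNReal.ofReal_le_ofReal
    have e : ((2:ℝ) ^ (-s)) ^ k = ((1/2) ^ k) ^ s := by
      rw [← Real.rpow_natCast, ← Real.rpow_natCast, ← Real.rpow_mul (by norm_num),
        ← Real.rpow_mul (by norm_num), one_div, Real.inv_rpow (by norm_num), ← Real.rpow_neg (by norm_num)]
      congr 1; ring
    set y := (1/2 : ℝ) ^ k with hy
    have hy0 : 0 < y := by positivity
    have e2 : ((1/2 : ℝ) * (y * ρ)) ^ (-N + s) = 2 ^ (N - s) * ((y * ρ) ^ N)⁻¹ * (y ^ s * ρ ^ s) := by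
      rw [Real.mul_rpow (by norm_num) (by positivity), one_div, Real.inv_rpow (by norm_num),
        ← Real.rpow_neg (by norm_num), Real.rpow_add (by positivity), Real.rpow_neg (by positivity) N,
        ← Real.mul_rpow hy0.le hρ.le, mul_assoc]
      congr 2; ring
    rw [e, e2, Real.mul_rpow (by norm_num : (0:ℝ) ≤ 2) (by positivity)]
    have h0 : (y * ρ) ^ N ≠ 0 := by positivity
    have e3 : (2:ℝ) ^ (N - s) * ((y * ρ) ^ N)⁻¹ * (y ^ s * ρ ^ s) * (C * (2 ^ N * (y * ρ) ^ N)) =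
      C * (2 ^ (N - s) * 2 ^ N) * ρ ^ s * y ^ s := by field_simp
    rw [e3, ← Real.rpow_add (by norm_num)]
    have : (2:ℝ) ^ (N - s + N) ≤ 2 ^ (N + N) := Real.rpow_le_rpow_of_exponent_le (by norm_num) (by linarith)
    gcongr





theorem measurable_DD {n : ℕ} (w : En n) : Measurable (fun z : En n => ‖1 - herm z w‖) :=
  (continuous_const.sub (continuous_herm_left w)).norm.measurable

theorem measurable_D2 {n : ℕ} : Measurable (fun p : En n × En n => ‖1 - herm p.1 p.2‖) :=
  (continuous_const.sub continuous_herm).norm.measurable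

theorem meas_D {n : ℕ} (hn : 1 ≤ n) (α : ℝ) (hα : -1 < α) : ∃ C : ℝ, 0 < C ∧
    ∀ (w : En n), ‖w‖ ≤ 1 → ∀ R : ℝ, 0 < R →
      measA n α {z | ‖1 - herm z w‖ < R} ≤ ENNReal.ofReal (C * R ^ (n + 1 + α)) := by
  obtain ⟨C, hC, h⟩ := upper_TT' hn α hα
  refine ⟨C, hC, fun w hw R hR => ?_⟩
  refine le_trans (le_of_eq ?_) (h w R hw hR)
  apply measure_congr
  filter_upwards [measA_ae n α] with z hz
  apply propext
  constructor
  · intro h; exact ⟨hz, h⟩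
  · intro h; exact h.2

theorem npos {n : ℕ} {α : ℝ} (hα : -1 < α) : 0 < (n : ℝ) + 1 + α := by
  have : (0:ℝ) ≤ n := Nat.cast_nonneg n
  linarith

theorem ker_far {n : ℕ} (hn : 1 ≤ n) (α s : ℝ) (hα : -1 < α) (hs : 0 < s) : ∃ C : ℝ, 0 < C ∧
    ∀ (w : En n), ‖w‖ ≤ 1 → ∀ ρ : ℝ, 0 < ρ →
      ∫⁻ z, {z | ρ ≤ ‖1 - herm z w‖}.indicator
        (fun z => ENNReal.ofReal (‖1 - herm z w‖ ^ (-(n + 1 + α) - s))) z ∂measA n α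
        ≤ ENNReal.ofReal (C * ρ ^ (-s)) := by
  obtain ⟨C, hC, h⟩ := meas_D hn α hα
  have hx1 : (2:ℝ) ^ (-s) < 1 := Real.rpow_lt_one_of_one_lt_of_neg (by norm_num) (by linarith)
  have hx2 : 0 < 1 - (2:ℝ) ^ (-s) := by linarith
  exact ⟨C * 2 ^ (n + 1 + α) / (1 - 2 ^ (-s)), by positivity, fun w hw ρ hρ =>
    dy_far _ _ (measurable_DD w) C _ s hC.le (npos hα).le hs (h w hw) ρ hρ⟩

theorem ker_full {n : ℕ} (hn : 1 ≤ n) (α s : ℝ) (hα : -1 < α) (hs : 0 < s) : ∃ C : ℝ, 0 < C ∧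
    ∀ (w : En n), ‖w‖ < 1 →
      ∫⁻ z, ENNReal.ofReal (‖1 - herm z w‖ ^ (-(n + 1 + α) - s)) ∂measA n α
        ≤ ENNReal.ofReal (C * (1 - ‖w‖) ^ (-s)) := by
  obtain ⟨C, hC, h⟩ := ker_far hn α s hα hs
  refine ⟨C, hC, fun w hw => le_trans (le_of_eq ?_) (h w hw.le (1 - ‖w‖) (by linarith))⟩
  apply lintegral_congr_ae
  filter_upwards [measA_ae n α] with z hz
  rw [Set.indicator_of_mem]
  exact le_one_sub_herm' z w hz.le

theorem ker_near {n : ℕ} (hn : 1 ≤ n) (α s : ℝ) (hα : -1 < α) (hs : 0 < s) (hs1 : s ≤ n + 1 + α) :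
    ∃ C : ℝ, 0 < C ∧ ∀ (w : En n), ‖w‖ < 1 → ∀ ρ : ℝ, 0 < ρ →
      ∫⁻ z in {z | ‖1 - herm z w‖ ≤ ρ}, ENNReal.ofReal (‖1 - herm z w‖ ^ (-(n + 1 + α))) ∂measA n α
        ≤ ENNReal.ofReal (C * ρ ^ s * (1 - ‖w‖) ^ (-s)) := by
  obtain ⟨C, hC, h⟩ := meas_D hn α hα
  have hx1 : (2:ℝ) ^ (-s) < 1 := Real.rpow_lt_one_of_one_lt_of_neg (by norm_num) (by linarith)
  have hx2 : 0 < 1 - (2:ℝ) ^ (-s) := by linarith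
  refine ⟨C * 2 ^ (n + 1 + α + (n + 1 + α)) / (1 - 2 ^ (-s)), by positivity, fun w hw ρ hρ => ?_⟩
  have key := dy_near _ _ (measurable_DD w) C _ s hC.le (npos hα).le hs hs1 (h w hw.le) ρ hρ
  have hw1 : 0 < 1 - ‖w‖ := by linarith
  rw [← lintegral_indicator (measurableSet_le (measurable_DD w) measurable_const)]
  calc _ ≤ ∫⁻ z, ENNReal.ofReal ((1 - ‖w‖) ^ (-s)) * {z | 0 < ‖1 - herm z w‖ ∧ ‖1 - herm z w‖ ≤ ρ}.indicator
        (fun z => ENNReal.ofReal (‖1 - herm z w‖ ^ (-(n + 1 + α) + s))) z ∂measA n α := by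
        apply lintegral_mono_ae
        filter_upwards [measA_ae n α] with z hz
        have h1 := le_one_sub_herm' z w hz.le
        have hp : 0 < ‖1 - herm z w‖ := by linarith
        by_cases h2 : ‖1 - herm z w‖ ≤ ρ
        · have m1 : z ∈ {z | ‖1 - herm z w‖ ≤ ρ} := h2
          have m2 : z ∈ {z | 0 < ‖1 - herm z w‖ ∧ ‖1 - herm z w‖ ≤ ρ} := ⟨hp, h2⟩
          rw [Set.indicator_of_mem m1, Set.indicator_of_mem m2, ← ENNReal.ofReal_mul (by positivity)]
          apply ENNReal.ofReal_le_ofReal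
          have e : ‖1 - herm z w‖ ^ (-(n + 1 + α)) =
              ‖1 - herm z w‖ ^ (-s) * ‖1 - herm z w‖ ^ (-(n + 1 + α) + s) := by
            rw [← Real.rpow_add hp]; congr 1; ring
          rw [e]
          gcongr ?_ * _
          exact Real.rpow_le_rpow_of_nonpos hw1 h1 (by linarith)
        · rw [Set.indicator_of_notMem (by exact h2)]; exact zero_le
    _ = ENNReal.ofReal ((1 - ‖w‖) ^ (-s)) * ∫⁻ z, {z | 0 < ‖1 - herm z w‖ ∧ ‖1 - herm z w‖ ≤ ρ}.indicator
        (fun z => ENNReal.ofReal (‖1 - herm z w‖ ^ (-(n + 1 + α) + s))) z ∂measA n α := by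
        rw [lintegral_const_mul']
        exact ENNReal.ofReal_ne_top
    _ ≤ _ := mul_le_mul_right key _
    _ = _ := by
        rw [← ENNReal.ofReal_mul (by positivity)]
        congr 1; ring

theorem int_neg_pow {n : ℕ} (hn : 1 ≤ n) (α η : ℝ) (hα : -1 < α) (hη : 0 ≤ η) (hη1 : -1 < α - η) :
    ∃ C : ℝ, 0 < C ∧ ∀ (ζ : En n) (R : ℝ), ‖ζ‖ = 1 → 0 < R →
      ∫⁻ w in TT ζ R, ENNReal.ofReal ((1 - ‖w‖) ^ (-η)) ∂measA n α
        ≤ ENNReal.ofReal (C * R ^ (n + 1 + α - η)) := by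
  obtain ⟨C, hC, h⟩ := upper_TT' hn (α - η) hη1
  have c1 := cnorm_pos n α hα
  have c2 := cnorm_pos n _ hη1
  refine ⟨2 ^ η * cnorm n α / cnorm n (α - η) * C, by positivity, fun ζ R hζ hR => ?_⟩
  have h3 := h ζ R hζ.le hR
  rw [← lintegral_indicator (measurableSet_TT _ _), lintegral_measA]
  have e : measA n (α - η) (TT ζ R) = ∫⁻ w, (TT ζ R).indicator (fun _ => 1) w ∂measA n (α - η) := by
    rw [lintegral_indicator (measurableSet_TT _ _)]; simp
  rw [e, lintegral_measA] at h3
  calc _ ≤ ∫⁻ z in uball n, ENNReal.ofReal (2 ^ η * cnorm n α / cnorm n (α - η)) *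
        (ENNReal.ofReal (cnorm n (α - η) * (1 - ‖z‖ ^ 2) ^ (α - η)) *
        (TT ζ R).indicator (fun _ => 1) z) ∂vol n := by
        refine setLIntegral_mono' (measurableSet_uball n) fun z hz => ?_
        have hz := mem_uball.1 hz
        by_cases hm : z ∈ TT ζ R
        · rw [Set.indicator_of_mem hm, Set.indicator_of_mem hm, mul_one]
          have p1 : 0 < 1 - ‖z‖ := by linarith
          have p0 := norm_nonneg z
          have p2 : 0 < 1 - ‖z‖ ^ 2 := by nlinarith
          rw [← ENNReal.ofReal_mul (by positivity), ← ENNReal.ofReal_mul (by positivity)]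
          apply ENNReal.ofReal_le_ofReal
          have h5 : (1 - ‖z‖) ^ (-η) ≤ 2 ^ η * (1 - ‖z‖ ^ 2) ^ (-η) := by
            have : (1 - ‖z‖) ^ (-η) ≤ ((1 - ‖z‖ ^ 2) / 2) ^ (-η) :=
              Real.rpow_le_rpow_of_nonpos (by positivity) (by nlinarith) (by linarith)
            refine this.trans (le_of_eq ?_)
            rw [Real.div_rpow p2.le (by norm_num), Real.rpow_neg (by norm_num : (0:ℝ) ≤ 2) η,
              div_inv_eq_mul, mul_comm]
          have h6 : (1 - ‖z‖ ^ 2) ^ (α - η) = (1 - ‖z‖ ^ 2) ^ α * (1 - ‖z‖ ^ 2) ^ (-η) := by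
            rw [← Real.rpow_add p2]; congr 1
          calc cnorm n α * (1 - ‖z‖ ^ 2) ^ α * (1 - ‖z‖) ^ (-η) ≤
              cnorm n α * (1 - ‖z‖ ^ 2) ^ α * (2 ^ η * (1 - ‖z‖ ^ 2) ^ (-η)) := by gcongr
            _ = _ := by rw [h6]; field_simp
        · rw [Set.indicator_of_notMem hm, mul_zero]; exact zero_le
    _ = ENNReal.ofReal (2 ^ η * cnorm n α / cnorm n (α - η)) * _ := by
        rw [lintegral_const_mul' _ _ ENNReal.ofReal_ne_top]
    _ ≤ _ := mul_le_mul_right h3 _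
    _ = _ := by
        rw [← ENNReal.ofReal_mul (by positivity)]
        congr 1
        rw [show (n:ℝ) + 1 + (α - η) = n + 1 + α - η by ring]; ring




theorem sf_measA {n : ℕ} (hn : 1 ≤ n) (α : ℝ) (hα : -1 < α) : SFinite (measA n α) := by
  have := isFinite_measA hn α hα; infer_instance

theorem loc_est {n : ℕ} (hn : 1 ≤ n) (q q' α : ℝ) (hq : q.HolderConjugate q') (hα : -1 < α) :
    ∃ C : ℝ, 0 < C ∧ ∀ (ζ : En n) (R : ℝ), ‖ζ‖ = 1 → 0 < R → R ≤ 4 →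
      ∀ A : En n → ℝ≥0∞, Measurable A → (∀ᵐ w ∂measA n α, w ∉ TT ζ R → A w = 0) →
      ∫⁻ z in {z | ‖1 - herm z ζ‖ < 36 * R},
        ∫⁻ w, A w * ENNReal.ofReal (‖1 - herm z w‖ ^ (-(n + 1 + α))) ∂measA n α ∂measA n α
        ≤ ENNReal.ofReal C *
          ((∫⁻ w, A w ^ q ∂measA n α) ^ (1 / q) * (measA n α (TT ζ R)) ^ (1 / q')) := by
  have hq'0 : 0 < q' := hq.symm.pos
  have hq'1 : 1 < q' := hq.symm.lt
  have hN := npos (n := n) hα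
  set η := (1 + α) / 2 with hη
  have hη0 : 0 < η := by rw [hη]; linarith
  have hεle : η / q' ≤ n + 1 + α := by
    have h1 : η / q' ≤ η := div_le_self hη0.le hq'1.le
    have : (0:ℝ) ≤ n := Nat.cast_nonneg n
    rw [hη] at h1 ⊢; linarith
  obtain ⟨C1, hC1, K1⟩ := ker_near hn α (η / q') hα (by positivity) hεle
  obtain ⟨C2, hC2, K2⟩ := int_neg_pow hn α η hα hη0.le (by rw [hη]; linarith)
  obtain ⟨c, hc, K3⟩ := lower_TT hn α hα
  have := sf_measA hn α hα
  refine ⟨C1 * 49 ^ (η / q') * (C2 / c) ^ (1 / q'), by positivity, fun ζ R hζ hR hR4 A hA hAs => ?_⟩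
  have hm : Measurable (fun p : En n × En n =>
      A p.2 * ENNReal.ofReal (‖1 - herm p.1 p.2‖ ^ (-(n + 1 + α)))) :=
    (hA.comp measurable_snd).mul ((measurable_D2.pow_const _).ennreal_ofReal)
  have hgm : Measurable ((TT ζ R).indicator (fun w => ENNReal.ofReal ((1 - ‖w‖) ^ (-(η / q'))))) := by
    refine Measurable.indicator ?_ (measurableSet_TT _ _)
    fun_prop
  calc _ = ∫⁻ w, (∫⁻ z in {z | ‖1 - herm z ζ‖ < 36 * R},
        A w * ENNReal.ofReal (‖1 - herm z w‖ ^ (-(n + 1 + α))) ∂measA n α) ∂measA n α :=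
        lintegral_lintegral_swap hm.aemeasurable
    _ ≤ ∫⁻ w, ENNReal.ofReal (C1 * (49 * R) ^ (η / q')) *
        (A w * (TT ζ R).indicator (fun w => ENNReal.ofReal ((1 - ‖w‖) ^ (-(η / q')))) w) ∂measA n α := by
        apply lintegral_mono_ae
        filter_upwards [measA_ae n α, hAs] with w hw hws
        by_cases hwT : w ∈ TT ζ R
        · rw [Set.indicator_of_mem hwT, lintegral_const_mul _
            (((measurable_DD w).pow_const _).ennreal_ofReal), mul_left_comm]
          refine mul_le_mul_right ?_ _
          rw [← ENNReal.ofReal_mul (by positivity)]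
          refine le_trans ?_ (K1 w hw (49 * R) (by positivity))
          rw [← lintegral_indicator (measurableSet_lt (measurable_DD ζ) measurable_const),
            ← lintegral_indicator (measurableSet_le (measurable_DD w) measurable_const)]
          apply lintegral_mono_ae
          filter_upwards [measA_ae n α] with z hz
          by_cases h1 : ‖1 - herm z ζ‖ < 36 * R
          · have m1 : z ∈ {z | ‖1 - herm z ζ‖ < 36 * R} := h1
            have m2 : z ∈ {z | ‖1 - herm z w‖ ≤ 49 * R} := by
              have h2 := quasi_tri z w ζ hζ hz.le hw.le
              have h3 := hwT.2
              have h4 : √‖1 - herm z ζ‖ * √‖1 - herm w ζ‖ ≤ 6 * R := by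
                rw [← Real.sqrt_mul (norm_nonneg _), Real.sqrt_le_left (by positivity)]
                nlinarith [norm_nonneg (1 - herm z ζ), norm_nonneg (1 - herm w ζ)]
              have h5 : ‖1 - herm z w‖ ≤ ‖1 - herm z ζ‖ + ‖herm z w - herm z ζ‖ := by
                rw [show 1 - herm z w = (1 - herm z ζ) - (herm z w - herm z ζ) by ring]
                exact norm_sub_le _ _
              change ‖1 - herm z w‖ ≤ 49 * R
              linarith
            rw [Set.indicator_of_mem m1, Set.indicator_of_mem m2]
          · rw [Set.indicator_of_notMem (by exact h1)]; exact zero_le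
        · rw [hws hwT]; simp
    _ = ENNReal.ofReal (C1 * (49 * R) ^ (η / q')) * ∫⁻ w, (A *
        (TT ζ R).indicator (fun w => ENNReal.ofReal ((1 - ‖w‖) ^ (-(η / q'))))) w ∂measA n α := by
        rw [lintegral_const_mul' _ _ ENNReal.ofReal_ne_top]; rfl
    _ ≤ ENNReal.ofReal (C1 * (49 * R) ^ (η / q')) * ((∫⁻ w, A w ^ q ∂measA n α) ^ (1 / q) *
        (∫⁻ w, ((TT ζ R).indicator (fun w => ENNReal.ofReal ((1 - ‖w‖) ^ (-(η / q')))) w) ^ q'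
          ∂measA n α) ^ (1 / q')) :=
        mul_le_mul_right (ENNReal.lintegral_mul_le_Lp_mul_Lq _ hq hA.aemeasurable hgm.aemeasurable) _
    _ ≤ ENNReal.ofReal (C1 * (49 * R) ^ (η / q')) * ((∫⁻ w, A w ^ q ∂measA n α) ^ (1 / q) *
        (ENNReal.ofReal (C2 * R ^ (n + 1 + α - η))) ^ (1 / q')) := by
        refine mul_le_mul_right (mul_le_mul_right (ENNReal.rpow_le_rpow ?_ (by positivity)) _) _
        refine le_trans ?_ (K2 ζ R hζ hR)
        rw [← lintegral_indicator (measurableSet_TT _ _)]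
        apply lintegral_mono_ae
        filter_upwards [measA_ae n α] with w hw
        by_cases hwT : w ∈ TT ζ R
        · have p1 : 0 < 1 - ‖w‖ := by linarith
          rw [Set.indicator_of_mem hwT, Set.indicator_of_mem hwT,
            ENNReal.ofReal_rpow_of_pos (by positivity), ← Real.rpow_mul p1.le]
          apply le_of_eq
          congr 2; field_simp
        · rw [Set.indicator_of_notMem hwT, ENNReal.zero_rpow_of_pos hq'0]; exact zero_le
    _ ≤ _ := by
        have k3 := ENNReal.rpow_le_rpow (K3 ζ R hζ hR hR4) (show 0 ≤ 1 / q' by positivity)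
        have hfin : ENNReal.ofReal (C1 * (49 * R) ^ (η / q')) *
            (ENNReal.ofReal (C2 * R ^ (n + 1 + α - η))) ^ (1 / q') ≤
            ENNReal.ofReal (C1 * 49 ^ (η / q') * (C2 / c) ^ (1 / q')) *
              (measA n α (TT ζ R)) ^ (1 / q') := by
          refine le_trans (le_of_eq ?_) (mul_le_mul_right k3 _)
          rw [ENNReal.ofReal_rpow_of_pos (by positivity), ENNReal.ofReal_rpow_of_pos (by positivity),
            ← ENNReal.ofReal_mul (by positivity), ← ENNReal.ofReal_mul (by positivity)]
          congr 1
          rw [Real.mul_rpow (by norm_num) hR.le, Real.mul_rpow hC2.le (by positivity),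
            Real.mul_rpow hc.le (by positivity), Real.div_rpow hC2.le hc.le,
            ← Real.rpow_mul hR.le, ← Real.rpow_mul hR.le]
          have e : R ^ ((n + 1 + α) * (1 / q')) = R ^ (η / q') * R ^ ((n + 1 + α - η) * (1 / q')) := by
            rw [← Real.rpow_add hR]; congr 1; field_simp; ring
          rw [e]
          have : c ^ (1 / q') ≠ 0 := by positivity
          field_simp
        calc _ = (∫⁻ w, A w ^ q ∂measA n α) ^ (1 / q) * (ENNReal.ofReal (C1 * (49 * R) ^ (η / q')) *
            (ENNReal.ofReal (C2 * R ^ (n + 1 + α - η))) ^ (1 / q')) := by ring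
          _ ≤ _ := mul_le_mul_right hfin _
          _ = _ := by ring

theorem ker_diff {n : ℕ} (N : ℝ) (hN : 0 < N) (ζ : En n) (hζ : ‖ζ‖ = 1) (R : ℝ) (hR : 0 < R)
    (z w : En n) (hz : ‖z‖ < 1) (hw : w ∈ TT ζ R) (hD : 36 * R ≤ ‖1 - herm z ζ‖) :
    ‖(1 - herm z w) ^ (-(N : ℂ)) - (1 - herm z ζ) ^ (-(N : ℂ))‖ ≤
      3 * N * 2 ^ (N + 1) * √R * ‖1 - herm z ζ‖ ^ (-N - 1/2) := by
  set D := ‖1 - herm z ζ‖ with hDdef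
  have hD0 : 0 < D := by linarith
  have hdiff : ‖herm z w - herm z ζ‖ ≤ 3 * (√R * √D) := by
    have h1 := quasi_tri z w ζ hζ hz.le hw.1.le
    have h2 : √‖1 - herm w ζ‖ ≤ √R := Real.sqrt_le_sqrt hw.2.le
    have h3 : √R * √R = R := Real.mul_self_sqrt hR.le
    have h4 : 6 * √R ≤ √D := by
      rw [show (6:ℝ) = √36 by rw [show (36:ℝ) = 6 ^ 2 by norm_num]; simp, ← Real.sqrt_mul (by norm_num)]
      exact Real.sqrt_le_sqrt hD
    have h5 := hw.2
    have h6 : √D * √‖1 - herm w ζ‖ ≤ √D * √R := by gcongr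
    have h7 : 0 ≤ √R := Real.sqrt_nonneg _
    nlinarith
  have hhalf : 3 * (√R * √D) ≤ D / 2 := by
    have h3 : √D * √D = D := Real.mul_self_sqrt hD0.le
    have h4 : 6 * √R ≤ √D := by
      rw [show (6:ℝ) = √36 by rw [show (36:ℝ) = 6 ^ 2 by norm_num]; simp, ← Real.sqrt_mul (by norm_num)]
      exact Real.sqrt_le_sqrt hD
    nlinarith [Real.sqrt_nonneg D]
  have hseg : ∀ x ∈ segment ℝ (1 - herm z ζ) (1 - herm z w), x ∈ Complex.slitPlane ∧ D / 2 ≤ ‖x‖ := by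
    intro x hx
    constructor
    · left
      have hconv : Convex ℝ {x : ℂ | 0 < x.re} := convex_halfSpace_re_gt 0
      refine hconv.segment_subset ?_ ?_ hx
      · exact re_pos z ζ (by rw [hζ]; linarith)
      · exact re_pos z w (by nlinarith [norm_nonneg z, norm_nonneg w, hw.1])
    · obtain ⟨t, s, ht, hs, hts, rfl⟩ := hx
      have e : t • (1 - herm z ζ) + s • (1 - herm z w) = (1 - herm z ζ) - s • (herm z w - herm z ζ) := by
        have : t = 1 - s := by linarith
        subst this
        simp only [Complex.real_smul]; push_cast; ring
      rw [e]
      have h1 := norm_sub_norm_le (1 - herm z ζ) (s • (herm z w - herm z ζ))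
      rw [norm_smul, Real.norm_eq_abs, abs_of_nonneg hs] at h1
      nlinarith [norm_nonneg (herm z w - herm z ζ)]
  have mv := Convex.norm_image_sub_le_of_norm_hasDerivWithin_le (𝕜 := ℂ) (f := fun x : ℂ => x ^ (-(N : ℂ)))
    (f' := fun x : ℂ => -(N : ℂ) * x ^ (-(N : ℂ) - 1) * 1) (C := N * (D / 2) ^ (-N - 1))
    (s := segment ℝ (1 - herm z ζ) (1 - herm z w)) (x := 1 - herm z ζ) (y := 1 - herm z w)
    (fun x hx => ((hasDerivAt_id x).cpow_const (hseg x hx).1).hasDerivWithinAt) ?_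
    (convex_segment _ _) (left_mem_segment _ _ _) (right_mem_segment _ _ _)
  · refine mv.trans ?_
    rw [show (1 - herm z w) - (1 - herm z ζ) = -(herm z w - herm z ζ) by ring, norm_neg]
    calc _ ≤ N * (D / 2) ^ (-N - 1) * (3 * (√R * √D)) := by gcongr
      _ = _ := by
        rw [Real.div_rpow hD0.le (by norm_num), Real.sqrt_eq_rpow D,
          show (-N - 1/2 : ℝ) = (-N - 1) + 1/2 by ring, Real.rpow_add hD0,
          show (-N - 1 : ℝ) = -(N + 1) by ring, Real.rpow_neg (by norm_num : (0:ℝ) ≤ 2)]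
        field_simp
  · intro x hx
    obtain ⟨h1, h2⟩ := hseg x hx
    rw [mul_one, norm_mul, norm_neg, Complex.norm_real, Real.norm_eq_abs, abs_of_pos hN,
      show (-(N:ℂ) - 1) = ((-N - 1 : ℝ) : ℂ) by push_cast; ring, Complex.norm_cpow_real]
    exact mul_le_mul_of_nonneg_left
      (Real.rpow_le_rpow_of_nonpos (by positivity) h2 (by linarith)) hN.le




theorem ctube_eq {n : ℕ} (ζ : En n) (hζ : ‖ζ‖ = 1) (r : ℝ) (hr : 0 < r) :
    ctube n ζ r = TT ζ (min (r ^ 2) 4) := by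
  ext z
  simp only [ctube, TT, Set.mem_ofPred_eq, mem_uball]
  constructor
  · rintro ⟨h1, h2⟩
    refine ⟨h1, lt_min ?_ ?_⟩
    · rw [← Real.sqrt_eq_rpow, Real.sqrt_lt' hr] at h2; exact h2
    · have h3 := norm_sub_le (1:ℂ) (herm z ζ)
      have h4 := norm_herm_le z ζ
      rw [hζ] at h4; simp at h3; linarith
  · rintro ⟨h1, h2⟩
    refine ⟨h1, ?_⟩
    rw [← Real.sqrt_eq_rpow, Real.sqrt_lt' hr]
    exact lt_of_lt_of_le h2 (min_le_left _ _)

theorem enorm_ker {n : ℕ} (N : ℝ) (a : ℂ) (z w : En n) :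
    ‖a / (1 - herm z w) ^ ((N : ℝ) : ℂ)‖ₑ = ‖a‖ₑ * ENNReal.ofReal (‖1 - herm z w‖ ^ (-N)) := by
  rw [← ofReal_norm, norm_div, Complex.norm_cpow_real, ← ofReal_norm, ← ENNReal.ofReal_mul (norm_nonneg _),
    Real.rpow_neg (norm_nonneg _), div_eq_mul_inv]

theorem bp_le {n : ℕ} (α : ℝ) (a : En n → ℂ) (z : En n) : ‖bergProj n α a z‖ₑ ≤
    ∫⁻ w, ‖a w‖ₑ * ENNReal.ofReal (‖1 - herm z w‖ ^ (-(n + 1 + α))) ∂measA n α := by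
  refine (enorm_integral_le_lintegral_enorm _).trans (le_of_eq ?_)
  congr 1; ext w
  rw [enorm_ker]

theorem bp_congr {n : ℕ} (α : ℝ) (a b : En n → ℂ) (h : a =ᵐ[measA n α] b) :
    bergProj n α a = bergProj n α b := by
  ext z
  apply integral_congr_ae
  filter_upwards [h] with w hw
  simp only [hw]

theorem measurable_K {n : ℕ} (c : ℂ) :
    Measurable (fun p : En n × En n => (1 - herm p.1 p.2) ^ c) :=
  (continuous_const.sub continuous_herm).measurable.pow_const c

theorem measurable_K1 {n : ℕ} (c : ℂ) (z : En n) :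
    Measurable (fun w : En n => (1 - herm z w) ^ c) :=
  (continuous_const.sub (continuous_herm_right z)).measurable.pow_const c

theorem bp_junk {n : ℕ} (α : ℝ) (a : En n → ℂ)
    (ha : ¬ AEStronglyMeasurable a (measA n α)) (z : En n) (hz : ‖z‖ < 1) : bergProj n α a z = 0 := by
  apply integral_undef
  intro hi
  apply ha
  have h1 : AEStronglyMeasurable (fun w : En n => a w / (1 - herm z w) ^ ((((n : ℝ) + 1 + α : ℝ)) : ℂ) *
      (1 - herm z w) ^ ((((n : ℝ) + 1 + α : ℝ)) : ℂ)) (measA n α) :=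
    hi.1.mul (measurable_K1 _ z).aestronglyMeasurable
  refine h1.congr ?_
  filter_upwards [measA_ae n α] with w hw
  have : 1 - herm z w ≠ 0 := one_sub_herm_ne z w (by nlinarith [norm_nonneg z, norm_nonneg w])
  have h2 : (1 - herm z w) ^ ((((n : ℝ) + 1 + α : ℝ)) : ℂ) ≠ 0 := by
    rw [Complex.cpow_def_of_ne_zero this]; exact Complex.exp_ne_zero _
  field_simp

theorem bp_meas {n : ℕ} (hn : 1 ≤ n) (α : ℝ) (hα : -1 < α) (a : En n → ℂ) :
    AEStronglyMeasurable (bergProj n α a) (measA n α) := by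
  have := sf_measA hn α hα
  by_cases ha : AEStronglyMeasurable a (measA n α)
  · rw [bp_congr α a _ ha.ae_eq_mk]
    apply StronglyMeasurable.aestronglyMeasurable
    have hm : StronglyMeasurable (fun p : En n × En n =>
      ha.mk a p.2 / (1 - herm p.1 p.2) ^ ((((n : ℝ) + 1 + α : ℝ)) : ℂ)) :=
      ((ha.stronglyMeasurable_mk.measurable.comp measurable_snd).div (measurable_K _)).stronglyMeasurable
    exact hm.integral_prod_right'
  · refine (aestronglyMeasurable_const (b := (0:ℂ))).congr ?_
    filter_upwards [measA_ae n α] with z hz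
    rw [bp_junk α a ha z hz]

theorem far_est {n : ℕ} (hn : 1 ≤ n) (α : ℝ) (hα : -1 < α) :
    ∃ C : ℝ, 0 < C ∧ ∀ (ζ : En n) (R : ℝ), ‖ζ‖ = 1 → 0 < R →
      ∀ a : En n → ℂ, AEStronglyMeasurable a (measA n α) → (∀ w, w ∉ TT ζ R → a w = 0) →
      ∫⁻ w, ‖a w‖ₑ ∂measA n α ≤ 1 → ∫ w, a w ∂measA n α = 0 →
      ∫⁻ z in {z | ‖1 - herm z ζ‖ < 36 * R}ᶜ, ‖bergProj n α a z‖ₑ ∂measA n α ≤ ENNReal.ofReal C := by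
  obtain ⟨C, hC, K⟩ := ker_far hn α (1/2) hα (by norm_num)
  have hN := npos (n := n) hα
  set N : ℝ := n + 1 + α with hNdef
  refine ⟨3 * N * 2 ^ (N + 1) * C, by positivity, fun ζ R hζ hR a ham has ha1 ha0 => ?_⟩
  have haI : Integrable a (measA n α) := ⟨ham, lt_of_le_of_lt ha1 (by simp)⟩
  have pt : ∀ z : En n, ‖z‖ < 1 → 36 * R ≤ ‖1 - herm z ζ‖ → ‖bergProj n α a z‖ₑ ≤
      ENNReal.ofReal (3 * N * 2 ^ (N + 1) * √R * ‖1 - herm z ζ‖ ^ (-N - 1/2)) := by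
    intro z hz hD
    have hKI : Integrable (fun w => a w * (1 - herm z w) ^ (-(N : ℂ))) (measA n α) := by
      refine haI.mul_bdd (c := (1 - ‖z‖) ^ (-N)) (measurable_K1 _ z).aestronglyMeasurable ?_
      filter_upwards [measA_ae n α] with w hw
      rw [← Complex.ofReal_neg, Complex.norm_cpow_real]
      refine Real.rpow_le_rpow_of_nonpos (by linarith) ?_ (by linarith)
      have := le_one_sub_herm z w
      nlinarith [norm_nonneg z]
    have e : bergProj n α a z =
        ∫ w, a w * ((1 - herm z w) ^ (-(N : ℂ)) - (1 - herm z ζ) ^ (-(N : ℂ))) ∂measA n α := by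
      simp only [mul_sub]
      rw [integral_sub hKI (haI.mul_const _), integral_mul_const, ha0, zero_mul, sub_zero]
      unfold bergProj
      congr 1; ext w
      rw [← hNdef, Complex.cpow_neg, div_eq_mul_inv]
    rw [e]
    refine (enorm_integral_le_lintegral_enorm _).trans ?_
    calc _ ≤ ∫⁻ w, ENNReal.ofReal (3 * N * 2 ^ (N + 1) * √R * ‖1 - herm z ζ‖ ^ (-N - 1/2)) * ‖a w‖ₑ
          ∂measA n α := by
          refine lintegral_mono fun w => ?_
          by_cases hw : w ∈ TT ζ R
          · rw [enorm_mul, mul_comm]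
            refine mul_le_mul_left ?_ _
            rw [← ofReal_norm]
            exact ENNReal.ofReal_le_ofReal (ker_diff N hN ζ hζ R hR z w hz hw hD)
          · rw [has w hw]; simp
      _ = ENNReal.ofReal (3 * N * 2 ^ (N + 1) * √R * ‖1 - herm z ζ‖ ^ (-N - 1/2)) * ∫⁻ w, ‖a w‖ₑ ∂measA n α :=
          lintegral_const_mul' _ _ ENNReal.ofReal_ne_top
      _ ≤ _ := (mul_le_mul_right ha1 _).trans (by rw [mul_one])
  have hms : MeasurableSet {z : En n | ‖1 - herm z ζ‖ < 36 * R} :=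
    measurableSet_lt (measurable_DD ζ) measurable_const
  rw [← lintegral_indicator hms.compl]
  calc _ ≤ ∫⁻ z, ENNReal.ofReal (3 * N * 2 ^ (N + 1) * √R) * {z | 36 * R ≤ ‖1 - herm z ζ‖}.indicator
        (fun z => ENNReal.ofReal (‖1 - herm z ζ‖ ^ (-N - 1/2))) z ∂measA n α := by
        apply lintegral_mono_ae
        filter_upwards [measA_ae n α] with z hz
        by_cases h : 36 * R ≤ ‖1 - herm z ζ‖
        · have m1 : z ∈ {z : En n | ‖1 - herm z ζ‖ < 36 * R}ᶜ := not_lt.2 h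
          have m2 : z ∈ {z : En n | 36 * R ≤ ‖1 - herm z ζ‖} := h
          rw [Set.indicator_of_mem m1, Set.indicator_of_mem m2, ← ENNReal.ofReal_mul (by positivity)]
          exact pt z hz h
        · have m1 : z ∉ {z : En n | ‖1 - herm z ζ‖ < 36 * R}ᶜ := fun h2 => h (not_lt.1 h2)
          rw [Set.indicator_of_notMem m1]; exact zero_le
    _ = ENNReal.ofReal (3 * N * 2 ^ (N + 1) * √R) * _ := lintegral_const_mul' _ _ ENNReal.ofReal_ne_top
    _ ≤ _ := mul_le_mul_right (K ζ hζ.le (36 * R) (by positivity)) _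
    _ ≤ _ := by
        rw [← ENNReal.ofReal_mul (by positivity)]
        apply ENNReal.ofReal_le_ofReal
        rw [Real.rpow_neg (by positivity), ← Real.sqrt_eq_rpow]
        have h1 : √R ≤ √(36 * R) := Real.sqrt_le_sqrt (by linarith)
        have h2 : 0 < √(36 * R) := Real.sqrt_pos.2 (by positivity)
        have h3 : √R * (√(36 * R))⁻¹ ≤ 1 := by
          rw [← div_eq_mul_inv, div_le_one h2]; exact h1
        calc 3 * N * 2 ^ (N + 1) * √R * (C * (√(36 * R))⁻¹)
            = 3 * N * 2 ^ (N + 1) * C * (√R * (√(36 * R))⁻¹) := by ring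
          _ ≤ 3 * N * 2 ^ (N + 1) * C * 1 := by gcongr
          _ = _ := by ring

theorem atom_bound {n : ℕ} (hn : 1 ≤ n) (q α : ℝ) (hq : 1 < q) (hα : -1 < α) :
    ∃ C : ℝ, 0 < C ∧ ∀ a, IsAtomCT n q α a →
      ∫⁻ z, ‖bergProj n α a z‖ₑ ∂measA n α ≤ ENNReal.ofReal C := by
  have hqq := Real.HolderConjugate.conjExponent hq
  set q' := q.conjExponent with hq'
  have hq0 : 0 < q := by linarith
  have hq'0 : 0 < q' := hqq.symm.pos
  have hinv : 1 / q - 1 + 1 / q' = 0 := by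
    have := hqq.inv_add_inv_eq_one
    simp only [one_div]; linarith
  obtain ⟨C1, hC1, L⟩ := loc_est hn q q' α hqq hα
  obtain ⟨C2, hC2, F⟩ := far_est hn α hα
  obtain ⟨c, hc, K3⟩ := lower_TT hn α hα
  have hfinm := isFinite_measA hn α hα
  set M : ℝ≥0∞ := (∫⁻ w : En n, (1 : ℝ≥0∞) ^ q ∂measA n α) ^ (1 / q) *
    (measA n α Set.univ) ^ (1 / q') with hM
  have hMfin : M ≠ ⊤ := by
    rw [hM]
    simp only [ENNReal.one_rpow, lintegral_one]
    exact ENNReal.mul_ne_top (ENNReal.rpow_ne_top_of_nonneg (by positivity) (measure_ne_top _ _))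
      (ENNReal.rpow_ne_top_of_nonneg (by positivity) (measure_ne_top _ _))
  refine ⟨C1 + C2 + C1 * M.toReal, by positivity, fun a ha => ?_⟩
  rcases ha with rfl | ⟨ζ, r, hζ, hr, has, haq, ha0⟩
  · obtain ⟨ζ, hζ⟩ := exists_unit hn
    have hall : ∀ z : En n, ‖z‖ < 1 → ‖1 - herm z ζ‖ < 4 := fun z hz => by
      have h3 := norm_sub_le (1:ℂ) (herm z ζ)
      have h4 := norm_herm_le z ζ
      rw [hζ] at h4; simp at h3; linarith
    have h1 := L ζ 4 hζ (by norm_num) le_rfl (fun _ => 1) measurable_const (by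
      filter_upwards [measA_ae n α] with w hw hw2
      exact absurd ⟨hw, hall w hw⟩ hw2)
    have h2 : ∫⁻ z, ‖bergProj n α (fun _ => 1) z‖ₑ ∂measA n α ≤ ENNReal.ofReal C1 * M := by
      calc _ = ∫⁻ z in {z | ‖1 - herm z ζ‖ < 36 * 4}, ‖bergProj n α (fun _ => 1) z‖ₑ ∂measA n α := by
            rw [← lintegral_indicator (measurableSet_lt (measurable_DD ζ) measurable_const)]
            apply lintegral_congr_ae
            filter_upwards [measA_ae n α] with z hz
            rw [Set.indicator_of_mem]
            change ‖1 - herm z ζ‖ < 36 * 4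
            linarith [hall z hz]
        _ ≤ _ := by
            refine le_trans (lintegral_mono fun z => ?_) (h1.trans ?_)
            · refine (bp_le α _ z).trans (le_of_eq ?_)
              simp
            · refine mul_le_mul_right (mul_le_mul_right ?_ _) _
              exact ENNReal.rpow_le_rpow (measure_mono (Set.subset_univ _)) (by positivity)
    refine h2.trans ?_
    rw [← ENNReal.ofReal_toReal hMfin, ← ENNReal.ofReal_mul hC1.le]
    apply ENNReal.ofReal_le_ofReal
    simp only [ENNReal.toReal_ofReal ENNReal.toReal_nonneg]
    linarith
  · rw [ctube_eq ζ hζ r hr] at has haq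
    set R := min (r ^ 2) 4 with hR
    have hR0 : 0 < R := lt_min (by positivity) (by norm_num)
    have hR4 : R ≤ 4 := min_le_right _ _
    by_cases ham : AEStronglyMeasurable a (measA n α)
    · have hq1 : (∫⁻ z, ‖a z‖ₑ ^ q ∂measA n α) ^ (1 / q) ≤ (measA n α (TT ζ R)) ^ (1 / q - 1) := by
        refine le_trans (le_of_eq ?_) haq
        congr 2; ext z
        rw [← ofReal_norm, ENNReal.ofReal_rpow_of_nonneg (norm_nonneg _) hq0.le]
      have hpos : measA n α (TT ζ R) ≠ 0 := by
        have := K3 ζ R hζ hR0 hR4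
        intro h0
        rw [h0] at this
        have h5 : 0 < ENNReal.ofReal (c * R ^ (n + 1 + α)) := by
          rw [ENNReal.ofReal_pos]; positivity
        exact absurd this (not_le.2 h5)
      have hprod : (∫⁻ z, ‖a z‖ₑ ^ q ∂measA n α) ^ (1 / q) * (measA n α (TT ζ R)) ^ (1 / q') ≤ 1 := by
        refine (mul_le_mul_left hq1 _).trans ?_
        rw [← ENNReal.rpow_add _ _ hpos (measure_ne_top _ _), hinv, ENNReal.rpow_zero]
      have h1 : ∫⁻ w, ‖a w‖ₑ ∂measA n α ≤ 1 := by
        refine le_trans ?_ hprod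
        have hh := ENNReal.lintegral_mul_le_Lp_mul_Lq (measA n α) hqq (f := fun w => ‖a w‖ₑ)
          (g := (TT ζ R).indicator (fun _ => 1)) ham.enorm
          (measurable_const.indicator (measurableSet_TT _ _)).aemeasurable
        refine le_trans (le_of_eq ?_) (hh.trans (le_of_eq ?_))
        · congr 1; ext w
          by_cases hw : w ∈ TT ζ R
          · simp [hw]
          · simp [hw, has w hw]
        · congr 2
          rw [← lintegral_indicator_one (measurableSet_TT _ _)]
          congr 1; ext w
          by_cases hw : w ∈ TT ζ R
          · simp [hw]
          · simp [hw, hq'0]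
      have hms : MeasurableSet {z : En n | ‖1 - herm z ζ‖ < 36 * R} :=
        measurableSet_lt (measurable_DD ζ) measurable_const
      rw [← lintegral_add_compl _ hms]
      have hF := F ζ R hζ hR0 a ham has h1 ha0
      have hL : ∫⁻ z in {z | ‖1 - herm z ζ‖ < 36 * R}, ‖bergProj n α a z‖ₑ ∂measA n α ≤
          ENNReal.ofReal C1 := by
        have l1 := L ζ R hζ hR0 hR4 (fun w => ‖ham.mk a w‖ₑ) ham.stronglyMeasurable_mk.measurable.enorm
          (by
            filter_upwards [ham.ae_eq_mk] with w hw hw2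
            rw [← hw, has w hw2]; simp)
        have l2 : ∫⁻ w, ‖ham.mk a w‖ₑ ^ q ∂measA n α = ∫⁻ w, ‖a w‖ₑ ^ q ∂measA n α := by
          apply lintegral_congr_ae
          filter_upwards [ham.ae_eq_mk] with w hw
          rw [← hw]
        rw [l2] at l1
        refine le_trans (lintegral_mono fun z => ?_) (l1.trans ((mul_le_mul_right hprod _).trans
          (by rw [mul_one])))
        rw [bp_congr α a _ ham.ae_eq_mk]
        exact bp_le α _ z
      refine (add_le_add hL hF).trans ?_
      rw [← ENNReal.ofReal_add hC1.le hC2.le]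
      apply ENNReal.ofReal_le_ofReal
      have : 0 ≤ C1 * M.toReal := by positivity
      linarith
    · refine le_trans (le_of_eq ?_) zero_le
      rw [← lintegral_zero (μ := measA n α)]
      apply lintegral_congr_ae
      filter_upwards [measA_ae n α] with z hz
      rw [bp_junk α a ham z hz]; simp



def om {n : ℕ} (β : ℝ) (w : En n) : ℝ := (max 0 (1 - ‖w‖ ^ 2)) ^ β

theorem om_nonneg {n : ℕ} (β : ℝ) (w : En n) : 0 ≤ om β w := Real.rpow_nonneg (le_max_left _ _) _

theorem om_zero {n : ℕ} (β : ℝ) (hβ : 0 < β) (w : En n) (hw : 1 ≤ ‖w‖) : om β w = 0 := by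
  unfold om
  rw [max_eq_left (by nlinarith), Real.zero_rpow hβ.ne']

theorem om_cont {n : ℕ} (β : ℝ) (hβ : 0 < β) : Continuous (om β : En n → ℝ) := by
  unfold om
  exact Continuous.rpow_const (by fun_prop) (fun x => Or.inr hβ.le)

theorem om_succ {n : ℕ} (β : ℝ) (hβ : 0 < β) (w : En n) : om (β + 1) w = (1 - ‖w‖ ^ 2) * om β w := by
  unfold om
  rcases le_total 0 (1 - ‖w‖^2) with h | h
  · rw [max_eq_right h, Real.rpow_add_one' h (by linarith), mul_comm]
  · rw [max_eq_left h, Real.zero_rpow hβ.ne', Real.zero_rpow (by linarith), mul_zero]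

theorem deriv_max (β : ℝ) (hβ : 0 < β) (x : ℝ) :
    HasDerivAt (fun x : ℝ => (max 0 x) ^ (β + 1)) ((β + 1) * (max 0 x) ^ β) x := by
  rcases lt_trichotomy x 0 with h | h | h
  · rw [max_eq_left h.le, Real.zero_rpow hβ.ne', mul_zero]
    apply (hasDerivAt_const x (0:ℝ)).congr_of_eventuallyEq
    filter_upwards [eventually_lt_nhds h] with y hy
    rw [max_eq_left hy.le, Real.zero_rpow (by linarith)]
  · subst h
    simp only [max_self, Real.zero_rpow hβ.ne', mul_zero]
    rw [← hasDerivWithinAt_univ, ← Set.Iic_union_Ici (a := (0:ℝ))]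
    apply HasDerivWithinAt.union
    · apply (hasDerivWithinAt_const (0:ℝ) _ (0:ℝ)).congr
      · intro y hy
        rw [max_eq_left hy, Real.zero_rpow (by linarith)]
      · rw [max_self, Real.zero_rpow (by linarith)]
    · have h1 : HasDerivAt (fun x : ℝ => x ^ (β+1)) 0 0 := by
        have := Real.hasDerivAt_rpow_const (x := 0) (p := β + 1) (Or.inr (by linarith))
        simpa [Real.zero_rpow hβ.ne'] using this
      apply h1.hasDerivWithinAt.congr
      · intro y hy
        rw [max_eq_right hy]
      · rw [max_self]
  · rw [max_eq_right h.le]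
    have h1 := Real.hasDerivAt_rpow_const (x := x) (p := β + 1) (Or.inl h.ne')
    rw [add_sub_cancel_right] at h1
    apply h1.congr_of_eventuallyEq
    filter_upwards [eventually_gt_nhds h] with y hy
    rw [max_eq_right hy.le]

theorem om_line {n : ℕ} (β : ℝ) (hβ : 0 < β) (w u : En n) :
    HasLineDerivAt ℝ (om (β + 1)) (-((β + 1) * om β w * (2 * (herm u w).re))) w u := by
  unfold HasLineDerivAt
  have h1 : HasDerivAt (fun t : ℝ => 1 - ‖w + t • u‖ ^ 2) (-(2 * (herm u w).re)) 0 := by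
    have e : (fun t : ℝ => 1 - ‖w + t • u‖ ^ 2) = fun t : ℝ => 1 - (‖w‖^2 + 2 * (t * (herm u w).re) + t^2 * ‖u‖^2) := by
      funext t
      rw [norm_add_sq (𝕜 := ℂ), ← herm_eq, norm_smul, mul_pow]
      have : herm (t • u) w = (t:ℂ) * herm u w := by
        rw [← herm_smul_left]; rfl
      rw [this]
      simp
    rw [e]
    have h2 := (((hasDerivAt_const (0:ℝ) (‖w‖^2)).add (((hasDerivAt_id (0:ℝ)).mul_const (herm u w).re).const_mul 2)).add
      (((hasDerivAt_id (0:ℝ)).pow 2).mul_const (‖u‖^2))).const_sub 1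
    convert! h2 using 1
    simp
  have h3 := (deriv_max β hβ (1 - ‖w + (0:ℝ) • u‖ ^ 2)).comp (0:ℝ) h1
  convert! h3 using 1
  simp only [zero_smul, add_zero]
  unfold om
  ring

theorem oc_cont {n : ℕ} (β : ℝ) (hβ : 0 < β) (R : ℝ) (hR : 1 < R) (Φ : En n → ℂ)
    (hΦ : ContinuousOn Φ (Metric.ball 0 R)) : Continuous (fun w => (om β w : ℂ) * Φ w) := by
  rw [continuous_iff_continuousAt]
  intro w
  by_cases h : ‖w‖ < R
  · apply ContinuousAt.mul
    · exact (Complex.continuous_ofReal.comp (om_cont β hβ)).continuousAt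
    · exact hΦ.continuousAt (Metric.isOpen_ball.mem_nhds (by simpa using h))
  · have : (fun w => (om β w : ℂ) * Φ w) =ᶠ[𝓝 w] fun _ => 0 := by
      have : ∀ᶠ v in 𝓝 w, 1 < ‖v‖ := continuous_norm.continuousAt.eventually (lt_mem_nhds (by linarith))
      filter_upwards [this] with v hv
      rw [om_zero β hβ v hv.le]; simp
    exact this.continuousAt

theorem oc_int {n : ℕ} (β : ℝ) (hβ : 0 < β) (R : ℝ) (hR : 1 < R) (Φ : En n → ℂ)
    (hΦ : ContinuousOn Φ (Metric.ball 0 R)) : Integrable (fun w => (om β w : ℂ) * Φ w) (vol n) := by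
  apply (oc_cont β hβ R hR Φ hΦ).integrable_of_hasCompactSupport
  apply HasCompactSupport.intro (isCompact_closedBall (0 : En n) 1)
  intro x hx
  have : 1 < ‖x‖ := by simpa using hx
  rw [om_zero β hβ x this.le]; simp

theorem IBP1 {n : ℕ} (β : ℝ) (hβ : 0 < β) (R : ℝ) (hR : 1 < R) (Φ Φ' : En n → ℂ) (u : En n)
    (hΦ : ContinuousOn Φ (Metric.ball 0 R)) (hΦ' : ContinuousOn Φ' (Metric.ball 0 R))
    (hd : ∀ w ∈ Metric.ball (0 : En n) R, HasLineDerivAt ℝ Φ (Φ' w) w u) :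
    ∫ w, (om (β + 1) w : ℂ) * Φ' w ∂vol n = (β + 1) * ∫ w, (om β w : ℂ) * ((2 * (herm u w).re : ℝ) * Φ w) ∂vol n := by
  have c2 : ContinuousOn (fun w => ((2 * (herm u w).re : ℝ) : ℂ) * Φ w) (Metric.ball 0 R) := by
    apply ContinuousOn.mul _ hΦ
    apply Continuous.continuousOn
    have := continuous_herm_right u
    fun_prop
  have i0 := oc_int (β + 1) (by linarith) R hR Φ hΦ
  have i1 := oc_int (β + 1) (by linarith) R hR Φ' hΦ'
  have i2 := oc_int β hβ R hR _ c2
  set G : En n → ℂ := fun w => (om (β+1) w : ℂ) * Φ w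
  set G' : En n → ℂ := fun w => (om (β+1) w : ℂ) * Φ' w - (β + 1) * ((om β w : ℂ) * ((2 * (herm u w).re : ℝ) * Φ w))
  have iG' : Integrable G' (vol n) := i1.sub (i2.const_mul _)
  have hG : ∀ w, HasLineDerivAt ℝ G (G' w) w u := by
    intro w
    by_cases h : ‖w‖ < R
    · have h1 : HasDerivAt (fun t : ℝ => om (β+1) (w + t • u)) _ 0 := om_line β hβ w u
      have h2 : HasDerivAt (fun t : ℝ => Φ (w + t • u)) _ 0 := hd w (by simpa using h)
      have h3 := h1.ofReal_comp.mul h2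
      unfold HasLineDerivAt
      convert! h3 using 1
      simp only [G', zero_smul, add_zero]
      push_cast
      ring
    · have e : G' w = 0 := by
        simp only [G']
        rw [om_zero β hβ w (by linarith), om_zero (β + 1) (by linarith) w (by linarith)]; simp
      rw [e]
      unfold HasLineDerivAt
      apply (hasDerivAt_const (0:ℝ) (0:ℂ)).congr_of_eventuallyEq
      have : ∀ᶠ t in 𝓝 (0:ℝ), 1 < ‖w + t • u‖ := by
        have c : Continuous fun t : ℝ => ‖w + t • u‖ := by fun_prop
        exact c.continuousAt.eventually (lt_mem_nhds (by simp; linarith))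
      filter_upwards [this] with t ht
      simp only [G]
      rw [om_zero (β+1) (by linarith) _ ht.le]; simp
  have key := integral_bilinear_hasLineDerivAt_right_eq_neg_left_of_integrable (μ := vol n)
    (f := fun _ : En n => (1:ℂ)) (f' := fun _ => 0) (g := G) (g' := G') (v := u)
    (B := ContinuousLinearMap.mul ℝ ℂ) (by simp) (by simpa using iG') (by simpa using i0)
    (fun x _ => by
      unfold HasLineDerivAt
      exact hasDerivAt_const _ _) (fun x _ => hG x)
  simp only [ContinuousLinearMap.mul_apply', one_mul, zero_mul, integral_zero, neg_zero] at key
  simp only [G'] at key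
  rw [integral_sub i1 (i2.const_mul _), integral_const_mul, sub_eq_zero] at key
  exact key



theorem line_deriv {n : ℕ} (g : En n → ℂ) (x v : En n) (h : DifferentiableAt ℂ g x) :
    deriv (fun t : ℂ => g (x + t • v)) 0 = fderiv ℂ g x v := by
  have h1 : HasFDerivAt g (fderiv ℂ g x) (x + (0:ℂ) • v) := by simpa using h.hasFDerivAt
  have h2 : HasDerivAt (fun t : ℂ => x + t • v) v 0 := by
    simpa using ((hasDerivAt_id (0:ℂ)).smul_const v).const_add x
  exact (h1.comp_hasDerivAt (0:ℂ) h2).deriv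

theorem hol_deriv {n : ℕ} (R : ℝ) (g : En n → ℂ) (hg : DifferentiableOn ℂ g (Metric.ball 0 R)) (ξ : En n) :
    DifferentiableOn ℂ (fun w => fderiv ℂ g w ξ) (Metric.ball 0 R) := by
  intro w0 hw0
  apply DifferentiableAt.differentiableWithinAt
  have hw0' : ‖w0‖ < R := by simpa using hw0
  obtain ⟨d, hd, hdR⟩ : ∃ d : ℝ, 0 < d ∧ ‖w0‖ + 3 * d < R := ⟨(R - ‖w0‖)/4, by linarith, by linarith⟩
  have hin : ∀ x : En n, ‖x - w0‖ ≤ 3 * d → x ∈ Metric.ball (0 : En n) R := by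
    intro x hx
    have := norm_le_norm_add_norm_sub' x w0
    simp only [Metric.mem_ball, dist_zero_right]; linarith
  have hda : ∀ x : En n, ‖x - w0‖ ≤ 3 * d → DifferentiableAt ℂ g x := fun x hx =>
    hg.differentiableAt (Metric.isOpen_ball.mem_nhds (hin x hx))
  obtain ⟨M, hM⟩ := (isCompact_closedBall w0 (3*d)).exists_bound_of_continuousOn
    (f := g) (hg.continuousOn.mono (fun x hx => hin x (by simpa [dist_eq_norm] using hx)))
  have hM' : ∀ x : En n, ‖x - w0‖ ≤ 3 * d → ‖g x‖ ≤ M := fun x hx => hM x (by simpa [dist_eq_norm] using hx)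
  have M0 : 0 ≤ M := (norm_nonneg _).trans (hM' w0 (by simp; linarith))
  have lin : ∀ (x v : En n), Continuous fun t : ℂ => x + t • v := fun x v => by fun_prop
  have slice : ∀ (x v : En n) (ρ : ℝ), ‖x - w0‖ ≤ 2 * d → ρ * ‖v‖ ≤ d →
      ∀ t ∈ Metric.closedBall (0:ℂ) ρ, ‖x + t • v - w0‖ ≤ 3 * d := by
    intro x v ρ hx hv t ht
    have h1 : ‖t‖ ≤ ρ := by simpa using ht
    have h2 : ‖x + t • v - w0‖ ≤ ‖x - w0‖ + ‖t‖ * ‖v‖ := by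
      rw [← norm_smul, add_sub_right_comm]; exact norm_add_le _ _
    nlinarith [norm_nonneg v]
  have sdiff : ∀ (x v : En n) (ρ : ℝ), ‖x - w0‖ ≤ 2 * d → ρ * ‖v‖ ≤ d →
      DifferentiableOn ℂ (fun t : ℂ => g (x + t • v)) (Metric.closedBall (0:ℂ) ρ) := by
    intro x v ρ hx hv t ht
    have h1 := hda _ (slice x v ρ hx hv t ht)
    apply DifferentiableAt.differentiableWithinAt
    exact DifferentiableAt.comp t h1 (by fun_prop)
  have bd : ∀ x : En n, ‖x - w0‖ ≤ 2 * d → ‖fderiv ℂ g x‖ ≤ M / d := by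
    intro x hx
    apply ContinuousLinearMap.opNorm_le_bound _ (by positivity)
    intro v
    rcases eq_or_ne v 0 with rfl | hv
    · simp
    have hv' : 0 < ‖v‖ := norm_pos_iff.2 hv
    have hρ : d / ‖v‖ * ‖v‖ ≤ d := by rw [div_mul_cancel₀ _ hv'.ne']
    rw [← line_deriv g x v (hda x (by linarith))]
    have := Complex.norm_deriv_le_of_forall_mem_sphere_norm_le (c := 0) (R := d / ‖v‖) (C := M) (f := fun t : ℂ => g (x + t • v)) (by positivity)
      ((sdiff x v _ hx hρ).diffContOnCl_ball (fun _ h => h)) (fun t ht => hM' _ (slice x v _ hx hρ t (Metric.sphere_subset_closedBall ht)))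
    calc _ ≤ M / (d / ‖v‖) := this
      _ = _ := by field_simp
  set ρ : ℝ := d / (‖ξ‖ + 1)
  have hρ0 : 0 < ρ := by positivity
  have hρ : ρ * ‖ξ‖ ≤ d := by
    simp only [ρ]; rw [div_mul_eq_mul_div, div_le_iff₀ (by positivity)]; nlinarith [norm_nonneg ξ]
  set k : ℝ → ℂ := fun θ => deriv (circleMap 0 ρ) θ * (1 / (circleMap 0 ρ θ - 0)^2)
  have hk : Continuous k := by
    simp only [k, deriv_circleMap]
    apply Continuous.mul
    · exact (continuous_circleMap _ _).mul continuous_const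
    · apply Continuous.div continuous_const
      · exact ((continuous_circleMap _ _).sub continuous_const).pow 2
      · intro x
        have := circleMap_ne_center (c := 0) (R := ρ) hρ0.ne' (θ := x)
        simpa using this
  have rep : ∀ x : En n, ‖x - w0‖ ≤ 2 * d → fderiv ℂ g x ξ = (2 * Real.pi * Complex.I)⁻¹ * ∫ θ in Set.Ioc 0 (2 * Real.pi), k θ * g (x + circleMap 0 ρ θ • ξ) := by
    intro x hx
    have h1 := (sdiff x ξ ρ hx hρ).deriv_eq_smul_circleIntegral hρ0
    rw [line_deriv g x ξ (hda x (by linarith))] at h1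
    rw [circleIntegral, intervalIntegral.integral_of_le (by positivity)] at h1
    simp only [smul_eq_mul] at h1
    simp only [k, mul_assoc]
    rw [h1]; field_simp
  have hcm : ∀ θ, circleMap 0 ρ θ ∈ Metric.closedBall (0:ℂ) ρ := fun θ => circleMap_mem_closedBall _ hρ0.le _
  have cG : ∀ x : En n, ‖x - w0‖ ≤ 2 * d → Continuous fun θ : ℝ => k θ * g (x + circleMap 0 ρ θ • ξ) := by
    intro x hx
    apply hk.mul
    exact (sdiff x ξ ρ hx hρ).continuousOn.comp_continuous (continuous_circleMap _ _) hcm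
  obtain ⟨K, hK⟩ := (isCompact_Icc (a := (0:ℝ)) (b := 2 * Real.pi)).exists_bound_of_continuousOn (hk.continuousOn)
  have main : HasFDerivAt (fun x : En n => ∫ θ in Set.Ioc 0 (2 * Real.pi), k θ * g (x + circleMap 0 ρ θ • ξ))
      (∫ θ in Set.Ioc 0 (2 * Real.pi), k θ • fderiv ℂ g (w0 + circleMap 0 ρ θ • ξ)) w0 := by
    have near : ∀ᶠ x in 𝓝 w0, ‖x - w0‖ ≤ d := by
      filter_upwards [Metric.ball_mem_nhds w0 hd] with x hx
      rw [← dist_eq_norm]; exact (Metric.mem_ball.1 hx).le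
    apply hasFDerivAt_integral_of_dominated_of_fderiv_le (s := Metric.ball w0 d) (bound := fun _ => K * (M / d))
      (F' := fun x θ => k θ • fderiv ℂ g (x + circleMap 0 ρ θ • ξ)) (Metric.ball_mem_nhds w0 hd)
    · filter_upwards [near] with x hx
      exact (cG x (by linarith)).aestronglyMeasurable
    · exact ((cG w0 (by simp; linarith)).integrableOn_Icc (a := 0) (b := 2 * Real.pi)).mono_set Set.Ioc_subset_Icc_self
    · apply AEStronglyMeasurable.smul hk.aestronglyMeasurable
      apply Measurable.aestronglyMeasurable
      apply (measurable_fderiv ℂ g).comp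
      have : Continuous fun θ : ℝ => w0 + circleMap 0 ρ θ • ξ := (lin w0 ξ).comp (continuous_circleMap 0 ρ)
      exact this.measurable
    · filter_upwards [ae_restrict_mem measurableSet_Ioc] with θ hθ x hx
      rw [norm_smul]
      have hx' : ‖x - w0‖ < d := by rw [← dist_eq_norm]; exact hx
      apply mul_le_mul (hK θ (Set.Ioc_subset_Icc_self hθ)) _ (norm_nonneg _) ((norm_nonneg _).trans (hK θ (Set.Ioc_subset_Icc_self hθ)))
      apply bd
      have h1 : ‖circleMap 0 ρ θ‖ ≤ ρ := by simpa using hcm θ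
      have h2 : ‖x + circleMap 0 ρ θ • ξ - w0‖ ≤ ‖x - w0‖ + ‖circleMap 0 ρ θ‖ * ‖ξ‖ := by
        rw [← norm_smul, add_sub_right_comm]; exact norm_add_le _ _
      nlinarith [norm_nonneg ξ]
    · exact integrable_const _
    · refine ae_of_all _ fun θ x hx => ?_
      have hx' : ‖x - w0‖ < d := by rw [← dist_eq_norm]; exact hx
      have h1 := (hda _ (slice x ξ ρ (by linarith) hρ _ (hcm θ))).hasFDerivAt
      have h2 : HasFDerivAt (fun x : En n => g (x + circleMap 0 ρ θ • ξ)) (fderiv ℂ g (x + circleMap 0 ρ θ • ξ)) x :=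
        (hasFDerivAt_comp_add_right _).2 h1
      exact h2.const_mul _
  have m2 := (main.const_mul ((2 * Real.pi * Complex.I)⁻¹)).differentiableAt
  apply m2.congr_of_eventuallyEq
  filter_upwards [Metric.ball_mem_nhds w0 hd] with x hx
  have hx' : ‖x - w0‖ < d := by rw [← dist_eq_norm]; exact hx
  rw [rep x (by linarith)]



theorem hld_of_fderiv {n : ℕ} (g : En n → ℂ) (x v : En n) (h : DifferentiableAt ℂ g x) :
    HasLineDerivAt ℝ g (fderiv ℂ g x v) x v := by
  have h1 : HasFDerivAt g ((fderiv ℂ g x).restrictScalars ℝ) x := h.hasFDerivAt.restrictScalars ℝ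
  exact h1.hasLineDerivAt v

theorem hld_herm {n : ℕ} (ξ x v : En n) : HasLineDerivAt ℝ (fun w => herm ξ w) (herm ξ v) x v := by
  unfold HasLineDerivAt
  have e : (fun t : ℝ => herm ξ (x + t • v)) = fun t : ℝ => herm ξ x + (t : ℂ) * herm ξ v := by
    funext t
    have : t • v = (t : ℂ) • v := rfl
    rw [herm_add_right, this, herm_smul_right, Complex.conj_ofReal]
  rw [e]
  simpa using (((hasDerivAt_id (0:ℝ)).ofReal_comp).mul_const (herm ξ v)).const_add (herm ξ x)

theorem IBP2 {n : ℕ} (β : ℝ) (hβ : 0 < β) (R : ℝ) (hR : 1 < R) (g : En n → ℂ)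
    (hg : DifferentiableOn ℂ g (Metric.ball 0 R)) (ξ : En n) (j : ℕ) :
    ∫ w, (om (β + 1) w : ℂ) * ((herm ξ w) ^ j * fderiv ℂ g w ξ) ∂vol n =
      (β + 1) * ∫ w, (om β w : ℂ) * ((herm ξ w) ^ (j + 1) * g w) ∂vol n := by
  have hgd : ∀ w ∈ Metric.ball (0 : En n) R, DifferentiableAt ℂ g w := fun w hw =>
    hg.differentiableAt (Metric.isOpen_ball.mem_nhds hw)
  have ch : Continuous fun w => herm ξ w := continuous_herm_right ξ
  have cg := hg.continuousOn
  have cf : ∀ u, ContinuousOn (fun w => fderiv ℂ g w u) (Metric.ball 0 R) := fun u => (hol_deriv R g hg u).continuousOn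
  have c0 : ContinuousOn (fun w => (herm ξ w) ^ j * g w) (Metric.ball 0 R) := (ch.pow j).continuousOn.mul cg
  have c1 : ∀ u, ContinuousOn (fun w => (j * (herm ξ w) ^ (j-1) * herm ξ u) * g w + (herm ξ w) ^ j * fderiv ℂ g w u) (Metric.ball 0 R) := by
    intro u
    apply ContinuousOn.add
    · exact ((continuous_const.mul (ch.pow _)).mul continuous_const).continuousOn.mul cg
    · exact (ch.pow _).continuousOn.mul (cf u)
  have c2 : ∀ u, ContinuousOn (fun w => ((2 * (herm u w).re : ℝ) : ℂ) * ((herm ξ w) ^ j * g w)) (Metric.ball 0 R) := by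
    intro u
    apply ContinuousOn.mul _ c0
    apply Continuous.continuousOn
    have := continuous_herm_right u
    fun_prop
  have hd : ∀ u, ∀ w ∈ Metric.ball (0 : En n) R, HasLineDerivAt ℝ (fun w => (herm ξ w) ^ j * g w)
      ((j * (herm ξ w) ^ (j-1) * herm ξ u) * g w + (herm ξ w) ^ j * fderiv ℂ g w u) w u := by
    intro u w hw
    have h1 : HasDerivAt (fun t : ℝ => herm ξ (w + t • u)) _ 0 := hld_herm ξ w u
    have h2 : HasDerivAt (fun t : ℝ => g (w + t • u)) _ 0 := hld_of_fderiv g w u (hgd w hw)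
    have h3 := (h1.pow j).mul h2
    unfold HasLineDerivAt
    convert! h3 using 1
    simp
  have A := IBP1 β hβ R hR _ _ ξ c0 (c1 ξ) (hd ξ)
  have B := IBP1 β hβ R hR _ _ (Complex.I • ξ) c0 (c1 (Complex.I • ξ)) (hd (Complex.I • ξ))
  have i1 := fun u => oc_int (β + 1) (by linarith) R hR _ (c1 u)
  have i2 := fun u => oc_int β hβ R hR _ (c2 u)
  have E1 : ∫ w, (om (β + 1) w : ℂ) * ((herm ξ w) ^ j * fderiv ℂ g w ξ) ∂vol n =
    (1/2) * (∫ w, (om (β + 1) w : ℂ) * ((j * (herm ξ w) ^ (j-1) * herm ξ ξ) * g w + (herm ξ w) ^ j * fderiv ℂ g w ξ) ∂vol n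
     - Complex.I * ∫ w, (om (β + 1) w : ℂ) * ((j * (herm ξ w) ^ (j-1) * herm ξ (Complex.I • ξ)) * g w + (herm ξ w) ^ j * fderiv ℂ g w (Complex.I • ξ)) ∂vol n) := by
    rw [← integral_const_mul, ← integral_sub (i1 _) ((i1 _).const_mul _), ← integral_const_mul]
    congr 1; funext w
    rw [herm_smul_right, map_smul, Complex.conj_I, smul_eq_mul]
    ring_nf; rw [Complex.I_sq]; ring
  have E2 : ∫ w, (om β w : ℂ) * ((herm ξ w) ^ (j + 1) * g w) ∂vol n =
    (1/2) * (∫ w, (om β w : ℂ) * (((2 * (herm ξ w).re : ℝ) : ℂ) * ((herm ξ w) ^ j * g w)) ∂vol n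
     - Complex.I * ∫ w, (om β w : ℂ) * (((2 * (herm (Complex.I • ξ) w).re : ℝ) : ℂ) * ((herm ξ w) ^ j * g w)) ∂vol n) := by
    rw [← integral_const_mul, ← integral_sub (i2 _) ((i2 _).const_mul _), ← integral_const_mul]
    congr 1; funext w
    have : herm ξ w = ((herm ξ w).re : ℂ) - Complex.I * ((herm (Complex.I • ξ) w).re : ℂ) := by
      rw [herm_smul_left]
      apply Complex.ext <;> simp
    rw [pow_succ]
    conv_lhs => rw [mul_comm ((herm ξ w) ^ j)]; enter [2, 1, 1]; rw [this]
    push_cast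
    ring
  rw [E1, E2, A, B]
  ring

theorem vol_rot {n : ℕ} (c : ℂ) (hc : ‖c‖ = 1) (H : En n → ℂ) (hH : Continuous H) :
    ∫ w, H (c • w) ∂vol n = ∫ w, H w ∂vol n := by
  have hc0 : c ≠ 0 := by rintro rfl; simp at hc
  have hdet : LinearMap.det (c • (LinearMap.id : En n →ₗ[ℂ] En n)) = c ^ n := by simp
  have h := vol_scale (c • (LinearMap.id : En n →ₗ[ℂ] En n)) (by rw [hdet]; exact pow_ne_zero _ hc0) 0
  rw [hdet, norm_pow, hc] at h
  simp only [one_pow, ENNReal.ofReal_one, one_smul, LinearMap.smul_apply, LinearMap.id_apply, zero_add] at h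
  conv_rhs => rw [h]
  rw [integral_map (by fun_prop) hH.aestronglyMeasurable]

theorem om_rot {n : ℕ} (β : ℝ) (c : ℂ) (hc : ‖c‖ = 1) (w : En n) : om β (c • w) = om β w := by
  unfold om; rw [norm_smul, hc, one_mul]

theorem mean_val {n : ℕ} (β : ℝ) (hβ : 0 < β) (R : ℝ) (hR : 1 < R) (g : En n → ℂ)
    (hg : DifferentiableOn ℂ g (Metric.ball 0 R)) :
    ∫ w, (om β w : ℂ) * g w ∂vol n = (∫ w, (om β w : ℂ) ∂vol n) * g 0 := by
  set H : En n → ℂ := fun w => (om β w : ℂ) * g w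
  have cH : Continuous H := oc_cont β hβ R hR g hg.continuousOn
  have Hz : ∀ w, 1 < ‖w‖ → H w = 0 := fun w hw => by simp only [H]; rw [om_zero β hβ w hw.le]; simp
  have sH : HasCompactSupport H := by
    apply HasCompactSupport.intro (isCompact_closedBall (0 : En n) 1)
    intro x hx
    exact Hz x (by simpa using hx)
  obtain ⟨K, hK⟩ := sH.exists_bound_of_continuous cH
  have nc : ∀ θ, ‖circleMap 0 1 θ‖ = 1 := fun θ => by simp
  have cF : Continuous fun p : ℝ × En n => H (circleMap 0 1 p.1 • p.2) := by
    apply cH.comp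
    exact ((continuous_circleMap 0 1).comp continuous_fst).smul continuous_snd
  have iF : Integrable (fun p : ℝ × En n => H (circleMap 0 1 p.1 • p.2)) ((volume.restrict (Set.Ioc 0 (2*Real.pi))).prod (vol n)) := by
    have b : Integrable (fun p : ℝ × En n => K * (Metric.closedBall (0 : En n) 1).indicator (fun _ => (1:ℝ)) p.2) ((volume.restrict (Set.Ioc 0 (2*Real.pi))).prod (vol n)) := by
      apply Integrable.mul_prod (f := fun _ : ℝ => K)
      · exact integrable_const K
      · exact (integrable_indicator_iff Metric.isClosed_closedBall.measurableSet).2 (integrableOn_const (isCompact_closedBall _ _).measure_lt_top.ne)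
    apply b.mono' cF.aestronglyMeasurable
    refine ae_of_all _ fun p => ?_
    by_cases h : p.2 ∈ Metric.closedBall (0 : En n) 1
    · rw [Set.indicator_of_mem h, mul_one]; exact hK _
    · rw [Set.indicator_of_notMem h, Hz]
      · simp
      · rw [norm_smul, nc, one_mul]; simpa using h
  have F1 : ∫ θ in Set.Ioc 0 (2*Real.pi), ∫ w, H (circleMap 0 1 θ • w) ∂vol n = ((2 * Real.pi : ℝ) : ℂ) * ∫ w, H w ∂vol n := by
    have : ∀ θ, ∫ w, H (circleMap 0 1 θ • w) ∂vol n = ∫ w, H w ∂vol n := fun θ => vol_rot _ (nc θ) H cH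
    simp only [this]
    simp [Real.pi_pos.le]
  have F2 : ∀ w, ∫ θ in Set.Ioc 0 (2*Real.pi), H (circleMap 0 1 θ • w) = ((2 * Real.pi : ℝ) : ℂ) * ((om β w : ℂ) * g 0) := by
    intro w
    simp only [H, om_rot β _ (nc _)]
    rw [integral_const_mul]
    rcases le_or_gt 1 ‖w‖ with h | h
    · rw [om_zero β hβ w h]; simp
    have hd : DiffContOnCl ℂ (fun t : ℂ => g (t • w)) (Metric.ball 0 |1|) := by
      apply DifferentiableOn.diffContOnCl
      rw [closure_ball _ (by norm_num)]
      intro t ht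
      have ht' : ‖t‖ ≤ 1 := by simpa using ht
      have hm : t • w ∈ Metric.ball (0 : En n) R := by
        simp only [Metric.mem_ball, dist_zero_right, norm_smul]
        nlinarith [norm_nonneg w]
      apply DifferentiableAt.differentiableWithinAt
      exact DifferentiableAt.comp t (hg.differentiableAt (Metric.isOpen_ball.mem_nhds hm)) (by fun_prop)
    have h1 := hd.circleAverage
    rw [Real.circleAverage, intervalIntegral.integral_of_le (by positivity), zero_smul] at h1
    rw [← h1, Complex.real_smul]
    push_cast
    field_simp
  have h3 := integral_integral_swap (f := fun (θ : ℝ) (w : En n) => H (circleMap 0 1 θ • w)) iF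
  rw [F1] at h3
  simp only [F2] at h3
  rw [integral_const_mul, integral_mul_const] at h3
  exact mul_left_cancel₀ (by simp [Real.pi_ne_zero]) h3



def II (n : ℕ) (β : ℝ) : ℂ := ∫ w : En n, (om β w : ℂ) ∂vol n

theorem II_pos (n : ℕ) (β : ℝ) (hβ : 0 < β) : ∃ x : ℝ, 0 < x ∧ II n β = x := by
  refine ⟨∫ w : En n, om β w ∂vol n, ?_, integral_ofReal⟩
  apply Continuous.integral_pos_of_hasCompactSupport_nonneg_nonzero (x := 0) (om_cont β hβ)
  · apply HasCompactSupport.intro (isCompact_closedBall (0 : En n) 1)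
    intro x hx
    have : 1 < ‖x‖ := by simpa using hx
    exact om_zero β hβ x this.le
  · exact fun w => om_nonneg β w
  · simp [om]

theorem II_ne (n : ℕ) (β : ℝ) (hβ : 0 < β) : II n β ≠ 0 := by
  obtain ⟨x, hx, h⟩ := II_pos n β hβ
  rw [h]; exact_mod_cast hx.ne'

theorem II_rec (n : ℕ) (β : ℝ) (hβ : 0 < β) : II n (β + 1) * (n + 1 + β) = (β + 1) * II n β := by
  have h1 : ∀ k : Fin n, II n (β + 1) = (β + 1) * ∫ w : En n, (om β w : ℂ) * ((‖w k‖^2 : ℝ) : ℂ) ∂vol n := by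
    intro k
    have e : ∀ w : En n, herm (EuclideanSpace.single k (1:ℂ)) w = (starRingEnd ℂ) (w k) := by
      intro w; rw [herm_eq, EuclideanSpace.inner_single_right]; simp
    have e' : ∀ w : En n, herm w (EuclideanSpace.single k (1:ℂ)) = w k := by
      intro w; rw [← herm_conj, e]; simp
    have hd : ∀ w : En n, HasFDerivAt (fun w : En n => herm w (EuclideanSpace.single k (1:ℂ))) (EuclideanSpace.proj k : En n →L[ℂ] ℂ) w := by
      intro w
      simp only [e']
      exact (EuclideanSpace.proj k : En n →L[ℂ] ℂ).hasFDerivAt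
    have := IBP2 β hβ 2 (by norm_num) (fun w : En n => herm w (EuclideanSpace.single k (1:ℂ)))
      (fun w _ => (hd w).differentiableAt.differentiableWithinAt) (EuclideanSpace.single k (1:ℂ)) 0
    simp only [(hd _).fderiv] at this
    simp only [pow_zero, one_mul, zero_add, pow_one, e, e'] at this
    unfold II
    have ep : (EuclideanSpace.proj k : En n →L[ℂ] ℂ) (EuclideanSpace.single k (1:ℂ)) = 1 := by simp
    simp only [ep, mul_one] at this
    rw [this]
    congr 1
    congr 1; funext w
    push_cast; rw [← Complex.mul_conj', mul_comm (w.ofLp k)]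
  have ic : ∀ Φ : En n → ℂ, Continuous Φ → Integrable (fun w => (om β w : ℂ) * Φ w) (vol n) := fun Φ h =>
    oc_int β hβ 2 (by norm_num) Φ h.continuousOn
  have h2 : ∑ k : Fin n, ∫ w : En n, (om β w : ℂ) * ((‖w k‖^2 : ℝ) : ℂ) ∂vol n = II n β - II n (β + 1) := by
    unfold II
    rw [← integral_finsetSum, ← integral_sub]
    · congr 1; funext w
      rw [om_succ β hβ, ← Finset.mul_sum, ← Complex.ofReal_sum, ← EuclideanSpace.norm_sq_eq]
      push_cast; ring
    · simpa using ic (fun _ => 1) continuous_const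
    · simpa using oc_int (β + 1) (by linarith) 2 (by norm_num) (fun _ : En n => 1) continuousOn_const
    · intro k _
      apply ic
      fun_prop
  have h3 : (n : ℂ) * II n (β + 1) = (β + 1) * (II n β - II n (β + 1)) := by
    rw [← h2, Finset.mul_sum, ← Finset.sum_congr rfl (fun k _ => h1 k)]
    simp
  linear_combination h3

def pp (a : ℂ) (j : ℕ) : ℂ := ∏ i ∈ Finset.range j, (a + i)

theorem L1 {n : ℕ} (R : ℝ) (hR : 1 < R) (ξ : En n) (j : ℕ) : ∀ (β : ℝ), 0 < β → ∀ (g : En n → ℂ),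
    DifferentiableOn ℂ g (Metric.ball 0 R) →
    ∫ w, (om β w : ℂ) * ((herm ξ w) ^ j * g w) ∂vol n =
      II n β / pp (n + 1 + β) j * iteratedDeriv j (fun t : ℂ => g (t • ξ)) 0 := by
  induction j with
  | zero =>
    intro β hβ g hg
    simp only [pow_zero, one_mul, pp, Finset.range_zero, Finset.prod_empty, div_one, iteratedDeriv_zero, zero_smul]
    exact mean_val β hβ R hR g hg
  | succ j ih =>
    intro β hβ g hg
    have h1 := IBP2 β hβ R hR g hg ξ j
    rw [ih (β + 1) (by linarith) _ (hol_deriv R g hg ξ)] at h1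
    have hev : deriv (fun t : ℂ => g (t • ξ)) =ᶠ[𝓝 0] fun t : ℂ => fderiv ℂ g (t • ξ) ξ := by
      have : ∀ᶠ t in 𝓝 (0:ℂ), t • ξ ∈ Metric.ball (0 : En n) R := by
        have c : Continuous fun t : ℂ => t • ξ := by fun_prop
        apply c.continuousAt.eventually
        apply Metric.isOpen_ball.mem_nhds
        simp; linarith
      filter_upwards [this] with t ht
      have h := hg.differentiableAt (Metric.isOpen_ball.mem_nhds ht)
      have h2 : HasDerivAt (fun t : ℂ => t • ξ) ξ t := by
        simpa using (hasDerivAt_id t).smul_const ξ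
      exact (h.hasFDerivAt.comp_hasDerivAt t h2).deriv
    rw [iteratedDeriv_succ', hev.iteratedDeriv_eq]
    have hb : (β:ℂ) + 1 ≠ 0 := by exact_mod_cast (by linarith : β + 1 ≠ 0)
    have hc : II n (β + 1) / pp (n + 1 + (β + 1 : ℝ)) j = (β + 1) * (II n β / pp (n + 1 + β) (j + 1)) := by
      have e : pp (n + 1 + β) (j + 1) = pp (n + 1 + (β + 1 : ℝ)) j * (n + 1 + β) := by
        unfold pp
        rw [Finset.prod_range_succ']
        congr 1
        · apply Finset.prod_congr rfl
          intro i _; push_cast; ring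
        · simp
      have hne : (n : ℂ) + 1 + β ≠ 0 := by exact_mod_cast (by positivity : (n : ℝ) + 1 + β ≠ 0)
      rw [e, ← mul_div_assoc, ← II_rec n β hβ, mul_div_mul_right _ _ hne]
    rw [hc] at h1
    apply mul_left_cancel₀ hb
    rw [← h1]
    ring



theorem pp_succ' (a : ℂ) (j : ℕ) : pp a (j + 1) = a * pp (a + 1) j := by
  unfold pp
  rw [Finset.prod_range_succ', mul_comm]
  congr 1
  · simp
  · apply Finset.prod_congr rfl
    intro i _; push_cast; ring

theorem pp_pos (a : ℝ) (ha : 0 < a) (j : ℕ) : ∃ x : ℝ, 0 < x ∧ pp a j = x := by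
  refine ⟨∏ i ∈ Finset.range j, (a + i), Finset.prod_pos fun i _ => by positivity, ?_⟩
  unfold pp; push_cast; rfl

theorem iter_cpow (b c : ℂ) (hc : 0 < c.re) (j : ℕ) : ∀ a : ℂ,
    iteratedDeriv j (fun t : ℂ => (c - t * b) ^ (-a)) 0 = pp a j * b ^ j * c ^ (-(a + j)) := by
  induction j with
  | zero => intro a; simp [pp]
  | succ j ih =>
    intro a
    have hev : deriv (fun t : ℂ => (c - t * b) ^ (-a)) =ᶠ[𝓝 0] fun t : ℂ => (a * b) * (c - t * b) ^ (-(a + 1)) := by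
      have : ∀ᶠ t in 𝓝 (0:ℂ), 0 < (c - t * b).re := by
        have cc : Continuous fun t : ℂ => (c - t * b).re := by fun_prop
        exact cc.continuousAt.eventually (lt_mem_nhds (by simpa using hc))
      filter_upwards [this] with t ht
      have h1 : HasDerivAt (fun t : ℂ => c - t * b) (-b) t := by
        simpa using ((hasDerivAt_id t).mul_const b).const_sub c
      have h2 := h1.cpow_const (c := -a) (Or.inl ht)
      rw [h2.deriv]
      have : -(a+1) = -a - 1 := by ring
      rw [this]; ring
    rw [iteratedDeriv_succ', hev.iteratedDeriv_eq]
    have e := iteratedDeriv_const_mul_field (n := j) (x := (0:ℂ)) (a * b) (fun t : ℂ => (c - t * b) ^ (-(a+1)))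
    rw [e, ih (a + 1), pp_succ']
    push_cast
    rw [show a + 1 + (j:ℂ) = a + (j + 1) by ring]
    ring

theorem binom_hasSum (a x : ℂ) (hx : ‖x‖ < 1) :
    HasSum (fun j : ℕ => pp a j / (j.factorial : ℂ) * x ^ j) ((1 - x) ^ (-a)) := by
  have hd : DifferentiableOn ℂ (fun x : ℂ => (1 - x * 1) ^ (-a)) (Metric.ball 0 1) := by
    intro t ht
    have ht' : ‖t‖ < 1 := by simpa using ht
    apply DifferentiableAt.differentiableWithinAt
    apply DifferentiableAt.cpow_const (by fun_prop)
    left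
    have := (Complex.re_le_norm t)
    simp; linarith
  have h := Complex.hasSum_taylorSeries_on_ball hd (z := x) (by simpa using hx)
  simp only [iter_cpow 1 1 (by simp)] at h
  simp only [mul_one] at h
  convert! h using 2 with j
  simp
  ring

theorem repro1 {n : ℕ} (β : ℝ) (hβ : 0 < β) (R : ℝ) (hR : 1 < R) (g : En n → ℂ)
    (hg : DifferentiableOn ℂ g (Metric.ball 0 R)) (z : En n) (hz : ‖z‖ < 1) :
    ∫ w, (om β w : ℂ) * (g w * (1 - herm z w) ^ (-((n:ℂ) + 1 + β))) ∂vol n = II n β * g z := by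
  set a : ℂ := (n:ℂ) + 1 + β
  have ar : a = (((n:ℝ) + 1 + β : ℝ) : ℂ) := by simp [a]
  have apos : (0:ℝ) < (n:ℝ) + 1 + β := by positivity
  have ppn : ∀ j, pp a j ≠ 0 := by
    intro j
    obtain ⟨x, hx, h⟩ := pp_pos _ apos j
    rw [ar, h]; exact_mod_cast hx.ne'
  set F : ℕ → En n → ℂ := fun j w => pp a j / (j.factorial : ℂ) * ((om β w : ℂ) * ((herm z w) ^ j * g w))
  have ch : Continuous fun w => herm z w := continuous_herm_right z
  have ci : ∀ j, Integrable (fun w => (om β w : ℂ) * ((herm z w) ^ j * g w)) (vol n) := fun j =>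
    oc_int β hβ R hR _ ((ch.pow j).continuousOn.mul hg.continuousOn)
  have iF : ∀ j, Integrable (F j) (vol n) := fun j => (ci j).const_mul _
  have i0 : Integrable (fun w => (om β w : ℂ) * g w) (vol n) := oc_int β hβ R hR _ hg.continuousOn
  have hzw : ∀ w : En n, ‖w‖ ≤ 1 → ‖herm z w‖ ≤ ‖z‖ := fun w hw => (norm_herm_le z w).trans (by nlinarith [norm_nonneg z])
  have bF : ∀ j w, ‖F j w‖ ≤ ‖pp a j / (j.factorial : ℂ) * (‖z‖ : ℂ) ^ j‖ * ‖(om β w : ℂ) * g w‖ := by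
    intro j w
    rcases le_or_gt 1 ‖w‖ with h | h
    · simp only [F]; rw [om_zero β hβ w h]; simp
    · simp only [F, norm_mul, norm_pow, Complex.norm_real, norm_norm]
      have := pow_le_pow_left₀ (norm_nonneg _) (hzw w h.le) j
      calc _ = ‖pp a j / (j.factorial : ℂ)‖ * (‖om β w‖ * ‖g w‖) * ‖herm z w‖ ^ j := by ring
        _ ≤ ‖pp a j / (j.factorial : ℂ)‖ * (‖om β w‖ * ‖g w‖) * ‖z‖ ^ j := by gcongr
        _ = _ := by ring
  have sm : Summable fun j => ‖pp a j / (j.factorial : ℂ) * (‖z‖ : ℂ) ^ j‖ := by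
    have := (binom_hasSum a (‖z‖ : ℂ) (by simpa using hz)).summable
    exact this.norm
  have sF : Summable fun j => ∫ w, ‖F j w‖ ∂vol n := by
    apply Summable.of_nonneg_of_le (fun j => integral_nonneg fun w => norm_nonneg _) _ (sm.mul_right (∫ w, ‖(om β w : ℂ) * g w‖ ∂vol n))
    intro j
    rw [← integral_const_mul]
    exact integral_mono (iF j).norm (i0.norm.const_mul _) (bF j)
  have h1 := hasSum_integral_of_summable_integral_norm iF sF
  have e1 : ∀ w, ∑' j, F j w = (om β w : ℂ) * (g w * (1 - herm z w) ^ (-a)) := by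
    intro w
    rcases le_or_gt 1 ‖w‖ with h | h
    · simp only [F]; rw [om_zero β hβ w h]; simp
    · have := (binom_hasSum a (herm z w) ((hzw w h.le).trans_lt hz)).mul_left ((om β w : ℂ) * g w)
      rw [← mul_assoc, ← this.tsum_eq]
      apply tsum_congr
      intro j
      simp only [F]; ring
  simp only [e1] at h1
  have e2 : ∀ j, ∫ w, F j w ∂vol n = II n β * ((j.factorial : ℂ)⁻¹ • (1 - 0 : ℂ) ^ j • iteratedDeriv j (fun t : ℂ => g (t • z)) 0) := by
    intro j
    simp only [F]
    rw [integral_const_mul, L1 R hR z j β hβ g hg]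
    have := ppn j
    simp only [sub_zero, one_pow, one_smul, smul_eq_mul]
    simp only [a] at this ⊢
    field_simp
  simp only [e2] at h1
  have hd : DifferentiableOn ℂ (fun t : ℂ => g (t • z)) (Metric.ball 0 R) := by
    intro t ht
    have ht' : ‖t‖ < R := by simpa using ht
    have hm : t • z ∈ Metric.ball (0 : En n) R := by
      simp only [Metric.mem_ball, dist_zero_right, norm_smul]
      nlinarith [norm_nonneg t]
    apply DifferentiableAt.differentiableWithinAt
    exact DifferentiableAt.comp t (hg.differentiableAt (Metric.isOpen_ball.mem_nhds hm)) (by fun_prop)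
  have h2 := (Complex.hasSum_taylorSeries_on_ball hd (z := 1) (by simpa using hR)).mul_left (II n β)
  have := h1.unique h2
  simpa using this



theorem norm_cpow_re (x : ℂ) (a : ℝ) (hx : x ≠ 0) : ‖x ^ (a : ℂ)‖ = ‖x‖ ^ a := by
  rw [Complex.norm_cpow_of_ne_zero hx]; simp

theorem om_mono {n : ℕ} (β : ℝ) (hβ : 0 < β) (u v : En n) (h : ‖u‖ ≤ ‖v‖) : om β v ≤ om β u := by
  unfold om
  apply Real.rpow_le_rpow (le_max_left _ _) _ hβ.le
  apply max_le_max le_rfl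
  nlinarith [norm_nonneg u]

theorem repro2 {n : ℕ} (β : ℝ) (hβ : 0 < β) (f : En n → ℂ)
    (hf : DifferentiableOn ℂ f (Metric.ball 0 1)) (hi : Integrable (fun w => (om β w : ℂ) * f w) (vol n)) (z : En n) (hz : ‖z‖ < 1) :
    ∫ w, (om β w : ℂ) * (f w * (1 - herm z w) ^ (-((n:ℂ) + 1 + β))) ∂vol n = II n β * f z := by
  set a : ℝ := (n:ℝ) + 1 + β
  have apos : 0 < a := by positivity
  have ac : -((n:ℂ) + 1 + β) = ((-a : ℝ) : ℂ) := by simp [a]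
  rw [ac]
  set H : ℝ → En n → ℂ := fun r u => (om β (r⁻¹ • u) : ℂ) * (f u * (1 - herm z (r⁻¹ • u)) ^ ((-a : ℝ) : ℂ))
  have hev : ∀ᶠ r : ℝ in 𝓝[<] 1, 0 < r ∧ r < 1 := by
    filter_upwards [self_mem_nhdsWithin, nhdsWithin_le_nhds (lt_mem_nhds (show (0:ℝ) < 1 by norm_num))] with r h1 h2
    exact ⟨h2, h1⟩
  have step : ∀ r : ℝ, 0 < r → r < 1 → Integrable (H r) (vol n) ∧
      ∫ u, H r u ∂vol n = ((r ^ Module.finrank ℝ (En n) : ℝ) : ℂ) * (II n β * f (r • z)) := by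
    intro r h0 h1
    have hR : 1 < r⁻¹ := (one_lt_inv₀ h0).2 h1
    have hg : DifferentiableOn ℂ (fun w : En n => f (r • w)) (Metric.ball 0 r⁻¹) := by
      intro w hw
      have hw' : ‖w‖ < r⁻¹ := by simpa using hw
      have hm : r • w ∈ Metric.ball (0 : En n) 1 := by
        simp only [Metric.mem_ball, dist_zero_right, norm_smul, Real.norm_eq_abs, abs_of_pos h0]
        calc r * ‖w‖ < r * r⁻¹ := by gcongr
          _ = 1 := mul_inv_cancel₀ h0.ne'
      apply DifferentiableAt.differentiableWithinAt
      have : (fun w : En n => f (r • w)) = fun w : En n => f ((r:ℂ) • w) := rfl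
      rw [this]
      exact DifferentiableAt.comp w (hf.differentiableAt (Metric.isOpen_ball.mem_nhds hm)) (by fun_prop)
    have e := repro1 β hβ r⁻¹ hR _ hg z hz
    rw [ac] at e
    have eH : (fun w => H r (r • w)) = fun w => (om β w : ℂ) * (f (r • w) * (1 - herm z w) ^ ((-a : ℝ) : ℂ)) := by
      funext w
      simp only [H, smul_smul, inv_mul_cancel₀ h0.ne', one_smul]
    have c := Measure.integral_comp_smul (vol n) (H r) r
    rw [eH, e] at c
    have hp : 0 < r ^ Module.finrank ℝ (En n) := by positivity
    constructor
    · rw [← integrable_comp_smul_iff (vol n) (H r) h0.ne', eH]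
      have hq : 1 < 2 / (1 + ‖z‖) := by rw [lt_div_iff₀ (by positivity)]; linarith
      apply oc_int β hβ (min r⁻¹ (2 / (1 + ‖z‖))) (lt_min hR hq)
      apply ContinuousOn.mul
      · exact hg.continuousOn.mono (Metric.ball_subset_ball (min_le_left _ _))
      · intro w hw
        have hw' : ‖w‖ < 2 / (1 + ‖z‖) := lt_of_lt_of_le (by simpa using hw) (min_le_right r⁻¹ _)
        have h2 : ‖z‖ * ‖w‖ < 1 := by
          rw [lt_div_iff₀ (by positivity)] at hw'
          nlinarith [norm_nonneg z, norm_nonneg w]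
        apply ContinuousAt.continuousWithinAt
        apply ContinuousAt.cpow
        · exact continuousAt_const.sub (continuous_herm_right z).continuousAt
        · exact continuousAt_const
        · left
          exact re_pos z w h2
    · rw [c, abs_of_pos (by positivity), Complex.real_smul, ← mul_assoc, ← Complex.ofReal_mul, mul_inv_cancel₀ hp.ne']
      simp
  have lim1 : Tendsto (fun r => ∫ u, H r u ∂vol n) (𝓝[<] 1) (𝓝 (II n β * f z)) := by
    have : Tendsto (fun r : ℝ => ((r ^ Module.finrank ℝ (En n) : ℝ) : ℂ) * (II n β * f (r • z))) (𝓝[<] 1) (𝓝 (II n β * f z)) := by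
      have h1 : ContinuousAt (fun r : ℝ => ((r ^ Module.finrank ℝ (En n) : ℝ) : ℂ) * (II n β * f (r • z))) 1 := by
        apply ContinuousAt.mul
        · fun_prop
        · apply ContinuousAt.mul continuousAt_const
          have h2 : ContinuousAt f ((1:ℝ) • z) := by
            rw [one_smul]
            exact hf.continuousOn.continuousAt (Metric.isOpen_ball.mem_nhds (by simpa using hz))
          exact ContinuousAt.comp (f := fun r : ℝ => r • z) h2 (by fun_prop)
      have := h1.tendsto
      simp only [one_pow, Complex.ofReal_one, one_mul, one_smul] at this
      exact this.mono_left nhdsWithin_le_nhds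
    apply this.congr'
    filter_upwards [hev] with r hr
    exact (step r hr.1 hr.2).2.symm
  have lim2 : Tendsto (fun r => ∫ u, H r u ∂vol n) (𝓝[<] 1) (𝓝 (∫ u, (om β u : ℂ) * (f u * (1 - herm z u) ^ ((-a : ℝ) : ℂ)) ∂vol n)) := by
    apply tendsto_integral_filter_of_dominated_convergence (fun u => (1 - ‖z‖) ^ (-a) * ‖(om β u : ℂ) * f u‖)
    · filter_upwards [hev] with r hr
      exact (step r hr.1 hr.2).1.aestronglyMeasurable
    · filter_upwards [hev] with r hr
      refine ae_of_all _ fun u => ?_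
      simp only [H]
      rcases le_or_gt 1 ‖r⁻¹ • u‖ with h | h
      · rw [om_zero β hβ _ h]; simp only [Complex.ofReal_zero, zero_mul, norm_zero]
        have := Real.rpow_nonneg (by linarith : 0 ≤ 1 - ‖z‖) (-a)
        positivity
      · have h2 : ‖z‖ * ‖r⁻¹ • u‖ < 1 := by nlinarith [norm_nonneg z, norm_nonneg (r⁻¹ • u)]
        have h3 : 1 - ‖z‖ ≤ ‖1 - herm z (r⁻¹ • u)‖ := (by nlinarith [norm_nonneg z] : 1 - ‖z‖ ≤ 1 - ‖z‖ * ‖r⁻¹ • u‖).trans (le_one_sub_herm z _)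
        have h4 : ‖u‖ ≤ ‖r⁻¹ • u‖ := by
          rw [norm_smul, Real.norm_eq_abs, abs_of_pos (inv_pos.2 hr.1)]
          have : 1 ≤ r⁻¹ := (one_le_inv₀ hr.1).2 hr.2.le
          nlinarith [norm_nonneg u]
        have h5 := om_mono β hβ _ _ h4
        rw [norm_mul, norm_mul, norm_mul, norm_cpow_re _ _ (one_sub_herm_ne z _ h2), Complex.norm_real, Complex.norm_real,
          Real.norm_of_nonneg (om_nonneg _ _), Real.norm_of_nonneg (om_nonneg _ _)]
        have h6 : ‖1 - herm z (r⁻¹ • u)‖ ^ (-a) ≤ (1 - ‖z‖) ^ (-a) :=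
          Real.rpow_le_rpow_of_nonpos (by linarith) h3 (by linarith)
        have := om_nonneg β (r⁻¹ • u)
        calc _ ≤ om β u * (‖f u‖ * (1 - ‖z‖) ^ (-a)) := by gcongr; exact om_nonneg _ _
          _ = _ := by ring
    · exact hi.norm.const_mul _
    · refine ae_of_all _ fun u => ?_
      rcases le_or_gt 1 ‖u‖ with h | h
      · rw [om_zero β hβ _ h]
        simp only [Complex.ofReal_zero, zero_mul]
        apply tendsto_const_nhds.congr'
        filter_upwards [hev] with r hr
        have : 1 ≤ ‖r⁻¹ • u‖ := by
          rw [norm_smul, Real.norm_eq_abs, abs_of_pos (inv_pos.2 hr.1)]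
          have : 1 ≤ r⁻¹ := (one_le_inv₀ hr.1).2 hr.2.le
          nlinarith [norm_nonneg u]
        simp only [H]; rw [om_zero β hβ _ this]; simp
      · have h2 : ‖z‖ * ‖u‖ < 1 := by nlinarith [norm_nonneg z, norm_nonneg u]
        have cs : ContinuousAt (fun r : ℝ => r⁻¹ • u) 1 := by
          have : ContinuousAt (fun r : ℝ => r⁻¹) 1 := continuousAt_inv₀ one_ne_zero
          exact ContinuousAt.smul this continuousAt_const
        have c1 : ContinuousAt (fun r : ℝ => H r u) 1 := by
          simp only [H]
          apply ContinuousAt.mul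
          · exact (Complex.continuous_ofReal.comp (om_cont β hβ)).continuousAt.comp cs
          · apply ContinuousAt.mul continuousAt_const
            apply ContinuousAt.cpow
            · exact continuousAt_const.sub ((continuous_herm_right z).continuousAt.comp cs)
            · exact continuousAt_const
            · left
              simp only [inv_one, one_smul]
              exact re_pos z u h2
        have := c1.tendsto
        simp only [H, inv_one, one_smul] at this
        exact this.mono_left nhdsWithin_le_nhds
  exact tendsto_nhds_unique lim2 lim1



theorem integral_measA (n : ℕ) (α : ℝ) (hα : -1 < α) (G : En n → ℂ) : ∫ z, G z ∂measA n α =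
    ∫ z in uball n, ((cnorm n α * (1 - ‖z‖ ^ 2) ^ α : ℝ) : ℂ) * G z ∂vol n := by
  rw [measA, integral_withDensity_eq_integral_toReal_smul (measurable_dens n α).ennreal_ofReal (Eventually.of_forall fun z => ENNReal.ofReal_lt_top)]
  apply setIntegral_congr_fun (measurableSet_uball n)
  intro z hz
  have hz' := mem_uball.1 hz
  have : 0 ≤ cnorm n α * (1 - ‖z‖ ^ 2) ^ α := mul_nonneg (cnorm_pos n α hα).le (Real.rpow_nonneg (by nlinarith [norm_nonneg z]) _)
  simp only [ENNReal.toReal_ofReal this, Complex.real_smul]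

theorem integrable_measA (n : ℕ) (α : ℝ) (hα : -1 < α) (G : En n → ℂ) : Integrable G (measA n α) ↔
    IntegrableOn (fun z => ((cnorm n α * (1 - ‖z‖ ^ 2) ^ α : ℝ) : ℂ) * G z) (uball n) (vol n) := by
  rw [measA, integrable_withDensity_iff_integrable_smul' (measurable_dens n α).ennreal_ofReal (Eventually.of_forall fun z => ENNReal.ofReal_lt_top)]
  apply integrableOn_congr_fun _ (measurableSet_uball n)
  intro z hz
  have hz' := mem_uball.1 hz
  have : 0 ≤ cnorm n α * (1 - ‖z‖ ^ 2) ^ α := mul_nonneg (cnorm_pos n α hα).le (Real.rpow_nonneg (by nlinarith [norm_nonneg z]) _)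
  simp only [ENNReal.toReal_ofReal this, Complex.real_smul]

theorem om_eq {n : ℕ} (α : ℝ) (m : ℕ) (w : En n) (hw : ‖w‖ < 1) :
    om (α + m) w = (1 - ‖w‖^2) ^ α * (1 - ‖w‖^2) ^ m := by
  have : 0 < 1 - ‖w‖^2 := by nlinarith [norm_nonneg w]
  unfold om
  rw [max_eq_right this.le, Real.rpow_add this, Real.rpow_natCast]

theorem repro3 {n : ℕ} (α : ℝ) (hα : -1 < α) (m : ℕ) (hm : 0 < α + m) :
    ∃ κ : ℂ, ∀ f : En n → ℂ, DifferentiableOn ℂ f (uball n) → Integrable f (measA n α) →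
      ∀ z, ‖z‖ < 1 → f z = κ * ∫ w, f w * (((1 - ‖w‖^2)^m : ℝ) : ℂ) * (1 - herm z w) ^ (-(((n:ℝ) + 1 + α + m : ℝ) : ℂ)) ∂measA n α := by
  have hc := cnorm_pos n α hα
  have hcc : (cnorm n α : ℂ) ≠ 0 := by exact_mod_cast hc.ne'
  have hI := II_ne n (α + m) hm
  refine ⟨(cnorm n α : ℂ)⁻¹ * (II n (α + m))⁻¹, fun f hf hi z hz => ?_⟩
  have z0 : ∀ w : En n, w ∉ uball n → om (α + m) w = 0 := fun w hw => om_zero _ hm w (by simpa [mem_uball] using hw)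
  have h1 : Integrable (fun w => (om (α + m) w : ℂ) * f w) (vol n) := by
    rw [integrable_measA n α hα] at hi
    have h2 : IntegrableOn (fun w => (om (α + m) w : ℂ) * f w) (uball n) (vol n) := by
      have h3 : IntegrableOn (fun w => ((cnorm n α : ℂ)⁻¹ * (((1 - ‖w‖^2)^m : ℝ) : ℂ)) * (((cnorm n α * (1 - ‖w‖ ^ 2) ^ α : ℝ) : ℂ) * f w)) (uball n) (vol n) := by
        apply Integrable.bdd_mul (c := ‖(cnorm n α : ℂ)⁻¹‖) hi
        · apply Continuous.aestronglyMeasurable; fun_prop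
        · filter_upwards [ae_restrict_mem (measurableSet_uball n)] with w hw
          have hw' := mem_uball.1 hw
          rw [norm_mul, Complex.norm_real, norm_pow, Real.norm_eq_abs]
          apply mul_le_of_le_one_right (norm_nonneg _)
          apply pow_le_one₀ (abs_nonneg _)
          rw [abs_le]; constructor <;> nlinarith [norm_nonneg w]
      apply (integrableOn_congr_fun _ (measurableSet_uball n)).1 h3
      intro w hw
      simp only [om_eq α m w (mem_uball.1 hw)]
      push_cast
      field_simp
    rw [← integrableOn_iff_integrable_of_support_subset (s := uball n)]
    · exact h2
    · intro w hw
      by_contra h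
      rw [Function.mem_support, z0 w h] at hw
      simp at hw
  have h2 := repro2 (α + m) hm f hf h1 z hz
  have h3 : ∫ w, f w * (((1 - ‖w‖^2)^m : ℝ) : ℂ) * (1 - herm z w) ^ (-(((n:ℝ) + 1 + α + m : ℝ) : ℂ)) ∂measA n α
     = (cnorm n α : ℂ) * (II n (α + m) * f z) := by
    rw [← h2, integral_measA n α hα, ← integral_const_mul]
    conv_rhs => rw [← setIntegral_eq_integral_of_forall_compl_eq_zero (s := uball n) (by intro w hw; rw [z0 w hw]; simp)]
    · apply setIntegral_congr_fun (measurableSet_uball n)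
      intro w hw
      simp only [om_eq α m w (mem_uball.1 hw)]
      push_cast
      rw [← add_assoc]
      ring
  rw [h3]; field_simp

def bxi {n : ℕ} (ζ : En n) (δ : ℝ) (u : En n) : En n :=
  LD ζ (4 / δ) (4 / √δ) (u - ((1 - δ : ℝ) : ℂ) • ζ)

theorem bxi_bx {n : ℕ} (ζ : En n) (hζ : ‖ζ‖ = 1) (δ : ℝ) (hδ : 0 < δ) (v : En n) : bxi ζ δ (bx ζ δ v) = v := by
  have hs : 0 < √δ := Real.sqrt_pos.2 hδ
  unfold bxi bx
  rw [add_sub_cancel_left, LD_comp ζ hζ]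
  rw [show 4 / δ * (δ * (1/4)) = 1 by field_simp, show 4 / √δ * (√δ * (1/4)) = 1 by field_simp, LD_one]

theorem bx_bxi {n : ℕ} (ζ : En n) (hζ : ‖ζ‖ = 1) (δ : ℝ) (hδ : 0 < δ) (v : En n) : bx ζ δ (bxi ζ δ v) = v := by
  have hs : 0 < √δ := Real.sqrt_pos.2 hδ
  unfold bxi bx
  rw [LD_comp ζ hζ]
  rw [show (δ * (1/4)) * (4 / δ) = 1 by field_simp, show (√δ * (1/4)) * (4 / √δ) = 1 by field_simp, LD_one]
  abel

theorem cont_lin {n : ℕ} (A : En n →ₗ[ℂ] En n) : Continuous A := A.continuous_of_finiteDimensional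

theorem cont_bx {n : ℕ} (ζ : En n) (δ : ℝ) : Continuous (bx ζ δ) := by
  unfold bx
  exact continuous_const.add (cont_lin _)

theorem cont_bxi {n : ℕ} (ζ : En n) (δ : ℝ) : Continuous (bxi ζ δ) := by
  unfold bxi
  exact (cont_lin _).comp (continuous_id.sub continuous_const)

theorem push {n : ℕ} (hn : 1 ≤ n) (α : ℝ) (hα : -1 < α) : ∃ C : ℝ, 0 < C ∧ ∀ (ζ : En n) (δ : ℝ), ‖ζ‖ = 1 → 0 < δ → δ ≤ 1 →
    ∀ ψ : En n → ℂ, Continuous ψ → (∀ v, 1 ≤ ‖v‖ → ψ v = 0) → (∀ v, ‖ψ v‖ ≤ 1) →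
    ∃ a : En n → ℂ, Measurable a ∧ (∀ u, u ∉ TT ζ (2 * δ) → a u = 0) ∧ (∀ u, ‖a u‖ ≤ C * δ ^ (-((n:ℝ) + 1 + α))) ∧
      ∀ G : En n → ℂ, Measurable G → ∫ u, a u * G u ∂measA n α = ∫ v, ψ v * G (bx ζ δ v) ∂vol n := by
  have hc := cnorm_pos n α hα
  refine ⟨((1/4:ℝ) ^ (2*n))⁻¹ * (cnorm n α)⁻¹ * (3:ℝ)^|α|, by positivity, fun ζ δ hζ hδ hδ1 ψ hψ hψ0 hψ1 => ?_⟩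
  obtain ⟨hdet, hD⟩ := det_sq hn ζ hζ δ (1/4) hδ (by norm_num)
  set D : ℝ := ‖LinearMap.det (LD ζ (δ * (1/4)) (√δ * (1/4)))‖ ^ 2 with hDdef
  have Dpos : 0 < D := by positivity
  have supp : ∀ u, ψ (bxi ζ δ u) ≠ 0 → ∃ v, ‖v‖ < 1 ∧ u = bx ζ δ v := by
    intro u hu
    refine ⟨bxi ζ δ u, ?_, (bx_bxi ζ hζ δ hδ u).symm⟩
    by_contra h
    exact hu (hψ0 _ (not_lt.1 h))
  refine ⟨fun u => ψ (bxi ζ δ u) / ((D * (cnorm n α * (1 - ‖u‖^2) ^ α) : ℝ) : ℂ), ?_, ?_, ?_, ?_⟩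
  · apply Measurable.div
    · exact (hψ.comp (cont_bxi ζ δ)).measurable
    · exact Complex.measurable_ofReal.comp ((measurable_dens n α).const_mul D)
  · intro u hu
    by_cases h : ψ (bxi ζ δ u) = 0
    · beta_reduce; rw [h]; simp
    · obtain ⟨v, hv, rfl⟩ := supp u h
      obtain ⟨-, -, h3, h4⟩ := bx_bounds ζ hζ δ hδ hδ1 v (by linarith)
      exact absurd ⟨h3, h4⟩ hu
  · intro u
    by_cases h : ψ (bxi ζ δ u) = 0
    · beta_reduce; rw [h, zero_div, norm_zero]
      have := Real.rpow_nonneg hδ.le (-((n:ℝ) + 1 + α))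
      positivity
    · obtain ⟨v, hv, rfl⟩ := supp u h
      obtain ⟨h1, -, h3, h4⟩ := bx_bounds ζ hζ δ hδ hδ1 v (by linarith)
      have h5 := (bx_rpow ζ hζ δ hδ hδ1 v (by linarith) α).1
      have hp : 0 < δ ^ α := Real.rpow_pos_of_pos hδ _
      have h6 : 0 < (3:ℝ) ^ (-|α|) := by positivity
      have h7 : 0 ≤ (1 - ‖bx ζ δ v‖^2) ^ α := Real.rpow_nonneg (by nlinarith [norm_nonneg (bx ζ δ v)]) _
      rw [norm_div, Complex.norm_real, Real.norm_of_nonneg (by positivity), hD]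
      calc _ ≤ 1 / (δ ^ (n+1) * (1/4) ^ (2*n) * (cnorm n α * ((3:ℝ)^(-|α|) * δ ^ α))) := by
            gcongr
            exact hψ1 _
        _ = _ := by
            rw [Real.rpow_neg (by norm_num : (0:ℝ) ≤ 3), Real.rpow_neg hδ.le, Real.rpow_add hδ]
            have : δ ^ ((n:ℝ) + 1) = δ ^ (n+1) := by exact_mod_cast Real.rpow_natCast δ (n+1)
            rw [this]
            field_simp
  · intro G hG
    rw [integral_measA n α hα]
    have e1 : ∫ z in uball n, ((cnorm n α * (1 - ‖z‖ ^ 2) ^ α : ℝ) : ℂ) * (ψ (bxi ζ δ z) / ((D * (cnorm n α * (1 - ‖z‖^2) ^ α) : ℝ) : ℂ) * G z) ∂vol n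
        = ∫ z, (D : ℂ)⁻¹ * (ψ (bxi ζ δ z) * G z) ∂vol n := by
      have hz0 : ∀ z, z ∉ uball n → (D : ℂ)⁻¹ * (ψ (bxi ζ δ z) * G z) = 0 := by
        intro z hz
        by_cases h : ψ (bxi ζ δ z) = 0
        · rw [h]; simp
        · obtain ⟨v, hv, rfl⟩ := supp z h
          obtain ⟨-, -, h3, -⟩ := bx_bounds ζ hζ δ hδ hδ1 v (by linarith)
          exact absurd (mem_uball.2 h3) hz
      conv_rhs => rw [← setIntegral_eq_integral_of_forall_compl_eq_zero hz0]
      · apply setIntegral_congr_fun (measurableSet_uball n)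
        intro z hz
        have hz' := mem_uball.1 hz
        have : 0 < cnorm n α * (1 - ‖z‖ ^ 2) ^ α := mul_pos hc (Real.rpow_pos_of_pos (by nlinarith [norm_nonneg z]) _)
        have h7 : ((cnorm n α * (1 - ‖z‖ ^ 2) ^ α : ℝ) : ℂ) ≠ 0 := by exact_mod_cast this.ne'
        have h8 : (D : ℂ) ≠ 0 := by exact_mod_cast Dpos.ne'
        simp only [Complex.ofReal_mul D]
        field_simp
    rw [e1]
    have hs := vol_scale (LD ζ (δ * (1/4)) (√δ * (1/4))) hdet (((1 - δ : ℝ) : ℂ) • ζ)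
    rw [← hDdef] at hs
    conv_lhs => rw [hs]
    have mb : Measurable (fun v => ((1 - δ : ℝ) : ℂ) • ζ + LD ζ (δ * (1/4)) (√δ * (1/4)) v) := (cont_bx ζ δ).measurable
    rw [integral_smul_measure, integral_map mb.aemeasurable, ENNReal.toReal_ofReal Dpos.le, ← integral_smul]
    · congr 1; funext v
      have : ((1 - δ : ℝ) : ℂ) • ζ + LD ζ (δ * (1/4)) (√δ * (1/4)) v = bx ζ δ v := rfl
      rw [this, bxi_bx ζ hζ δ hδ, Complex.real_smul]
      have h8 : (D : ℂ) ≠ 0 := by exact_mod_cast Dpos.ne'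
      field_simp
    · exact ((((hψ.comp (cont_bxi ζ δ)).measurable).mul hG).const_mul _).aestronglyMeasurable



theorem conj_cp (x : ℂ) (hx : 0 < x.re) (a : ℝ) : (starRingEnd ℂ) (x ^ (a:ℂ)) = ((starRingEnd ℂ) x) ^ (a:ℂ) := by
  have h : x.arg ≠ Real.pi := by
    intro h
    rw [Complex.arg_eq_pi_iff] at h
    linarith [h.1]
  rw [Complex.conj_cpow _ _ h, Complex.conj_ofReal]

theorem bx_line {n : ℕ} (ζ : En n) (hζ : ‖ζ‖ = 1) (δ : ℝ) (t : ℂ) :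
    bx ζ δ (t • ζ) = (((1 - δ : ℝ) : ℂ) + t * ((δ * (1/4) : ℝ) : ℂ)) • ζ := by
  unfold bx
  rw [LD_apply, herm_smul_left, herm_self, hζ, smul_smul, ← add_smul, ← add_smul]
  congr 1
  push_cast
  ring

theorem proj_a {n : ℕ} (hn : 1 ≤ n) (α : ℝ) (hα : -1 < α) : ∃ C : ℝ, 0 < C ∧ ∀ j : ℕ, ∃ c : ℝ, 0 < c ∧
    ∀ (ζ : En n) (δ : ℝ), ‖ζ‖ = 1 → 0 < δ → δ ≤ 1 →
    ∃ a : En n → ℂ, Measurable a ∧ (∀ u, u ∉ TT ζ (2 * δ) → a u = 0) ∧ (∀ u, ‖a u‖ ≤ C * δ ^ (-((n:ℝ) + 1 + α))) ∧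
      ∀ z : En n, ‖z‖ < 1 → bergProj n α a z = (c : ℂ) * ((δ:ℂ) ^ j * (herm z ζ) ^ j * (1 - (1 - (δ:ℂ)) * herm z ζ) ^ (-(((n:ℝ) + 1 + α + j : ℝ) : ℂ))) := by
  obtain ⟨C, hC, hpush⟩ := push hn α hα
  refine ⟨C, hC, fun j => ?_⟩
  obtain ⟨x1, hx1, e1⟩ := II_pos n 1 one_pos
  obtain ⟨x2, hx2, e2⟩ := pp_pos ((n:ℝ) + 1 + 1) (by positivity) j
  obtain ⟨x3, hx3, e3⟩ := pp_pos ((n:ℝ) + 1 + α) (npos hα) j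
  refine ⟨x1 / x2 * (x3 * (1/4)^j), by positivity, fun ζ δ hζ hδ hδ1 => ?_⟩
  obtain ⟨a, ha1, ha2, ha3, ha4⟩ := hpush ζ δ hζ hδ hδ1 (fun v => (om 1 v : ℂ) * (herm v ζ) ^ j)
    (by
      have := om_cont (n := n) 1 one_pos
      have h2 := continuous_herm_left ζ
      fun_prop)
    (by intro v hv; beta_reduce; rw [om_zero 1 one_pos v hv]; simp)
    (by
      intro v
      by_cases hv : 1 ≤ ‖v‖
      · rw [om_zero 1 one_pos v hv]; simp
      · push Not at hv
        rw [norm_mul, Complex.norm_real, Real.norm_of_nonneg (om_nonneg _ _), norm_pow]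
        apply mul_le_one₀ _ (by positivity)
        · apply pow_le_one₀ (norm_nonneg _)
          apply (norm_herm_le _ _).trans
          rw [hζ]; linarith
        · unfold om
          rw [Real.rpow_one]
          apply max_le <;> nlinarith [norm_nonneg v])
  refine ⟨a, ha1, ha2, ha3, fun z hz => ?_⟩
  have hxr : 0 < (1 - herm (((1 - δ : ℝ):ℂ) • ζ) z).re := by
    apply re_pos
    rw [norm_smul, Complex.norm_real, hζ, Real.norm_of_nonneg (by linarith)]
    nlinarith [norm_nonneg z]
  have hxr' : 0 < (1 - (1 - (δ:ℂ)) * herm z ζ).re := by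
    rw [herm_smul_left] at hxr
    have := congrArg Complex.re (Complex.conj_conj (1 - (1 - (δ:ℂ)) * herm z ζ))
    rw [← this, Complex.conj_re]
    simpa [herm_conj] using hxr
  have hre : ∀ v : En n, ‖v‖ ≤ 2 → 0 < (1 - herm (bx ζ δ v) z).re := by
    intro v hv
    apply re_pos
    have := (bx_bounds ζ hζ δ hδ hδ1 v hv).2.2.1
    nlinarith [norm_nonneg z, norm_nonneg (bx ζ δ v)]
  set N : ℝ := (n:ℝ) + 1 + α with hN
  have h1 : bergProj n α a z = ∫ v, ((om 1 v : ℂ) * (herm v ζ) ^ j) * ((1 - herm z (bx ζ δ v)) ^ (N:ℂ))⁻¹ ∂vol n := by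
    unfold bergProj
    simp only [div_eq_mul_inv]
    exact ha4 (fun u => ((1 - herm z u) ^ (N:ℂ))⁻¹) (measurable_K1 _ z).inv
  have h2 : (starRingEnd ℂ) (bergProj n α a z) = ∫ v, (om 1 v : ℂ) * ((herm ζ v) ^ j * (1 - herm (bx ζ δ v) z) ^ (-(N:ℂ))) ∂vol n := by
    rw [h1, ← integral_conj]
    congr 1; funext v
    by_cases hv : 1 ≤ ‖v‖
    · rw [om_zero 1 one_pos v hv]; simp
    · push Not at hv
      have h3 := hre v (by linarith)
      rw [map_mul, map_mul, Complex.conj_ofReal, map_pow, herm_conj, map_inv₀, Complex.cpow_neg, mul_assoc]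
      congr 3
      rw [← Complex.conj_conj (1 - herm z (bx ζ δ v)), ← conj_cp, Complex.conj_conj] <;> simp only [map_sub, map_one, herm_conj]
      exact h3
  rw [L1 2 one_lt_two ζ j 1 one_pos] at h2
  · have h4 : (fun t : ℂ => (1 - herm (bx ζ δ (t • ζ)) z) ^ (-(N:ℂ))) = fun t => ((1 - herm (((1 - δ : ℝ):ℂ) • ζ) z) - t * (((δ * (1/4) : ℝ) : ℂ) * herm ζ z)) ^ (-(N:ℂ)) := by
      funext t
      rw [bx_line ζ hζ, herm_smul_left, herm_smul_left]
      congr 1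
      ring
    rw [h4, iter_cpow _ _ hxr] at h2
    rw [← Complex.conj_conj (bergProj n α a z), h2, e1, e3, show ((n:ℂ) + 1 + ((1:ℝ):ℂ)) = (((n:ℝ) + 1 + 1 : ℝ) : ℂ) by push_cast; ring, e2]
    have h5 : (-((N:ℂ) + (j:ℂ))) = ((-(N + j) : ℝ) : ℂ) := by push_cast; ring
    rw [h5]
    simp only [map_mul, map_div₀, Complex.conj_ofReal, map_pow, herm_conj]
    rw [conj_cp _ hxr]
    simp only [map_sub, map_one, herm_conj, herm_smul_left, herm_smul_right, map_mul, Complex.conj_ofReal]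
    push_cast
    ring
  · intro v hv
    have hv' : ‖v‖ ≤ 2 := by
      have := mem_ball_zero_iff.1 hv; linarith
    apply DifferentiableAt.differentiableWithinAt
    apply DifferentiableAt.cpow
    · have : (fun v => 1 - herm (bx ζ δ v) z) = fun v => 1 - (herm (((1 - δ : ℝ):ℂ) • ζ) z + herm (LinearMap.toContinuousLinearMap (LD ζ (δ * (1/4)) (√δ * (1/4))) v) z) := by
        funext v
        unfold bx
        rw [herm_add_left]; rfl
      rw [this]
      unfold herm
      fun_prop
    · fun_prop
    · left; exact hre v hv'



theorem atom_of_bdd {n : ℕ} (hn : 1 ≤ n) (q α : ℝ) (hq : 1 < q) (hα : -1 < α) (ζ : En n) (hζ : ‖ζ‖ = 1) (R : ℝ) (hR : 0 < R) (hR4 : R ≤ 4)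
    (a : En n → ℂ) (B : ℝ) (hB : 0 ≤ B) (ha0 : ∀ u, u ∉ TT ζ R → a u = 0) (hab : ∀ u, ‖a u‖ ≤ B)
    (hBm : ENNReal.ofReal B * measA n α (TT ζ R) ≤ 1) (hi : ∫ z, a z ∂measA n α = 0) : IsAtomCT n q α a := by
  have hs : 0 < √R := Real.sqrt_pos.2 hR
  have hct : ctube n ζ (√R) = TT ζ R := by
    rw [ctube_eq ζ hζ _ hs, Real.sq_sqrt hR.le, min_eq_left hR4]
  have := isFinite_measA hn α hα
  refine Or.inr ⟨ζ, √R, hζ, hs, by rw [hct]; exact ha0, ?_, hi⟩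
  rw [hct]
  set μ := measA n α (TT ζ R) with hμ
  have hμt : μ ≠ ⊤ := measure_ne_top _ _
  have hμ0 : μ ≠ 0 := by
    obtain ⟨c, hc, h⟩ := lower_TT hn α hα
    have h1 := h ζ R hζ hR hR4
    have : 0 < ENNReal.ofReal (c * R ^ ((n:ℝ) + 1 + α)) := ENNReal.ofReal_pos.2 (mul_pos hc (Real.rpow_pos_of_pos hR _))
    exact (this.trans_le h1).ne'
  have hq0 : 0 < q := by linarith
  have h1 : ∫⁻ z, ENNReal.ofReal (‖a z‖ ^ q) ∂measA n α ≤ ENNReal.ofReal B ^ q * μ := by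
    calc _ ≤ ∫⁻ z, (TT ζ R).indicator (fun _ => ENNReal.ofReal B ^ q) z ∂measA n α := by
          apply lintegral_mono
          intro z
          by_cases hz : z ∈ TT ζ R
          · simp only [Set.indicator_of_mem hz]
            rw [ENNReal.ofReal_rpow_of_nonneg hB hq0.le]
            apply ENNReal.ofReal_le_ofReal
            exact Real.rpow_le_rpow (norm_nonneg _) (hab z) hq0.le
          · simp only [ha0 z hz, norm_zero, Real.zero_rpow hq0.ne', ENNReal.ofReal_zero]; positivity
      _ = _ := by rw [lintegral_indicator (measurableSet_TT _ _), lintegral_const, Measure.restrict_apply_univ]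
  calc _ ≤ (ENNReal.ofReal B ^ q * μ) ^ (1/q) := by gcongr
    _ = ENNReal.ofReal B * μ ^ (1/q) := by
        rw [ENNReal.mul_rpow_of_nonneg _ _ (by positivity), ← ENNReal.rpow_mul, mul_one_div_cancel hq0.ne', ENNReal.rpow_one]
    _ ≤ μ⁻¹ * μ ^ (1/q) := by
        gcongr
        rw [ENNReal.le_inv_iff_mul_le]; exact hBm
    _ = _ := by
        rw [sub_eq_add_neg, ENNReal.rpow_add _ _ hμ0 hμt, ENNReal.rpow_neg_one, mul_comm]

def FD (n : ℕ) (q α t : ℝ) (F : En n → ℂ) : Prop :=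
  ∃ (K : ℕ) (a : ℕ → En n → ℂ) (l : ℕ → ℂ), (∀ i, IsAtomCT n q α (a i)) ∧ (∑ i ∈ Finset.range K, ‖l i‖ ≤ t) ∧
    ∀ z, ‖z‖ < 1 → F z = ∑ i ∈ Finset.range K, l i * bergProj n α (a i) z

theorem FD_mono {n : ℕ} {q α t s : ℝ} {F : En n → ℂ} (h : FD n q α t F) (hts : t ≤ s) : FD n q α s F := by
  obtain ⟨K, a, l, h1, h2, h3⟩ := h
  exact ⟨K, a, l, h1, h2.trans hts, h3⟩

theorem FD_congr {n : ℕ} {q α t : ℝ} {F G : En n → ℂ} (h : FD n q α t F) (hFG : ∀ z, ‖z‖ < 1 → G z = F z) : FD n q α t G := by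
  obtain ⟨K, a, l, h1, h2, h3⟩ := h
  exact ⟨K, a, l, h1, h2, fun z hz => (hFG z hz).trans (h3 z hz)⟩

theorem FD_atom {n : ℕ} {q α : ℝ} {a : En n → ℂ} (h : IsAtomCT n q α a) : FD n q α 1 (bergProj n α a) :=
  ⟨1, fun _ => a, fun _ => 1, fun _ => h, by simp, fun z _ => by simp⟩

theorem FD_zero (n : ℕ) (q α : ℝ) : FD n q α 0 (fun _ => 0) :=
  ⟨0, fun _ _ => 1, fun _ => 1, fun _ => Or.inl rfl, by simp, fun z _ => by simp⟩

theorem FD_smul {n : ℕ} {q α t : ℝ} {F : En n → ℂ} (h : FD n q α t F) (c : ℂ) : FD n q α (‖c‖ * t) (fun z => c * F z) := by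
  obtain ⟨K, a, l, h1, h2, h3⟩ := h
  refine ⟨K, a, fun i => c * l i, h1, ?_, fun z hz => ?_⟩
  · simp only [norm_mul, ← Finset.mul_sum]; gcongr
  · simp only [h3 z hz, Finset.mul_sum, mul_assoc]

theorem FD_add {n : ℕ} {q α t s : ℝ} {F G : En n → ℂ} (h : FD n q α t F) (h' : FD n q α s G) : FD n q α (t + s) (fun z => F z + G z) := by
  obtain ⟨K, a, l, h1, h2, h3⟩ := h
  obtain ⟨K', a', l', h1', h2', h3'⟩ := h'
  refine ⟨K + K', fun i => if i < K then a i else a' (i - K), fun i => if i < K then l i else l' (i - K), ?_, ?_, fun z hz => ?_⟩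
  · intro i; dsimp only; split_ifs
    · exact h1 i
    · exact h1' _
  · rw [Finset.sum_range_add]
    have e1 : ∑ x ∈ Finset.range K, ‖if x < K then l x else l' (x - K)‖ = ∑ x ∈ Finset.range K, ‖l x‖ :=
      Finset.sum_congr rfl fun x hx => by rw [if_pos (Finset.mem_range.1 hx)]
    rw [e1]; simp; linarith
  · beta_reduce; rw [h3 z hz, h3' z hz, Finset.sum_range_add]
    congr 1
    · exact Finset.sum_congr rfl fun x hx => by rw [if_pos (Finset.mem_range.1 hx), if_pos (Finset.mem_range.1 hx)]
    · exact Finset.sum_congr rfl fun x hx => by simp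

theorem FD_sum {n : ℕ} {q α : ℝ} (t : ℕ → ℝ) (F : ℕ → En n → ℂ) (K : ℕ) (h : ∀ i, FD n q α (t i) (F i)) :
    FD n q α (∑ i ∈ Finset.range K, t i) (fun z => ∑ i ∈ Finset.range K, F i z) := by
  induction K with
  | zero => simpa using FD_zero n q α
  | succ K ih => simp only [Finset.sum_range_succ]; exact FD_add ih (h K)

theorem bp_integrable {n : ℕ} (hn : 1 ≤ n) (α : ℝ) (hα : -1 < α) (a : En n → ℂ) (ha : Measurable a) (B : ℝ) (hB : ∀ u, ‖a u‖ ≤ B) (z : En n) (hz : ‖z‖ < 1) :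
    Integrable (fun w => a w / (1 - herm z w) ^ ((((n : ℝ) + 1 + α : ℝ)) : ℂ)) (measA n α) := by
  have := isFinite_measA hn α hα
  apply Integrable.of_bound (C := B * (1 - ‖z‖) ^ (-((n:ℝ) + 1 + α)))
  · exact (ha.div (measurable_K1 _ z)).aestronglyMeasurable
  · filter_upwards [measA_ae n α] with w hw
    have h0 : 0 < 1 - ‖z‖ := by linarith
    have hlt : ‖z‖ * ‖w‖ < 1 := by nlinarith [norm_nonneg z, norm_nonneg w]
    have hne := one_sub_herm_ne z w hlt
    have h1 : 1 - ‖z‖ ≤ ‖1 - herm z w‖ := le_trans (by nlinarith [norm_nonneg z]) (le_one_sub_herm z w)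
    rw [norm_div, norm_cpow_re _ _ hne, div_eq_mul_inv, ← Real.rpow_neg (norm_nonneg _)]
    have hB0 : 0 ≤ B := (norm_nonneg _).trans (hB 0)
    apply mul_le_mul (hB w) _ (by positivity) hB0
    exact Real.rpow_le_rpow_of_nonpos h0 h1 (by have := npos (n := n) hα; linarith)

theorem bp_smul {n : ℕ} (α : ℝ) (a : En n → ℂ) (c : ℂ) (z : En n) : bergProj n α (fun u => c * a u) z = c * bergProj n α a z := by
  unfold bergProj
  rw [← integral_const_mul]
  simp only [mul_div_assoc]

theorem bp_zero {n : ℕ} (α : ℝ) (a : En n → ℂ) : bergProj n α a 0 = ∫ z, a z ∂measA n α := by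
  unfold bergProj
  simp [herm]



def tj {n : ℕ} (α : ℝ) (j : ℕ) (ζ : En n) (δ : ℝ) (z : En n) : ℂ :=
  (δ:ℂ) ^ j * (herm z ζ) ^ j * (1 - (1 - (δ:ℂ)) * herm z ζ) ^ (-(((n:ℝ) + 1 + α + j : ℝ) : ℂ))

theorem piece_pos {n : ℕ} (hn : 1 ≤ n) (q α : ℝ) (hq : 1 < q) (hα : -1 < α) (j : ℕ) (hj : j ≠ 0) : ∃ M : ℝ, 0 < M ∧
    ∀ (ζ : En n) (δ : ℝ), ‖ζ‖ = 1 → 0 < δ → δ ≤ 1 → FD n q α M (tj α j ζ δ) := by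
  obtain ⟨C, hC, h⟩ := proj_a hn α hα
  obtain ⟨c, hc, h⟩ := h j
  obtain ⟨C', hC', hup⟩ := upper_TT hn α hα
  set N : ℝ := (n:ℝ) + 1 + α with hN
  have h2N : 0 < (2:ℝ) ^ N := by positivity
  set A : ℝ := C * C' * 2 ^ N with hA
  have hApos : 0 < A := by positivity
  refine ⟨A / c, by positivity, fun ζ δ hζ hδ hδ1 => ?_⟩
  obtain ⟨a, ha1, ha2, ha3, ha4⟩ := h ζ δ hζ hδ hδ1
  have hδN : 0 < δ ^ N := Real.rpow_pos_of_pos hδ _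
  have hat : IsAtomCT n q α (fun u => ((A⁻¹ : ℝ) : ℂ) * a u) := by
    apply atom_of_bdd hn q α hq hα ζ hζ (2 * δ) (by positivity) (by linarith) _ (A⁻¹ * (C * δ ^ (-N)))
    · have := Real.rpow_nonneg hδ.le (-N); positivity
    · intro u hu; beta_reduce; rw [ha2 u hu, mul_zero]
    · intro u
      rw [norm_mul, Complex.norm_real, Real.norm_of_nonneg (by positivity)]
      gcongr
      exact ha3 u
    · calc _ ≤ ENNReal.ofReal (A⁻¹ * (C * δ ^ (-N))) * ENNReal.ofReal (C' * (2 * δ) ^ N) := by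
            gcongr
            exact hup ζ (2 * δ) hζ (by positivity)
        _ = ENNReal.ofReal 1 := by
            have := Real.rpow_nonneg hδ.le (-N)
            rw [← ENNReal.ofReal_mul (by positivity), Real.mul_rpow (by norm_num) hδ.le, Real.rpow_neg hδ.le, hA]
            congr 1
            field_simp
        _ ≤ 1 := by simp
    · rw [integral_const_mul, ← bp_zero, ha4 0 (by simp)]
      simp [herm, hj]
  apply FD_congr (FD_mono (FD_smul (FD_atom hat) ((A / c : ℝ) : ℂ)) _)
  · intro z hz
    rw [bp_smul, ha4 z hz, tj, ← hN]
    have : (A:ℂ) ≠ 0 := by exact_mod_cast hApos.ne'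
    have : (c:ℂ) ≠ 0 := by exact_mod_cast hc.ne'
    push_cast
    field_simp
  · rw [Complex.norm_real, Real.norm_of_nonneg (by positivity), mul_one]

theorem piece_zero {n : ℕ} (hn : 1 ≤ n) (q α : ℝ) (hq : 1 < q) (hα : -1 < α) (m : ℕ) (hm : (n:ℝ) + 1 + α ≤ m) : ∃ M : ℝ, 0 < M ∧
    ∀ (ζ : En n) (δ : ℝ), ‖ζ‖ = 1 → 0 < δ → δ ≤ 1 → FD n q α M (fun z => (δ:ℂ) ^ m * tj α 0 ζ δ z) := by
  obtain ⟨C, hC, h⟩ := proj_a hn α hα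
  obtain ⟨c, hc, h⟩ := h 0
  have hfin := isFinite_measA hn α hα
  set μ : ℝ := (measA n α).real Set.univ with hμ
  have hμ0 : 0 < μ := by
    obtain ⟨ζ, hζ⟩ := exists_unit hn
    obtain ⟨x, hx, h⟩ := lower_TT hn α hα
    have h1 := h ζ 1 hζ one_pos (by norm_num)
    have h2 : 0 < ENNReal.ofReal (x * 1 ^ ((n:ℝ) + 1 + α)) := ENNReal.ofReal_pos.2 (by simpa using hx)
    have h3 : 0 < measA n α Set.univ := h2.trans_le (h1.trans (measure_mono (Set.subset_univ _)))
    exact ENNReal.toReal_pos h3.ne' (measure_ne_top _ _)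
  set A : ℝ := 2 * C * μ with hA
  have hApos : 0 < A := by positivity
  refine ⟨(C + A) / c, by positivity, fun ζ δ hζ hδ hδ1 => ?_⟩
  obtain ⟨a, ha1, ha2, ha3, ha4⟩ := h ζ δ hζ hδ hδ1
  set b : En n → ℂ := fun u => (δ:ℂ) ^ m * a u with hb
  have hb1 : Measurable b := ha1.const_mul _
  have hb3 : ∀ u, ‖b u‖ ≤ C := by
    intro u
    rw [hb]; beta_reduce
    rw [norm_mul, norm_pow, Complex.norm_real, Real.norm_of_nonneg hδ.le]
    calc _ ≤ δ ^ m * (C * δ ^ (-((n:ℝ) + 1 + α))) := by gcongr; exact ha3 u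
      _ = C * δ ^ ((m:ℝ) - ((n:ℝ) + 1 + α)) := by
          rw [sub_eq_add_neg, Real.rpow_add hδ, Real.rpow_natCast]; ring
      _ ≤ C * 1 := by
          gcongr
          exact Real.rpow_le_one hδ.le hδ1 (by linarith)
      _ = C := mul_one _
  have hbz : ∀ z : En n, ‖z‖ < 1 → bergProj n α b z = (c:ℂ) * ((δ:ℂ) ^ m * tj α 0 ζ δ z) := by
    intro z hz
    rw [hb, bp_smul, ha4 z hz, tj]; ring
  have hbi : Integrable b (measA n α) := Integrable.of_bound hb1.aestronglyMeasurable C (Eventually.of_forall hb3)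
  set μ0 : ℂ := (∫ u, b u ∂measA n α) / (μ:ℂ) with hμ0d
  have hμ0n : ‖μ0‖ ≤ C := by
    rw [hμ0d, norm_div, Complex.norm_real, Real.norm_of_nonneg hμ0.le, div_le_iff₀ hμ0]
    exact norm_integral_le_of_norm_le_const (Eventually.of_forall hb3)
  have hTT : ∀ u : En n, ‖u‖ < 1 → u ∈ TT ζ 4 := by
    intro u hu
    refine ⟨hu, ?_⟩
    have h1 := norm_herm_le u ζ
    have h2 := norm_sub_le (1:ℂ) (herm u ζ)
    rw [hζ] at h1
    rw [norm_one] at h2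
    linarith
  have hat : IsAtomCT n q α (fun u => ((A⁻¹ : ℝ) : ℂ) * (uball n).indicator (fun u => b u - μ0) u) := by
    apply atom_of_bdd hn q α hq hα ζ hζ 4 (by norm_num) le_rfl _ (A⁻¹ * (2 * C))
    · positivity
    · intro u hu
      beta_reduce
      rw [Set.indicator_of_notMem, mul_zero]
      intro h; exact hu (hTT u (mem_uball.1 h))
    · intro u
      rw [norm_mul, Complex.norm_real, Real.norm_of_nonneg (by positivity)]
      gcongr
      apply (norm_indicator_le_norm_self _ _).trans
      apply (norm_sub_le _ _).trans
      linarith [hb3 u]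
    · calc _ ≤ ENNReal.ofReal (A⁻¹ * (2 * C)) * ENNReal.ofReal μ := by
            gcongr
            rw [hμ, ofReal_measureReal]
            exact measure_mono (Set.subset_univ _)
        _ = ENNReal.ofReal 1 := by
            rw [← ENNReal.ofReal_mul (by positivity), hA]
            congr 1
            field_simp
        _ ≤ 1 := by simp
    · rw [integral_const_mul]
      have : ∫ u, (uball n).indicator (fun u => b u - μ0) u ∂measA n α = ∫ u, (b u - μ0) ∂measA n α := by
        apply integral_congr_ae
        filter_upwards [measA_ae n α] with u hu
        rw [Set.indicator_of_mem (mem_uball.2 hu)]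
      rw [this, integral_sub hbi (integrable_const _), integral_const, hμ0d, ← hμ, Complex.real_smul]
      have : (μ:ℂ) ≠ 0 := by exact_mod_cast hμ0.ne'
      field_simp
      simp
  have hone : IsAtomCT n q α (fun _ => 1) := Or.inl rfl
  apply FD_congr (FD_mono (FD_add (FD_smul (FD_atom hat) ((A / c : ℝ) : ℂ)) (FD_smul (FD_atom hone) (μ0 / c))) _)
  · intro z hz
    have hc' : (c:ℂ) ≠ 0 := by exact_mod_cast hc.ne'
    have hA' : (A:ℂ) ≠ 0 := by exact_mod_cast hApos.ne'
    have e1 : bergProj n α ((uball n).indicator (fun u => b u - μ0)) z = bergProj n α b z - μ0 * bergProj n α (fun _ => 1) z := by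
      rw [bp_congr α _ (fun u => b u - μ0 * 1), ← bp_smul]
      · unfold bergProj
        rw [← integral_sub (bp_integrable hn α hα b hb1 C hb3 z hz) (bp_integrable hn α hα _ (by fun_prop) (‖μ0 * 1‖) (fun _ => le_rfl) z hz)]
        simp only [sub_div]
      · filter_upwards [measA_ae n α] with u hu
        rw [Set.indicator_of_mem (mem_uball.2 hu), mul_one]
    rw [bp_smul, e1, hbz z hz]
    push_cast
    field_simp
    ring
  · rw [Complex.norm_real, Real.norm_of_nonneg (by positivity), mul_one, mul_one, norm_div, Complex.norm_real, Real.norm_of_nonneg hc.le, add_div]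
    have : ‖μ0‖ / c ≤ C / c := by gcongr
    linarith

theorem kern_FD {n : ℕ} (hn : 1 ≤ n) (q α : ℝ) (hq : 1 < q) (hα : -1 < α) (m : ℕ) (hm : (n:ℝ) + 1 + α ≤ m) : ∃ M : ℝ, 0 < M ∧
    ∀ w : En n, ‖w‖ < 1 → FD n q α M (fun z => (((1 - ‖w‖) ^ m : ℝ) : ℂ) * (1 - herm z w) ^ (-(((n:ℝ) + 1 + α + m : ℝ) : ℂ))) := by
  have key : ∀ j : ℕ, ∃ M : ℝ, 0 < M ∧ ∀ (ζ : En n) (δ : ℝ), ‖ζ‖ = 1 → 0 < δ → δ ≤ 1 →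
      FD n q α M (fun z => ((m.choose j : ℂ) * (1 - (δ:ℂ)) ^ j * (δ:ℂ) ^ (m - j)) * tj α j ζ δ z) := by
    intro j
    by_cases hj : j = 0
    · subst hj
      obtain ⟨M, hM, h⟩ := piece_zero hn q α hq hα m hm
      refine ⟨M, hM, fun ζ δ hζ hδ hδ1 => ?_⟩
      simpa using h ζ δ hζ hδ hδ1
    · obtain ⟨M, hM, h⟩ := piece_pos hn q α hq hα j hj
      refine ⟨(m.choose j + 1) * M, by positivity, fun ζ δ hζ hδ hδ1 => ?_⟩
      apply FD_mono (FD_smul (h ζ δ hζ hδ hδ1) _)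
      gcongr
      have e : (m.choose j : ℂ) * (1 - (δ:ℂ)) ^ j * (δ:ℂ) ^ (m - j) = (((m.choose j : ℝ) * (1 - δ) ^ j * δ ^ (m - j) : ℝ) : ℂ) := by push_cast; ring
      have h1 : (1 - δ) ^ j ≤ 1 := pow_le_one₀ (by linarith) (by linarith)
      have h2 : δ ^ (m - j) ≤ 1 := pow_le_one₀ hδ.le hδ1
      have h3 : 0 ≤ (1 - δ) ^ j := pow_nonneg (by linarith) _
      rw [e, Complex.norm_real, Real.norm_of_nonneg (by positivity), mul_assoc]
      have h4 : (1 - δ) ^ j * δ ^ (m - j) ≤ 1 := mul_le_one₀ h1 (by positivity) h2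
      have h5 : (0:ℝ) ≤ m.choose j := by positivity
      nlinarith
  choose M hM h using key
  refine ⟨∑ j ∈ Finset.range (m+1), M j, Finset.sum_pos (fun j _ => hM j) (by simp), fun w hw => ?_⟩
  obtain ⟨ζ, hζ, hwζ⟩ := exists_dir hn w
  have hδ : 0 < 1 - ‖w‖ := by linarith
  have h1 := FD_sum M _ (m+1) (fun j => h j ζ (1 - ‖w‖) hζ hδ (by linarith [norm_nonneg w]))
  apply FD_congr h1
  intro z hz
  have hx : herm z w = (1 - ((1 - ‖w‖ : ℝ) : ℂ)) * herm z ζ := by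
    conv_lhs => rw [hwζ]
    rw [herm_smul_right, Complex.conj_ofReal]
    push_cast; ring
  have hne : 1 - herm z w ≠ 0 := one_sub_herm_ne z w (by nlinarith [norm_nonneg z, norm_nonneg w])
  simp only [tj, ← hx]
  set X : ℂ := herm z w with hX
  set N : ℝ := (n:ℝ) + 1 + α
  set δ : ℝ := 1 - ‖w‖
  have hb := add_pow X (1 - X) m
  rw [add_sub_cancel, one_pow] at hb
  calc _ = (((δ) ^ m : ℝ) : ℂ) * (1 - X) ^ (-((N + m : ℝ) : ℂ)) * 1 := by ring
    _ = (((δ) ^ m : ℝ) : ℂ) * (1 - X) ^ (-((N + m : ℝ) : ℂ)) * ∑ i ∈ Finset.range (m + 1), X ^ i * (1 - X) ^ (m - i) * (m.choose i : ℂ) := by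
      rw [← hb]
    _ = _ := by
      rw [Finset.mul_sum]
      apply Finset.sum_congr rfl
      intro j hj
      have hjm : j ≤ m := by have := Finset.mem_range.1 hj; omega
      have e1 : (1 - X) ^ (-((N + j : ℝ) : ℂ)) = (1 - X) ^ (-((N + m : ℝ) : ℂ)) * (1 - X) ^ (m - j) := by
        rw [← Complex.cpow_natCast, ← Complex.cpow_add _ _ hne]
        congr 1
        push_cast [Nat.cast_sub hjm]
        ring
      have e2 : (((δ) ^ m : ℝ) : ℂ) = (δ:ℂ) ^ (m - j) * (δ:ℂ) ^ j := by
        rw [← pow_add, Nat.sub_add_cancel hjm]; push_cast; rfl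
      have e3 : X ^ j = (1 - (δ:ℂ)) ^ j * herm z ζ ^ j := by rw [← mul_pow, ← hx]
      rw [e1, e2, e3]
      ring



theorem lp_integral {X Y : Type*} [MeasurableSpace X] [MeasurableSpace Y] (ν : Measure X) (μ : Measure Y) [SFinite ν] [SFinite μ]
    (Φ : X → Lp ℂ 1 μ) (hΦ : Integrable Φ ν) (ker : X → Y → ℂ) (hk : Integrable (Function.uncurry ker) (ν.prod μ))
    (h : ∀ᵐ w ∂ν, Φ w =ᵐ[μ] ker w) : (∫ w, Φ w ∂ν : Lp ℂ 1 μ) =ᵐ[μ] fun z => ∫ w, ker w z ∂ν := by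
  apply Integrable.ae_eq_of_forall_setIntegral_eq _ _ (L1.integrable_coeFn _) hk.integral_prod_right
  intro s hs _
  let ℓ : Lp ℂ 1 μ →L[ℂ] ℂ :=
    { toFun := fun f => ∫ z in s, f z ∂μ
      map_add' := fun f g => by
        rw [← integral_add (L1.integrable_coeFn f).integrableOn (L1.integrable_coeFn g).integrableOn]
        apply setIntegral_congr_ae hs
        filter_upwards [Lp.coeFn_add f g] with z hz _
        rw [hz]; rfl
      map_smul' := fun c f => by
        rw [RingHom.id_apply, ← integral_smul]
        apply setIntegral_congr_ae hs
        filter_upwards [Lp.coeFn_smul c f] with z hz _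
        rw [hz]; rfl
      cont := continuous_setIntegral s }
  have e1 : ℓ (∫ w, Φ w ∂ν) = ∫ w, ℓ (Φ w) ∂ν := (ContinuousLinearMap.integral_comp_comm ℓ hΦ).symm
  have e2 : ∫ w, ℓ (Φ w) ∂ν = ∫ w, ∫ z in s, ker w z ∂μ ∂ν := by
    apply integral_congr_ae
    filter_upwards [h] with w hw
    exact setIntegral_congr_ae hs (by filter_upwards [hw] with z hz _; exact hz)
  have e3 : ∫ w, ∫ z in s, ker w z ∂μ ∂ν = ∫ z in s, ∫ w, ker w z ∂ν ∂μ := by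
    apply integral_integral_swap
    have : ν.prod (μ.restrict s) = (ν.prod μ).restrict (Set.univ ×ˢ s) := by
      rw [← Measure.prod_restrict, Measure.restrict_univ]
    rw [this]
    exact hk.integrableOn
  exact e1.trans (e2.trans e3)

def kf {n : ℕ} (α : ℝ) (m : ℕ) (w z : En n) : ℂ :=
  (((1 - ‖w‖) ^ m : ℝ) : ℂ) * (1 - herm z w) ^ (-(((n:ℝ) + 1 + α + m : ℝ) : ℂ))

theorem mK2 {n : ℕ} (c : ℂ) : Measurable (fun p : En n × En n => (1 - herm p.2 p.1) ^ c) := by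
  have h : Measurable (fun p : En n × En n => herm p.2 p.1) := by
    unfold herm
    apply Continuous.measurable
    fun_prop
  exact (h.const_sub 1).pow_const c

theorem mK1 {n : ℕ} (c : ℂ) (w : En n) : Measurable (fun z : En n => (1 - herm z w) ^ c) := by
  have h : Measurable (fun z : En n => herm z w) := by
    unfold herm
    apply Continuous.measurable
    fun_prop
  exact (h.const_sub 1).pow_const c

theorem kf_meas {n : ℕ} (α : ℝ) (m : ℕ) : Measurable (Function.uncurry (kf (n := n) α m)) := by
  have h1 : Measurable (fun p : En n × En n => (((1 - ‖p.1‖) ^ m : ℝ) : ℂ)) := by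
    apply Continuous.measurable; fun_prop
  exact h1.mul (mK2 _)

theorem kf_meas1 {n : ℕ} (α : ℝ) (m : ℕ) (w : En n) : Measurable (kf α m w) :=
  (mK1 _ w).const_mul _

theorem kf_norm {n : ℕ} (α : ℝ) (m : ℕ) (w z : En n) (hw : ‖w‖ < 1) (hz : ‖z‖ < 1) :
    ‖kf α m w z‖ = (1 - ‖w‖) ^ m * ‖1 - herm z w‖ ^ (-((n:ℝ) + 1 + α) - m) := by
  have hne : 1 - herm z w ≠ 0 := one_sub_herm_ne z w (by nlinarith [norm_nonneg z, norm_nonneg w])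
  have e : (-(((n:ℝ) + 1 + α + m : ℝ) : ℂ)) = ((-((n:ℝ) + 1 + α) - m : ℝ) : ℂ) := by push_cast; ring
  rw [kf, norm_mul, e, norm_cpow_re _ _ hne, Complex.norm_real, Real.norm_of_nonneg (pow_nonneg (by linarith) _)]

theorem kf_L1 {n : ℕ} (hn : 1 ≤ n) (α : ℝ) (hα : -1 < α) (m : ℕ) (hm : 0 < m) : ∃ C : ℝ, 0 < C ∧ ∀ w : En n, ‖w‖ < 1 →
    ∫⁻ z, ‖kf α m w z‖ₑ ∂measA n α ≤ ENNReal.ofReal C := by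
  obtain ⟨C, hC, h⟩ := ker_full hn α m hα (by exact_mod_cast hm)
  refine ⟨C, hC, fun w hw => ?_⟩
  have hw0 : 0 < 1 - ‖w‖ := by linarith
  calc _ = ∫⁻ z, ENNReal.ofReal ((1 - ‖w‖) ^ m) * ENNReal.ofReal (‖1 - herm z w‖ ^ (-((n:ℝ) + 1 + α) - m)) ∂measA n α := by
        apply lintegral_congr_ae
        filter_upwards [measA_ae n α] with z hz
        rw [← ENNReal.ofReal_mul (by positivity), ← kf_norm α m w z hw hz, ofReal_norm]
    _ = ENNReal.ofReal ((1 - ‖w‖) ^ m) * ∫⁻ z, ENNReal.ofReal (‖1 - herm z w‖ ^ (-((n:ℝ) + 1 + α) - m)) ∂measA n α :=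
        lintegral_const_mul' _ _ ENNReal.ofReal_ne_top
    _ ≤ ENNReal.ofReal ((1 - ‖w‖) ^ m) * ENNReal.ofReal (C * (1 - ‖w‖) ^ (-(m:ℝ))) := by
        gcongr
        exact h w hw
    _ = ENNReal.ofReal C := by
        rw [← ENNReal.ofReal_mul (by positivity), Real.rpow_neg hw0.le, Real.rpow_natCast]
        congr 1
        field_simp

theorem kf_int {n : ℕ} (hn : 1 ≤ n) (α : ℝ) (hα : -1 < α) (m : ℕ) (hm : 0 < m) (w : En n) (hw : ‖w‖ < 1) :
    Integrable (kf α m w) (measA n α) := by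
  obtain ⟨C, hC, h⟩ := kf_L1 hn α hα m hm
  exact ⟨(kf_meas1 α m w).aestronglyMeasurable, (h w hw).trans_lt ENNReal.ofReal_lt_top⟩

theorem kf_hol {n : ℕ} (α : ℝ) (m : ℕ) (w : En n) (hw : ‖w‖ < 1) : DifferentiableOn ℂ (kf α m w) (uball n) := by
  intro z hz
  have hz' := mem_uball.1 hz
  apply DifferentiableAt.differentiableWithinAt
  unfold kf
  apply DifferentiableAt.const_mul
  apply DifferentiableAt.cpow
  · unfold herm; fun_prop
  · fun_prop
  · left; exact re_pos z w (by nlinarith [norm_nonneg z, norm_nonneg w])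

def Kl {n : ℕ} (hn : 1 ≤ n) (α : ℝ) (hα : -1 < α) (m : ℕ) (hm : 0 < m) (w : En n) : Lp ℂ 1 (measA n α) :=
  if hw : ‖w‖ < 1 then (kf_int hn α hα m hm w hw).toL1 _ else 0

theorem Kl_ae {n : ℕ} (hn : 1 ≤ n) (α : ℝ) (hα : -1 < α) (m : ℕ) (hm : 0 < m) (w : En n) (hw : ‖w‖ < 1) :
    Kl hn α hα m hm w =ᵐ[measA n α] kf α m w := by
  rw [Kl, dif_pos hw]
  exact Integrable.coeFn_toL1 _

theorem Kl_cont {n : ℕ} (hn : 1 ≤ n) (α : ℝ) (hα : -1 < α) (m : ℕ) (hm : 0 < m) : ContinuousOn (Kl (n := n) hn α hα m hm) (uball n) := by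
  have hfin := isFinite_measA hn α hα
  intro w hw
  have hw' := mem_uball.1 hw
  apply ContinuousAt.continuousWithinAt
  obtain ⟨r, hr1, hr2⟩ := exists_between hw'
  have hev : ∀ᶠ v in 𝓝 w, ‖v‖ < r := continuous_norm.continuousAt.eventually_lt continuousAt_const hr1
  rw [ContinuousAt, tendsto_iff_norm_sub_tendsto_zero]
  have h1 : Tendsto (fun v => ∫ z, ‖kf α m v z - kf α m w z‖ ∂measA n α) (𝓝 w) (𝓝 (∫ z, (0:ℝ) ∂measA n α)) := by
    apply tendsto_integral_filter_of_dominated_convergence (fun _ => 2 * (1 - r) ^ (-((n:ℝ) + 1 + α) - m))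
    · exact Eventually.of_forall fun v => ((kf_meas1 α m v).sub (kf_meas1 α m w)).norm.aestronglyMeasurable
    · have hb : ∀ v z : En n, ‖v‖ < r → ‖z‖ < 1 → ‖kf α m v z‖ ≤ (1 - r) ^ (-((n:ℝ) + 1 + α) - m) := by
        intro v z hv hz
        rw [kf_norm α m v z (hv.trans hr2) hz]
        have h2 := le_one_sub_herm' z v hz.le
        have h3 : (1 - ‖v‖) ^ m ≤ 1 := pow_le_one₀ (by linarith) (by linarith [norm_nonneg v])
        have h4 : ‖1 - herm z v‖ ^ (-((n:ℝ) + 1 + α) - m) ≤ (1 - r) ^ (-((n:ℝ) + 1 + α) - m) :=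
          Real.rpow_le_rpow_of_nonpos (by linarith) (by linarith) (by
            have := npos (n := n) hα
            have h5 : (0:ℝ) ≤ m := Nat.cast_nonneg m
            linarith)
        calc _ ≤ 1 * (1 - r) ^ (-((n:ℝ) + 1 + α) - m) := by gcongr
          _ = _ := one_mul _
      filter_upwards [hev] with v hv
      filter_upwards [measA_ae n α] with z hz
      rw [norm_norm]
      apply (norm_sub_le _ _).trans
      linarith [hb v z hv hz, hb w z hr1 hz]
    · exact integrable_const _
    · filter_upwards [measA_ae n α] with z hz
      rw [← tendsto_iff_norm_sub_tendsto_zero]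
      have : ContinuousAt (fun v => kf α m v z) w := by
        unfold kf
        apply ContinuousAt.mul
        · fun_prop
        · apply ContinuousAt.cpow
          · have := continuous_herm_right z
            fun_prop
          · fun_prop
          · left; exact re_pos z w (by nlinarith [norm_nonneg z, norm_nonneg w])
      exact this
  rw [integral_zero] at h1
  apply h1.congr'
  filter_upwards [hev] with v hv
  rw [L1.norm_eq_integral_norm]
  apply integral_congr_ae
  filter_upwards [Lp.coeFn_sub (Kl hn α hα m hm v) (Kl hn α hα m hm w), Kl_ae hn α hα m hm v (hv.trans hr2), Kl_ae hn α hα m hm w hw'] with z h1 h2 h3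
  rw [h1, Pi.sub_apply, h2, h3]

theorem Kl_norm {n : ℕ} (hn : 1 ≤ n) (α : ℝ) (hα : -1 < α) (m : ℕ) (hm : 0 < m) : ∃ C : ℝ, 0 < C ∧ ∀ w, ‖Kl (n := n) hn α hα m hm w‖ ≤ C := by
  obtain ⟨C, hC, h⟩ := kf_L1 hn α hα m hm
  refine ⟨C, hC, fun w => ?_⟩
  by_cases hw : ‖w‖ < 1
  · rw [Kl, dif_pos hw, Integrable.norm_toL1_eq_lintegral_enorm]
    exact ENNReal.toReal_le_of_le_ofReal hC.le (h w hw)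
  · rw [Kl, dif_neg hw, norm_zero]; exact hC.le



def SS (n : ℕ) (q α M : ℝ) : Set (Lp ℂ 1 (measA n α)) :=
  {x | ∃ F : En n → ℂ, FD n q α M F ∧ DifferentiableOn ℂ F (uball n) ∧ x =ᵐ[measA n α] F}

theorem SS_convex (n : ℕ) (q α M : ℝ) : Convex ℝ (SS n q α M) := by
  rintro x ⟨F, hF1, hF2, hF3⟩ y ⟨G, hG1, hG2, hG3⟩ a b ha hb hab
  refine ⟨fun z => (a:ℂ) * F z + (b:ℂ) * G z, ?_, ?_, ?_⟩
  · apply FD_mono (FD_add (FD_smul hF1 _) (FD_smul hG1 _))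
    rw [Complex.norm_real, Complex.norm_real, Real.norm_of_nonneg ha, Real.norm_of_nonneg hb, ← add_mul, hab, one_mul]
  · exact (hF2.const_mul _).add (hG2.const_mul _)
  · filter_upwards [Lp.coeFn_add (a • x) (b • y), Lp.coeFn_smul a x, Lp.coeFn_smul b y, hF3, hG3] with z h1 h2 h3 h4 h5
    rw [h1, Pi.add_apply, h2, h3, Pi.smul_apply, Pi.smul_apply, h4, h5, Complex.real_smul, Complex.real_smul]

theorem SS_K {n : ℕ} (hn : 1 ≤ n) (q α : ℝ) (hα : -1 < α) (m : ℕ) (hm : 0 < m) (M : ℝ) (hM : 0 ≤ M)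
    (h : ∀ w : En n, ‖w‖ < 1 → FD n q α M (kf α m w)) (w : En n) (hw : ‖w‖ < 1) (c : ℂ) (hc : ‖c‖ ≤ 1) :
    c • Kl hn α hα m hm w ∈ SS n q α M := by
  refine ⟨fun z => c * kf α m w z, FD_mono (FD_smul (h w hw) c) ?_, (kf_hol α m w hw).const_mul _, ?_⟩
  · exact mul_le_of_le_one_left hM hc
  · filter_upwards [Lp.coeFn_smul c (Kl hn α hα m hm w), Kl_ae hn α hα m hm w hw] with z h1 h2
    rw [h1, Pi.smul_apply, h2, smul_eq_mul]

theorem ker_integrable {X : Type*} [MeasurableSpace X] (μ : Measure X) [SFinite μ] (φ : X → ℂ) (hφi : Integrable φ μ) (k : X → X → ℂ)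
    (hk : Measurable (Function.uncurry k)) (C : ℝ) (hC : 0 ≤ C) (h : ∀ᵐ w ∂μ, ∫⁻ z, ‖k w z‖ₑ ∂μ ≤ ENNReal.ofReal C) :
    Integrable (Function.uncurry fun w z => φ w * k w z) (μ.prod μ) := by
  have hms : AEStronglyMeasurable (Function.uncurry fun w z => φ w * k w z) (μ.prod μ) := by
    have h1 : AEStronglyMeasurable (fun p : X × X => φ p.1) (μ.prod μ) := hφi.1.comp_fst
    exact h1.mul hk.aestronglyMeasurable
  have hk1 : ∀ w, Measurable (k w) := fun w => hk.comp measurable_prodMk_left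
  rw [integrable_prod_iff hms]
  constructor
  · filter_upwards [h] with w hw
    have : Integrable (k w) μ := ⟨(hk1 w).aestronglyMeasurable, hw.trans_lt ENNReal.ofReal_lt_top⟩
    exact this.const_mul (φ w)
  · apply Integrable.mono' (g := fun w => C * ‖φ w‖) (hφi.norm.const_mul _)
    · exact hms.norm.integral_prod_right'
    · filter_upwards [h] with w hw
      simp only [Function.uncurry, norm_mul]
      rw [integral_const_mul, norm_mul, norm_norm, mul_comm]
      gcongr
      rw [Real.norm_of_nonneg (integral_nonneg fun _ => norm_nonneg _), integral_norm_eq_lintegral_enorm (hk1 w).aestronglyMeasurable]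
      exact ENNReal.toReal_le_of_le_ofReal hC hw

theorem approx {n : ℕ} (hn : 1 ≤ n) (q α : ℝ) (hq : 1 < q) (hα : -1 < α) : ∃ C : ℝ, 0 < C ∧ ∀ g : En n → ℂ,
    DifferentiableOn ℂ g (uball n) → Integrable g (measA n α) → ∃ h : En n → ℂ, FD n q α (C * ∫ z, ‖g z‖ ∂measA n α) h ∧
      DifferentiableOn ℂ h (uball n) ∧ Integrable h (measA n α) ∧ ∫ z, ‖g z - h z‖ ∂measA n α ≤ (1/2) * ∫ z, ‖g z‖ ∂measA n α := by
  have hfin := isFinite_measA hn α hα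
  obtain ⟨m, hmN⟩ := exists_nat_ge ((n:ℝ) + 1 + α)
  have hN := npos (n := n) hα
  have hm : 0 < m := by
    have : (0:ℝ) < m := by linarith
    exact_mod_cast this
  have hm' : 0 < α + m := by
    have : (1:ℝ) ≤ m := by exact_mod_cast hm
    linarith
  obtain ⟨M, hM, hFD⟩ := kern_FD hn q α hq hα m hmN
  obtain ⟨κ, hκ⟩ := repro3 (n := n) α hα m hm'
  obtain ⟨CK, hCK, hKn⟩ := Kl_norm hn α hα m hm
  obtain ⟨CL, hCL, hKL⟩ := kf_L1 hn α hα m hm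
  refine ⟨(‖κ‖ + 1) * 2 ^ m * M, by positivity, fun g hg hgi => ?_⟩
  set G : ℝ := ∫ z, ‖g z‖ ∂measA n α with hG
  have hG0 : 0 ≤ G := integral_nonneg fun _ => norm_nonneg _
  rcases hG0.eq_or_lt with hz | hGpos
  · refine ⟨fun _ => 0, ?_, differentiableOn_const 0, integrable_const 0, ?_⟩
    · rw [← hz, mul_zero]; exact FD_zero n q α
    · simp only [sub_zero, ← hG, ← hz]; simp
  set φ : En n → ℂ := fun w => (κ * (((1 + ‖w‖) ^ m : ℝ) : ℂ)) * g w with hφ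
  have hφb : ∀ᵐ w ∂measA n α, ‖κ * (((1 + ‖w‖) ^ m : ℝ) : ℂ)‖ ≤ (‖κ‖ + 1) * 2 ^ m := by
    filter_upwards [measA_ae n α] with w hw
    rw [norm_mul, Complex.norm_real, Real.norm_of_nonneg (by positivity)]
    gcongr <;> linarith
  have hφi : Integrable φ (measA n α) := by
    apply Integrable.bdd_mul hgi _ hφb
    apply Continuous.aestronglyMeasurable; fun_prop
  have hac : measA n α ≪ (vol n).restrict (uball n) := withDensity_absolutelyContinuous _ _
  have hKm : AEStronglyMeasurable (Kl hn α hα m hm) (measA n α) :=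
    ((Kl_cont hn α hα m hm).aestronglyMeasurable (measurableSet_uball n)).mono_ac hac
  have hΦ : Integrable (fun w => φ w • Kl hn α hα m hm w) (measA n α) :=
    hφi.smul_bdd _ hKm (Eventually.of_forall hKn)
  have hker : Integrable (Function.uncurry fun w z => φ w * kf α m w z) ((measA n α).prod (measA n α)) := by
    apply ker_integrable _ φ hφi _ (kf_meas α m) CL hCL.le
    filter_upwards [measA_ae n α] with w hw
    exact hKL w hw
  set x0 : Lp ℂ 1 (measA n α) := ∫ w, φ w • Kl hn α hα m hm w ∂measA n α with hx0
  have hx0g : x0 =ᵐ[measA n α] g := by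
    have h1 := lp_integral (measA n α) (measA n α) _ hΦ _ hker (by
      filter_upwards [measA_ae n α] with w hw
      filter_upwards [Lp.coeFn_smul (φ w) (Kl hn α hα m hm w), Kl_ae hn α hα m hm w hw] with z h1 h2
      rw [h1, Pi.smul_apply, h2, smul_eq_mul])
    filter_upwards [h1, measA_ae n α] with z hz hz1
    rw [hx0, hz, hκ g hg hgi z hz1, ← integral_const_mul]
    congr 1; funext w
    rw [hφ, kf]
    have : (1 - ‖w‖^2)^m = (1 - ‖w‖)^m * (1 + ‖w‖)^m := by rw [← mul_pow]; congr 1; ring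
    rw [this]
    push_cast
    ring
  set T : ℝ := (‖κ‖ + 1) * 2 ^ m * G with hT
  have hTpos : 0 < T := by positivity
  have hφT : ∫ w, ‖φ w‖ ∂measA n α ≤ T := by
    rw [hT, hG, ← integral_const_mul]
    apply integral_mono_ae hφi.norm (hgi.norm.const_mul _)
    filter_upwards [hφb] with w hw
    rw [hφ]; beta_reduce
    rw [norm_mul]
    gcongr
  have hmem : (T⁻¹ : ℝ) • x0 ∈ closure (SS n q α M) := by
    by_contra hnot
    obtain ⟨ℓ, u, hu1, hu2⟩ := geometric_hahn_banach_closed_point (SS_convex n q α M).closure isClosed_closure hnot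
    have h0 : 0 < u := by
      have := hu1 _ (subset_closure (SS_K hn q α hα m hm M hM.le hFD 0 (by simp) 0 (by simp)))
      simpa using this
    have h1 : ℓ x0 ≤ u * T := by
      rw [hx0, ← ContinuousLinearMap.integral_comp_comm ℓ hΦ]
      calc _ ≤ ∫ w, u * ‖φ w‖ ∂measA n α := by
            apply integral_mono_ae (ℓ.integrable_comp hΦ) (hφi.norm.const_mul _)
            filter_upwards [measA_ae n α] with w hw
            have hc : ‖φ w / (‖φ w‖ : ℂ)‖ ≤ 1 := by
              rw [norm_div, Complex.norm_real, norm_norm]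
              exact div_self_le_one _
            have h2 := hu1 _ (subset_closure (SS_K hn q α hα m hm M hM.le hFD w hw _ hc))
            have h3 : φ w • Kl hn α hα m hm w = ‖φ w‖ • ((φ w / (‖φ w‖ : ℂ)) • Kl hn α hα m hm w) := by
              rw [RCLike.real_smul_eq_coe_smul (K := ℂ), smul_smul]
              congr 1
              by_cases h : φ w = 0
              · simp [h]
              · have : (‖φ w‖ : ℂ) ≠ 0 := by simpa using h
                field_simp
                simp
            beta_reduce
            rw [h3, map_smul, smul_eq_mul, mul_comm]
            gcongr
        _ = u * ∫ w, ‖φ w‖ ∂measA n α := integral_const_mul _ _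
        _ ≤ _ := by gcongr
    rw [map_smul, smul_eq_mul] at hu2
    have : T⁻¹ * ℓ x0 ≤ T⁻¹ * (u * T) := by gcongr
    have h2 : T⁻¹ * (u * T) = u := by field_simp
    linarith
  rw [Metric.mem_closure_iff] at hmem
  obtain ⟨y, ⟨F, hF1, hF2, hF3⟩, hy⟩ := hmem (G / (2 * T)) (by positivity)
  have hFi : Integrable F (measA n α) := (L1.integrable_coeFn y).congr hF3
  refine ⟨fun z => (T:ℂ) * F z, ?_, hF2.const_mul _, hFi.const_mul _, ?_⟩
  · apply FD_mono (FD_smul hF1 _)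
    rw [Complex.norm_real, Real.norm_of_nonneg hTpos.le, hT]
    apply le_of_eq; ring
  · have e1 : ∫ z, ‖g z - (T:ℂ) * F z‖ ∂measA n α = T * dist (T⁻¹ • x0) y := by
      rw [dist_eq_norm, L1.norm_eq_integral_norm, ← integral_const_mul]
      apply integral_congr_ae
      filter_upwards [Lp.coeFn_sub (T⁻¹ • x0) y, Lp.coeFn_smul T⁻¹ x0, hx0g, hF3] with z h1 h2 h3 h4
      rw [h1, Pi.sub_apply, h2, Pi.smul_apply, h3, h4, Complex.real_smul]
      have : (T:ℂ) ≠ 0 := by exact_mod_cast hTpos.ne'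
      have e2 : g z - (T:ℂ) * F z = (T:ℂ) * (((T⁻¹:ℝ):ℂ) * g z - F z) := by
        push_cast
        field_simp
      rw [e2, norm_mul, Complex.norm_real, Real.norm_of_nonneg hTpos.le]
    rw [e1]
    calc _ ≤ T * (G / (2 * T)) := by gcongr
      _ = _ := by field_simp



theorem concat {E : Type*} [NormedAddCommGroup E] [NormedSpace ℂ E] [CompleteSpace E] (l : ℕ → ℕ → ℂ) (B : ℕ → ℕ → E) (K : ℕ → ℕ)
    (CA : ℝ) (hB : ∀ k i, ‖B k i‖ ≤ CA) (hl : ∀ k i, i ∉ Finset.range (K k) → l k i = 0) (c : ℕ → ℝ) (S : ℝ) (hc : HasSum c S)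
    (hlc : ∀ k, ∑ i ∈ Finset.range (K k), ‖l k i‖ ≤ c k) (f : E)
    (hf : Tendsto (fun L => ∑ k ∈ Finset.range L, ∑ i ∈ Finset.range (K k), l k i • B k i) atTop (𝓝 f)) :
    Tendsto (fun L => ∑ p ∈ Finset.range L, l p.unpair.1 p.unpair.2 • B p.unpair.1 p.unpair.2) atTop (𝓝 f) ∧
    Summable (fun p : ℕ => ‖l p.unpair.1 p.unpair.2‖) ∧ ∑' p : ℕ, ‖l p.unpair.1 p.unpair.2‖ ≤ S := by
  have hfib : ∀ k, HasSum (fun i => ‖l k i‖) (∑ i ∈ Finset.range (K k), ‖l k i‖) := fun k =>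
    hasSum_sum_of_ne_finset_zero fun i hi => by rw [hl k i hi, norm_zero]
  have hs : Summable (fun p : ℕ × ℕ => ‖l p.1 p.2‖) := by
    rw [summable_prod_of_nonneg (fun _ => norm_nonneg _)]
    refine ⟨fun k => (hfib k).summable, ?_⟩
    apply Summable.of_nonneg_of_le (fun k => tsum_nonneg fun _ => norm_nonneg _) _ hc.summable
    intro k
    rw [(hfib k).tsum_eq]; exact hlc k
  have hsl : ∑' p : ℕ × ℕ, ‖l p.1 p.2‖ ≤ S := by
    have h1 := hs.hasSum.prod_fiberwise hfib
    exact hasSum_le hlc h1 hc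
  have hv : Summable (fun p : ℕ × ℕ => l p.1 p.2 • B p.1 p.2) := by
    apply Summable.of_norm_bounded (hs.mul_right CA)
    intro p
    rw [norm_smul]
    exact mul_le_mul_of_nonneg_left (hB _ _) (norm_nonneg _)
  have hv2 := hv.hasSum.prod_fiberwise (f := fun p : ℕ × ℕ => l p.1 p.2 • B p.1 p.2) (g := fun k => ∑ i ∈ Finset.range (K k), l k i • B k i) (fun k =>
    hasSum_sum_of_ne_finset_zero fun i hi => by rw [hl k i hi, zero_smul])
  have e := tendsto_nhds_unique hv2.tendsto_sum_nat hf
  have hv3 : HasSum (fun p : ℕ × ℕ => l p.1 p.2 • B p.1 p.2) f := e ▸ hv.hasSum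
  refine ⟨?_, ?_, ?_⟩
  · exact ((Nat.pairEquiv.symm.hasSum_iff (f := fun p : ℕ × ℕ => l p.1 p.2 • B p.1 p.2)).2 hv3).tendsto_sum_nat
  · exact (Nat.pairEquiv.symm.summable_iff (f := fun p : ℕ × ℕ => ‖l p.1 p.2‖)).2 hs
  · exact (Nat.pairEquiv.symm.tsum_eq (fun p : ℕ × ℕ => ‖l p.1 p.2‖)).trans_le hsl

theorem bp_int {n : ℕ} (hn : 1 ≤ n) (q α : ℝ) (hq : 1 < q) (hα : -1 < α) (a : En n → ℂ) (ha : IsAtomCT n q α a) :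
    Integrable (bergProj n α a) (measA n α) := by
  obtain ⟨C, hC, h⟩ := atom_bound hn q α hq hα
  exact ⟨bp_meas hn α hα a, (h a ha).trans_lt ENNReal.ofReal_lt_top⟩

theorem iterate {n : ℕ} (hn : 1 ≤ n) (q α : ℝ) (hq : 1 < q) (hα : -1 < α) : ∃ C : ℝ, 0 < C ∧ ∀ f : En n → ℂ,
    DifferentiableOn ℂ f (uball n) → Integrable f (measA n α) → ∃ h : ℕ → En n → ℂ,
      (∀ k, FD n q α (C * ((1/2) ^ k * ∫ z, ‖f z‖ ∂measA n α)) (h k)) ∧ (∀ k, Integrable (h k) (measA n α)) ∧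
      ∀ L, ∫ z, ‖f z - ∑ k ∈ Finset.range L, h k z‖ ∂measA n α ≤ (1/2) ^ L * ∫ z, ‖f z‖ ∂measA n α := by
  obtain ⟨C, hC, happ⟩ := approx hn q α hq hα
  refine ⟨C, hC, fun f hf hfi => ?_⟩
  let X := {g : En n → ℂ // DifferentiableOn ℂ g (uball n) ∧ Integrable g (measA n α)}
  have happ' : ∀ g : X, ∃ h : X, FD n q α (C * ∫ z, ‖g.1 z‖ ∂measA n α) h.1 ∧ ∫ z, ‖g.1 z - h.1 z‖ ∂measA n α ≤ (1/2) * ∫ z, ‖g.1 z‖ ∂measA n α := by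
    rintro ⟨g, hg1, hg2⟩
    obtain ⟨h, h1, h2, h3, h4⟩ := happ g hg1 hg2
    exact ⟨⟨h, h2, h3⟩, h1, h4⟩
  choose H hH1 hH2 using happ'
  let r : ℕ → X := fun k => Nat.rec (motive := fun _ => X) ⟨f, hf, hfi⟩ (fun _ g => ⟨fun z => g.1 z - (H g).1 z, g.2.1.sub (H g).2.1, g.2.2.sub (H g).2.2⟩) k
  have hr : ∀ k z, (r (k+1)).1 z = (r k).1 z - (H (r k)).1 z := fun k z => rfl
  have hb : ∀ k, ∫ z, ‖(r k).1 z‖ ∂measA n α ≤ (1/2) ^ k * ∫ z, ‖f z‖ ∂measA n α := by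
    intro k
    induction k with
    | zero => simp only [pow_zero, one_mul]; exact le_rfl
    | succ k ih =>
      simp only [hr]
      apply (hH2 (r k)).trans
      rw [pow_succ]
      linarith
  refine ⟨fun k => (H (r k)).1, fun k => ?_, fun k => (H (r k)).2.2, fun L => ?_⟩
  · apply FD_mono (hH1 (r k))
    gcongr
    exact hb k
  · have : ∀ z, f z - ∑ k ∈ Finset.range L, (H (r k)).1 z = (r L).1 z := by
      intro z
      induction L with
      | zero => simp only [Finset.range_zero, Finset.sum_empty, sub_zero]; rfl
      | succ L ih => rw [Finset.sum_range_succ, hr, ← ih]; ring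
    simp only [this]
    exact hb L

theorem upper_dec {n : ℕ} (hn : 1 ≤ n) (q α : ℝ) (hq : 1 < q) (hα : -1 < α) : ∃ C : ℝ, 0 < C ∧ ∀ f : En n → ℂ,
    DifferentiableOn ℂ f (uball n) → Integrable f (measA n α) →
      ∃ t ∈ atomDecompSums n q α f, t ≤ ENNReal.ofReal C * ∫⁻ z, ENNReal.ofReal ‖f z‖ ∂measA n α := by
  obtain ⟨C, hC, hit⟩ := iterate hn q α hq hα
  obtain ⟨CA, hCA, hat⟩ := atom_bound hn q α hq hα
  refine ⟨2 * C, by positivity, fun f hf hfi => ?_⟩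
  obtain ⟨h, h1, h2, h3⟩ := hit f hf hfi
  set G : ℝ := ∫ z, ‖f z‖ ∂measA n α with hG
  choose K a l ha hl hz using h1
  set l' : ℕ → ℕ → ℂ := fun k i => if i ∈ Finset.range (K k) then l k i else 0 with hl'
  have hl'e : ∀ k i, i ∈ Finset.range (K k) → l' k i = l k i := fun k i hi => if_pos hi
  set B : ℕ → ℕ → Lp ℂ 1 (measA n α) := fun k i => (bp_int hn q α hq hα (a k i) (ha k i)).toL1 _ with hB
  have hBa : ∀ k i, B k i =ᵐ[measA n α] bergProj n α (a k i) := fun k i => Integrable.coeFn_toL1 _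
  have hall : ∀ᵐ z ∂measA n α, ∀ k i, B k i z = bergProj n α (a k i) z := by
    rw [ae_all_iff]; intro k; rw [ae_all_iff]; intro i; exact hBa k i
  have hsm : ∀ (s : Finset ℕ) (v : ℕ → Lp ℂ 1 (measA n α)), ∀ᵐ z ∂measA n α, (∑ i ∈ s, v i : Lp ℂ 1 (measA n α)) z = ∑ i ∈ s, v i z := by
    intro s v
    filter_upwards [Lp.coeFn_finsetSum s v] with z hz
    rw [hz, Finset.sum_apply]
  have hsc : ∀ᵐ z ∂measA n α, ∀ k i, (l' k i • B k i : Lp ℂ 1 (measA n α)) z = l' k i * B k i z := by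
    rw [ae_all_iff]; intro k; rw [ae_all_iff]; intro i
    filter_upwards [Lp.coeFn_smul (l' k i) (B k i)] with z hz
    rw [hz]; rfl
  set fl : Lp ℂ 1 (measA n α) := hfi.toL1 _ with hfl
  have hfla : fl =ᵐ[measA n α] f := Integrable.coeFn_toL1 _
  have key := concat l' B K CA
    (fun k i => by
      rw [hB]; beta_reduce
      rw [Integrable.norm_toL1_eq_lintegral_enorm]
      exact ENNReal.toReal_le_of_le_ofReal hCA.le (hat _ (ha k i)))
    (fun k i hi => if_neg hi) (fun k => C * ((1/2) ^ k * G)) (C * (2 * G))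
    ((hasSum_geometric_two.mul_right G).mul_left C)
    (fun k => by
      rw [Finset.sum_congr rfl fun i hi => by rw [hl'e k i hi]]
      exact hl k) fl
    (by
      rw [tendsto_iff_norm_sub_tendsto_zero]
      have hlim : Tendsto (fun L : ℕ => (1/2:ℝ) ^ L * G) atTop (𝓝 0) := by
        have := (tendsto_pow_atTop_nhds_zero_of_lt_one (r := (1/2:ℝ)) (by norm_num) (by norm_num)).mul_const G
        simpa using this
      apply squeeze_zero (fun _ => norm_nonneg _) _ hlim
      intro L
      rw [norm_sub_rev, L1.norm_eq_integral_norm]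
      apply le_trans (le_of_eq _) (h3 L)
      apply integral_congr_ae
      have hin : ∀ᵐ z ∂measA n α, ∀ k, (∑ i ∈ Finset.range (K k), l' k i • B k i : Lp ℂ 1 (measA n α)) z = ∑ i ∈ Finset.range (K k), (l' k i • B k i : Lp ℂ 1 (measA n α)) z := by
        rw [ae_all_iff]; intro k; exact hsm _ _
      filter_upwards [Lp.coeFn_sub fl (∑ k ∈ Finset.range L, ∑ i ∈ Finset.range (K k), l' k i • B k i), hsm (Finset.range L) (fun k => ∑ i ∈ Finset.range (K k), l' k i • B k i), hin, hsc, hall, hfla, measA_ae n α] with z e1 e2 e3 e4 e5 e6 e7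
      rw [e1, Pi.sub_apply, e2, e6]
      congr 2
      apply Finset.sum_congr rfl
      intro k _
      rw [e3 k, hz k z e7]
      apply Finset.sum_congr rfl
      intro i hi
      rw [e4, e5, hl'e k i hi])
  obtain ⟨k1, k2, k3⟩ := key
  refine ⟨∑' p : ℕ, ENNReal.ofReal ‖l' p.unpair.1 p.unpair.2‖, ⟨fun p => a p.unpair.1 p.unpair.2, fun p => l' p.unpair.1 p.unpair.2, fun p => ha _ _, ?_, rfl⟩, ?_⟩
  · rw [tendsto_iff_norm_sub_tendsto_zero] at k1
    have k4 := ENNReal.tendsto_ofReal k1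
    rw [ENNReal.ofReal_zero] at k4
    apply k4.congr
    intro L
    rw [norm_sub_rev, L1.norm_eq_integral_norm, ofReal_integral_norm_eq_lintegral_enorm (L1.integrable_coeFn _)]
    apply lintegral_congr_ae
    filter_upwards [Lp.coeFn_sub fl (∑ p ∈ Finset.range L, l' p.unpair.1 p.unpair.2 • B p.unpair.1 p.unpair.2), hsm (Finset.range L) (fun p => l' p.unpair.1 p.unpair.2 • B p.unpair.1 p.unpair.2), hsc, hall, hfla] with z e1 e2 e4 e5 e6
    rw [e1, Pi.sub_apply, e2, e6, ofReal_norm]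
    congr 2
    apply Finset.sum_congr rfl
    intro i hi
    rw [e4, e5]
  · rw [← ENNReal.ofReal_tsum_of_nonneg (fun _ => norm_nonneg _) k2]
    have e : ∫⁻ z, ENNReal.ofReal ‖f z‖ ∂measA n α = ENNReal.ofReal G := by
      rw [hG, ofReal_integral_norm_eq_lintegral_enorm hfi]
      simp only [ofReal_norm]
    rw [e, ← ENNReal.ofReal_mul (by positivity)]
    apply ENNReal.ofReal_le_ofReal
    linarith

theorem lower_dec {n : ℕ} (hn : 1 ≤ n) (q α : ℝ) (hq : 1 < q) (hα : -1 < α) : ∃ C : ℝ, 0 < C ∧ ∀ f : En n → ℂ,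
    Integrable f (measA n α) →
      ∀ t ∈ atomDecompSums n q α f, ∫⁻ z, ENNReal.ofReal ‖f z‖ ∂measA n α ≤ ENNReal.ofReal C * t := by
  obtain ⟨CA, hCA, hat⟩ := atom_bound hn q α hq hα
  refine ⟨CA, hCA, ?_⟩
  rintro f hfi t ⟨a, l, ha, hlim, rfl⟩
  set T := ∑' i, ENNReal.ofReal ‖l i‖ with hT
  have hbd : ∀ L : ℕ, ∫⁻ z, ENNReal.ofReal ‖f z‖ ∂measA n α ≤
      ∫⁻ z, ENNReal.ofReal ‖f z - ∑ i ∈ Finset.range L, l i * bergProj n α (a i) z‖ ∂measA n α + ENNReal.ofReal CA * T := by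
    intro L
    have hsumm : AEMeasurable (fun z => ∑ i ∈ Finset.range L, l i * bergProj n α (a i) z) (measA n α) := by
      apply Finset.aemeasurable_fun_sum
      intro i _
      exact (bp_meas hn α hα (a i)).aemeasurable.const_mul _
    calc _ ≤ ∫⁻ z, (ENNReal.ofReal ‖f z - ∑ i ∈ Finset.range L, l i * bergProj n α (a i) z‖ + ∑ i ∈ Finset.range L, ENNReal.ofReal ‖l i‖ * ‖bergProj n α (a i) z‖ₑ) ∂measA n α := by
          apply lintegral_mono
          intro z
          simp only [ofReal_norm]
          calc ‖f z‖ₑ = ‖(f z - ∑ i ∈ Finset.range L, l i * bergProj n α (a i) z) + ∑ i ∈ Finset.range L, l i * bergProj n α (a i) z‖ₑ := by rw [sub_add_cancel]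
            _ ≤ _ := (enorm_add_le _ _).trans (by
                gcongr
                apply (enorm_sum_le _ _).trans
                simp only [enorm_mul]; exact le_rfl)
      _ = ∫⁻ z, ENNReal.ofReal ‖f z - ∑ i ∈ Finset.range L, l i * bergProj n α (a i) z‖ ∂measA n α + ∫⁻ z, ∑ i ∈ Finset.range L, ENNReal.ofReal ‖l i‖ * ‖bergProj n α (a i) z‖ₑ ∂measA n α := by
          apply lintegral_add_left'
          exact (hfi.1.aemeasurable.sub hsumm).norm.ennreal_ofReal
      _ ≤ _ := by
          gcongr
          rw [lintegral_finsetSum' _ (fun i _ => (bp_meas hn α hα (a i)).enorm.const_mul _)]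
          calc _ ≤ ∑ i ∈ Finset.range L, ENNReal.ofReal CA * ENNReal.ofReal ‖l i‖ := by
                apply Finset.sum_le_sum
                intro i _
                rw [lintegral_const_mul' _ _ ENNReal.ofReal_ne_top, mul_comm]
                gcongr
                exact hat _ (ha i)
            _ ≤ _ := by
                rw [← Finset.mul_sum]
                gcongr
                exact ENNReal.sum_le_tsum _
  have := ge_of_tendsto' (hlim.add_const (ENNReal.ofReal CA * T)) hbd
  simpa using this

/-- Real-variable atomic decomposition of `A¹_α` with respect to
Carleson tubes. -/
theorem stmt4 (n : ℕ) (hn : 1 ≤ n) (q α : ℝ) (hq : 1 < q) (hα : -1 < α) :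
    ∃ C : ℝ≥0∞, 0 < C ∧ C < ⊤ ∧
      ∀ f : En n → ℂ, DifferentiableOn ℂ f (uball n) →
        (∫⁻ z, ENNReal.ofReal ‖f z‖ ∂measA n α) < ⊤ →
        (∃ t ∈ atomDecompSums n q α f,
            t ≤ C * ∫⁻ z, ENNReal.ofReal ‖f z‖ ∂measA n α) ∧
        (C⁻¹ * sInf (atomDecompSums n q α f) ≤ ∫⁻ z, ENNReal.ofReal ‖f z‖ ∂measA n α ∧
          (∫⁻ z, ENNReal.ofReal ‖f z‖ ∂measA n α) ≤ C * sInf (atomDecompSums n q α f)) := by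
  obtain ⟨C1, hC1, h1⟩ := upper_dec hn q α hq hα
  obtain ⟨C2, hC2, h2⟩ := lower_dec hn q α hq hα
  refine ⟨ENNReal.ofReal (max C1 C2), ENNReal.ofReal_pos.2 (lt_max_of_lt_left hC1), ENNReal.ofReal_lt_top, fun f hf hfin => ?_⟩
  have hac : measA n α ≪ (vol n).restrict (uball n) := withDensity_absolutelyContinuous _ _
  have hfi : Integrable f (measA n α) := by
    refine ⟨((hf.continuousOn).aestronglyMeasurable (measurableSet_uball n)).mono_ac hac, ?_⟩
    simpa only [HasFiniteIntegral, ofReal_norm] using hfin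
  obtain ⟨t, ht, htb⟩ := h1 f hf hfi
  have hC0 : ENNReal.ofReal (max C1 C2) ≠ 0 := (ENNReal.ofReal_pos.2 (lt_max_of_lt_left hC1)).ne'
  have hb : t ≤ ENNReal.ofReal (max C1 C2) * ∫⁻ z, ENNReal.ofReal ‖f z‖ ∂measA n α := by
    apply htb.trans
    gcongr
    exact le_max_left _ _
  refine ⟨⟨t, ht, hb⟩, ?_, ?_⟩
  · calc _ ≤ (ENNReal.ofReal (max C1 C2))⁻¹ * (ENNReal.ofReal (max C1 C2) * ∫⁻ z, ENNReal.ofReal ‖f z‖ ∂measA n α) := by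
          gcongr
          exact (sInf_le ht).trans hb
      _ = _ := by rw [← mul_assoc, ENNReal.inv_mul_cancel hC0 ENNReal.ofReal_ne_top, one_mul]
  · rw [mul_comm, ← ENNReal.div_le_iff_le_mul (Or.inl hC0) (Or.inl ENNReal.ofReal_ne_top)]
    apply le_sInf
    intro s hs
    rw [ENNReal.div_le_iff_le_mul (Or.inl hC0) (Or.inl ENNReal.ofReal_ne_top), mul_comm]
    apply (h2 f hfi s hs).trans
    gcongr
    exact le_max_right _ _
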